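/- arXiv:2007.09958 — 2 statements merged into one kernel-verified Lean document; each statement's English description precedes it below -/
import Mathlib

section
/- For all integers n ≥ 1 and d ≥ 2, a general homogeneous polynomial F of degree d in n+2 complex variables has the following property: for every nonzero point P ∈ ℂ^{n+2} with F(P) = 0, the Galois group of the splitting field of the polynomial f_{F,P}(t) over K is isomorphic to the symmetric group S_{d−1}. (Equivalently: every point of ℙ^{n+1} lying on a general degree-d hypersurface X ⊂ ℙ^{n+1} is a uniform point, i.e., the monodromy group of the degree-(d−1) linear projection of X from that inner point is the full symmetric group S_{d−1}.) -/
set_option synthInstance.maxHeartbeats 1000000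
set_option maxHeartbeats 1000000

/-- The field `K = ℂ(Q₁, …, Q_m)` of rational functions in `m` variables over `ℂ`. -/
noncomputable abbrev RatFuncField (m : ℕ) : Type :=
  FractionRing (MvPolynomial (Fin m) ℂ)

/-- `f_{F,P}(t) = F(Q₁ + t·P₁, …, Q_m + t·P_m) ∈ K[t]`, obtained by substituting
`x_i ↦ Q_i + t·P_i` in `F`. -/
noncomputable def fFP {m : ℕ} (F : MvPolynomial (Fin m) ℂ) (P : Fin m → ℂ) :
    Polynomial (RatFuncField m) :=
  MvPolynomial.eval₂
    ((Polynomial.C : RatFuncField m →+* Polynomial (RatFuncField m)).comp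
      ((algebraMap (MvPolynomial (Fin m) ℂ) (RatFuncField m)).comp
        (MvPolynomial.C : ℂ →+* MvPolynomial (Fin m) ℂ)))
    (fun i =>
      Polynomial.C (algebraMap (MvPolynomial (Fin m) ℂ) (RatFuncField m) (MvPolynomial.X i)) +
        Polynomial.C (algebraMap (MvPolynomial (Fin m) ℂ) (RatFuncField m)
          (MvPolynomial.C (P i))) * Polynomial.X)
    F

section SymmetricGroup

open Polynomial

/-- Coefficientwise expression of `∏_σ (X - Σ u_i x_{σ i})` in elementary symmetric polynomials. -/
theorem exists_monic_map_esymmAlgHom_eq_prod_perm {D : ℕ} (u : Fin D → ℤ) :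
    ∃ W : (MvPolynomial (Fin D) ℤ)[X], W.Monic ∧ W.natDegree = D.factorial ∧
      W.map (MvPolynomial.aeval
          (fun i : Fin D => MvPolynomial.esymm (Fin D) ℤ (i + 1))).toRingHom =
        ∏ σ : Equiv.Perm (Fin D),
          (X - C (∑ i, MvPolynomial.C (u i) * MvPolynomial.X (σ i))) := by
  set p : (MvPolynomial (Fin D) ℤ)[X] :=
    ∏ σ : Equiv.Perm (Fin D), (X - C (∑ i, MvPolynomial.C (u i) * MvPolynomial.X (σ i))) with hp
  have hinv (τ : Equiv.Perm (Fin D)) :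
      p.map (MvPolynomial.rename τ : MvPolynomial (Fin D) ℤ →ₐ[ℤ] _).toRingHom = p := by
    rw [hp, Polynomial.map_prod]
    refine Fintype.prod_equiv (Equiv.mulLeft τ) _ _ fun σ => ?_
    simp [Polynomial.map_sum]
  have hmonic : p.Monic := monic_prod_X_sub_C _ _
  have hdeg : p.natDegree = D.factorial := by
    rw [hp, natDegree_finsetProd_X_sub_C_eq_card]
    simp [Fintype.card_perm]
  have hlift : p ∈ lifts ((MvPolynomial.aeval (R := ℤ)
      (fun i : Fin D => MvPolynomial.esymm (Fin D) ℤ (i + 1))).toRingHom) := by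
    rw [lifts_iff_coeff_lifts]
    intro k
    have hk : p.coeff k ∈ MvPolynomial.symmetricSubalgebra (Fin D) ℤ := by
      intro τ
      conv_rhs => rw [← hinv τ]
      simp
    obtain ⟨q, hq⟩ := MvPolynomial.esymmAlgHom_surjective ℤ (σ := Fin D) (n := D) (by simp)
      ⟨_, hk⟩
    refine ⟨q, ?_⟩
    have := congrArg Subtype.val hq
    rwa [MvPolynomial.esymmAlgHom_apply] at this
  obtain ⟨W, hW, hWd, hWm⟩ := lifts_and_natDegree_eq_and_monic hlift hmonic
  exact ⟨W, hWm, hWd.trans hdeg, hW⟩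

namespace Polynomial

section Resolvent

variable {D : ℕ} (u : Fin D → ℤ) {R S : Type*} [CommRing R] [CommRing S]

/-- The resolvent of a monic polynomial of degree `D` with roots `τ_i`:
the polynomial whose roots are `Σ u_i τ_{σ i}` for the permutations `σ`. -/
noncomputable def resolvent (p : R[X]) : R[X] :=
  (exists_monic_map_esymmAlgHom_eq_prod_perm u).choose.map
    (MvPolynomial.eval₂Hom (Int.castRingHom R)
      (fun i : Fin D => (-1) ^ ((i : ℕ) + 1) * p.coeff (D - 1 - i)))

theorem resolvent_map (φ : R →+* S) (p : R[X]) :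
    resolvent u (p.map φ) = (resolvent u p).map φ := by
  rw [resolvent, resolvent, Polynomial.map_map]
  congr 1
  ext <;> simp

theorem monic_resolvent (p : R[X]) : (resolvent u p).Monic :=
  (exists_monic_map_esymmAlgHom_eq_prod_perm u).choose_spec.1.map _

theorem natDegree_resolvent [Nontrivial R] (p : R[X]) :
    (resolvent u p).natDegree = D.factorial :=
  ((exists_monic_map_esymmAlgHom_eq_prod_perm u).choose_spec.1.natDegree_map _).trans
    (exists_monic_map_esymmAlgHom_eq_prod_perm u).choose_spec.2.1

theorem resolvent_prod_X_sub_C (τ : Fin D → R) :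
    resolvent u (∏ i, (X - C (τ i))) =
      ∏ σ : Equiv.Perm (Fin D), (X - C (∑ i, (u i : R) * τ (σ i))) := by
  have hW := (exists_monic_map_esymmAlgHom_eq_prod_perm u).choose_spec.2.2
  have := congrArg (Polynomial.map (MvPolynomial.aeval τ).toRingHom) hW
  rw [Polynomial.map_map, Polynomial.map_prod] at this
  convert this using 1
  · rw [resolvent]
    congr 1
    ext i
    · simp
    · have hi : D - (D - 1 - (i : ℕ)) = i + 1 := by omega
      have hc : (∏ i, (X - C (τ i))).coeff (D - 1 - i) =
          (-1) ^ ((i : ℕ) + 1) * (Finset.univ.val.map τ).esymm (i + 1) := by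
        have := Multiset.prod_X_sub_C_coeff (Finset.univ.val.map τ) (k := D - 1 - i)
          (by simp; omega)
        simp only [Multiset.map_map, Multiset.card_map, Finset.card_val, Finset.card_univ,
          Fintype.card_fin, hi] at this
        exact this
      simp only [MvPolynomial.coe_eval₂Hom, MvPolynomial.eval₂_X, hc, AlgHom.toRingHom_eq_coe,
        RingHom.coe_comp, RingHom.coe_coe, Function.comp_apply, MvPolynomial.aeval_X,
        MvPolynomial.aeval_esymm_eq_multiset_esymm]
      rw [← mul_assoc, ← mul_pow]
      simp
  · refine Finset.prod_congr rfl fun σ _ => ?_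
    simp [Polynomial.map_sum]

theorem exists_eq_prod_fin_of_splits [IsDomain R] {p : R[X]} (hp : p.Monic) (hs : p.Splits)
    (hd : p.natDegree = D) : ∃ τ : Fin D → R, p = ∏ i, (X - C (τ i)) := by
  have h := hs.eq_prod_roots_of_monic hp
  have hc : p.roots.card = D := by rw [← hs.natDegree_eq_card_roots, hd]
  obtain ⟨l, hl⟩ : ∃ l : List R, (l : Multiset R) = p.roots := ⟨p.roots.toList, by simp⟩
  rw [← hl] at h hc
  have hlen : l.length = D := by simpa using hc
  subst hlen
  refine ⟨fun i => l.get i, ?_⟩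
  conv_lhs => rw [h]
  rw [Multiset.map_coe, Multiset.prod_coe, ← List.prod_ofFn]
  congr 1
  apply List.ext_get <;> simp

theorem resolvent_scaleRoots [IsDomain R] {p : R[X]} (hp : p.Monic)
    (hd : p.natDegree = D) (a : R) :
    resolvent u (p.scaleRoots a) = (resolvent u p).scaleRoots a := by
  let L := AlgebraicClosure (FractionRing R)
  let φ : R →+* L := (algebraMap (FractionRing R) L).comp (algebraMap R (FractionRing R))
  have hφ : Function.Injective φ :=
    (algebraMap (FractionRing R) L).injective.comp (IsFractionRing.injective R _)
  apply Polynomial.map_injective φ hφ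
  have hm (q : R[X]) (hq : q.Monic) : (q.scaleRoots a).map φ = (q.map φ).scaleRoots (φ a) :=
    map_scaleRoots _ _ _ (by simp [hq.leadingCoeff])
  rw [← resolvent_map, hm _ hp, hm _ (monic_resolvent u p), ← resolvent_map]
  obtain ⟨τ, hτ⟩ := exists_eq_prod_fin_of_splits (D := D) (hp.map φ)
    (IsAlgClosed.splits _) (by rw [hp.natDegree_map, hd])
  have hprod {ι : Type} (s : Finset ι) (f : ι → L) (b : L) :
      (∏ i ∈ s, (X - C (f i))).scaleRoots b = ∏ i ∈ s, (X - C (b * f i)) := by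
    classical
    induction s using Finset.induction_on with
    | empty => simp
    | insert i s hi ih =>
      rw [Finset.prod_insert hi, Finset.prod_insert hi, mul_scaleRoots_of_noZeroDivisors, ih,
        X_sub_C_scaleRoots, mul_comm (f i)]
  rw [hτ, hprod, resolvent_prod_X_sub_C, resolvent_prod_X_sub_C, hprod]
  refine Finset.prod_congr rfl fun σ _ => ?_
  rw [Finset.mul_sum]
  congr 2
  exact Finset.sum_congr rfl fun i _ => by ring

end Resolvent

section Monicize

variable (D : ℕ) {R S : Type*} [CommRing R] [CommRing S]

/-- The monic polynomial `a^(D-1) f(X/a)` attached to a polynomial `f` with coefficient `a`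
in degree `D`. -/
noncomputable def monicize (f : R[X]) : R[X] :=
  X ^ D + ∑ i ∈ Finset.range D, C (f.coeff i * f.coeff D ^ (D - 1 - i)) * X ^ i

theorem monicize_map (φ : R →+* S) (f : R[X]) :
    monicize D (f.map φ) = (monicize D f).map φ := by
  simp [monicize, Polynomial.map_sum]

theorem degree_sum_range_lt (c : ℕ → R) :
    (∑ i ∈ Finset.range D, C (c i) * X ^ i).degree < (D : WithBot ℕ) := by
  refine (degree_sum_le _ _).trans_lt
    ((Finset.sup_lt_iff (WithBot.bot_lt_coe D)).2 fun i hi => ?_)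
  exact (degree_C_mul_X_pow_le _ _).trans_lt (Nat.cast_lt.2 (Finset.mem_range.1 hi))

theorem monic_monicize (f : R[X]) : (monicize D f).Monic :=
  monic_X_pow_add (degree_sum_range_lt D _)

theorem natDegree_monicize [Nontrivial R] (f : R[X]) : (monicize D f).natDegree = D := by
  rw [monicize, natDegree_eq_of_degree_eq_some]
  rw [degree_add_eq_left_of_degree_lt, degree_X_pow]
  rw [degree_X_pow]
  exact degree_sum_range_lt D _

theorem coeff_monicize_of_lt (f : R[X]) {i : ℕ} (hi : i < D) :
    (monicize D f).coeff i = f.coeff i * f.coeff D ^ (D - 1 - i) := by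
  simp only [monicize, coeff_add, coeff_X_pow, hi.ne, if_false, zero_add, finsetSum_coeff,
    coeff_C_mul_X_pow]
  simp [hi]

theorem monicize_eq_self {f : R[X]} (hf : f.Monic) (hd : f.natDegree = D) :
    monicize D f = f := by
  nontriviality R
  have hD : f.coeff D = 1 := hd ▸ hf
  ext i
  rcases lt_trichotomy i D with hi | rfl | hi
  · simp [coeff_monicize_of_lt D f hi, hD]
  · rw [hD]
    have := monic_monicize i f
    rwa [Monic, leadingCoeff, natDegree_monicize] at this
  · rw [coeff_eq_zero_of_natDegree_lt (by rwa [natDegree_monicize]),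
      coeff_eq_zero_of_natDegree_lt (by rwa [hd])]

theorem monicize_C_mul (a : R) (f : R[X]) :
    monicize D (C a * f) = (monicize D f).scaleRoots a := by
  nontriviality R
  ext i
  rw [coeff_scaleRoots, natDegree_monicize]
  rcases lt_trichotomy i D with hi | rfl | hi
  · rw [coeff_monicize_of_lt D _ hi, coeff_monicize_of_lt D _ hi, coeff_C_mul, coeff_C_mul,
      mul_pow, show D - i = (D - 1 - i) + 1 by omega]
    ring
  · have h (g : R[X]) : (monicize i g).coeff i = 1 := by
      have := monic_monicize i g
      rwa [Monic, leadingCoeff, natDegree_monicize] at this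
    simp [h]
  · rw [coeff_eq_zero_of_natDegree_lt (by rwa [natDegree_monicize]),
      coeff_eq_zero_of_natDegree_lt (by rwa [natDegree_monicize])]
    simp

theorem monicize_comp_C_mul_X {f : R[X]} (hD : D ≠ 0) (hf : f.natDegree ≤ D) :
    (monicize D f).comp (C (f.coeff D) * X) = C (f.coeff D ^ (D - 1)) * f := by
  have hsum := f.as_sum_range_C_mul_X_pow' (Nat.lt_succ_of_le hf)
  rw [Finset.sum_range_succ] at hsum
  set a := f.coeff D with ha
  conv_rhs => rw [hsum]
  rw [monicize, add_comp, pow_comp, X_comp, sum_comp, ← ha, mul_add, Finset.mul_sum, add_comm]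
  congr 1
  · refine Finset.sum_congr rfl fun i hi => ?_
    have hi := Finset.mem_range.1 hi
    rw [mul_comp, pow_comp, X_comp, C_comp, mul_pow, ← C_pow, ← mul_assoc, ← mul_assoc, ← C_mul,
      ← C_mul, mul_assoc, ← pow_add, mul_comm (f.coeff i), show D - 1 - i + i = D - 1 by omega]
  · rw [mul_pow, ← C_pow, ← mul_assoc, ← C_mul, ← pow_succ, show D - 1 + 1 = D by omega]

end Monicize

end Polynomial

open Classical in
/-- If `f = (X - c)² h - ϖ` where `ϖ` generates a maximal ideal `p` modulo which `(X - c) h` is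
separable, then the inertia group above `p` contains a transposition of the roots of `f`. -/
theorem Polynomial.exists_isSwap_of_eq_sq_mul_sub {R S G : Type*} [CommRing R] [IsDomain R]
    [CommRing S] [IsDedekindDomain S] [Algebra R S] [Module.IsTorsionFree R S]
    [Module.Finite R S] [Module.Flat R S] [Group G] [Finite G] [MulSemiringAction G S]
    [IsGaloisGroup G R S] (ϖ c : R) (h : R[X]) (hϖ : ϖ ≠ 0)
    [(Ideal.span {ϖ}).IsMaximal] [CharZero (R ⧸ Ideal.span {ϖ})]
    (hm : ((X - C c) ^ 2 * h - C ϖ).Monic)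
    (hs : (((X - C c) ^ 2 * h - C ϖ).map (algebraMap R S)).Splits)
    (hsep : (((X - C c) * h).map (Ideal.Quotient.mk (Ideal.span {ϖ}))).Separable)
    (hfaith : ∀ g : G, (∀ x ∈ ((X - C c) ^ 2 * h - C ϖ).rootSet S, g • x = x) → g = 1) :
    ∃ g : G, (MulAction.toPermHom G (((X - C c) ^ 2 * h - C ϖ).rootSet S) g).IsSwap := by
  set f := (X - C c) ^ 2 * h - C ϖ with hf
  set p := Ideal.span {ϖ} with hp
  have hp0 : p ≠ ⊥ := by simpa [hp] using hϖ
  have : FaithfulSMul R S := inferInstance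
  obtain ⟨⟨P, hP, hPp⟩⟩ := (inferInstance : Nonempty (Ideal.primesOver p S))
  have hPmax : P.IsMaximal := Ideal.IsMaximal.of_liesOver_isMaximal P p
  have hmapp : p.map (algebraMap R S) ≤ P := by
    rw [Ideal.map_le_iff_le_comap]
    exact (P.over_def p).le
  let _ : Field (R ⧸ p) := Ideal.Quotient.field p
  have hϖP : algebraMap R (S ⧸ P) ϖ = 0 := by
    rw [IsScalarTower.algebraMap_apply R S, Ideal.Quotient.algebraMap_eq,
      Ideal.Quotient.eq_zero_iff_mem]
    exact hmapp (Ideal.mem_map_of_mem _ (Ideal.mem_span_singleton_self ϖ))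
  have hfP : f.map (algebraMap R (S ⧸ P)) =
      (X - C (algebraMap R (S ⧸ P) c)) ^ 2 * h.map (algebraMap R (S ⧸ P)) := by
    simp [hf, hϖP]
  have hsepP : (((X - C c) * h).map (algebraMap R (S ⧸ P))).Separable := by
    have := hsep.map (f := algebraMap (R ⧸ p) (S ⧸ P))
    rwa [Polynomial.map_map, ← Ideal.Quotient.algebraMap_eq,
      ← IsScalarTower.algebraMap_eq] at this
  have hfP0 : f.map (algebraMap R (S ⧸ P)) ≠ 0 := (hm.map _).ne_zero
  have himage := hs.image_rootSet_of_map_ne_zero (Ideal.Quotient.mkₐ R P) hfP0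
  have hroots : f.rootSet (S ⧸ P) = ((X - C c) * h).rootSet (S ⧸ P) := by
    ext x
    rw [mem_rootSet', mem_rootSet', and_iff_right hfP0, and_iff_right hsepP.ne_zero]
    simp [hf, hϖP]
  obtain ⟨t, ht, htc⟩ : ∃ t ∈ f.rootSet S, Ideal.Quotient.mkₐ R P t = algebraMap R (S ⧸ P) c := by
    rw [← Set.mem_image, himage, mem_rootSet']
    exact ⟨hfP0, by simp [hf, hϖP]⟩
  have hsq : p.map (algebraMap R S) ≤ P ^ 2 := by
    rw [hp, Ideal.map_span, Set.image_singleton, Ideal.span_singleton_le_iff_mem]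
    have h0 : algebraMap R S ϖ = (t - algebraMap R S c) ^ 2 * aeval t h := by
      have := (mem_rootSet'.1 ht).2
      simp only [hf, map_sub, map_mul, map_pow, aeval_X, aeval_C] at this
      exact (sub_eq_zero.1 this).symm
    rw [h0]
    refine Ideal.mul_mem_right _ _ (Ideal.pow_mem_pow ?_ 2)
    rw [← Ideal.Quotient.mk_eq_mk_iff_sub_mem]
    exact htc
  have : CharZero p.ResidueField :=
    charZero_of_injective_algebraMap p.injective_algebraMap_quotient_residueField
  have hcard : Nat.card (P.inertia G) ≠ 1 := by
    rw [Ideal.card_inertia_eq_ramificationIdxIn (G := G) p P,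
      Ideal.ramificationIdxIn_eq_ramificationIdx p P G,
      ← Ideal.ramificationIdx'_eq_ramificationIdx p P hp0,
      Ideal.ramificationIdx'_ne_one_iff hmapp]
    exact hsq
  obtain ⟨g, hg, hg1⟩ : ∃ g ∈ P.inertia G, g ≠ 1 := by
    by_contra! H
    exact hcard (by rw [(Subgroup.eq_bot_iff_forall _).2 H]; simp)
  have hle : (f.rootSet S).ncard ≤ (f.rootSet (S ⧸ P)).ncard + 1 := by
    let _ : Field (S ⧸ P) := Ideal.Quotient.field P
    set q := ((X - C c) * h).map (algebraMap R (S ⧸ P)) with hq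
    have hfq : f.map (algebraMap R (S ⧸ P)) = (X - C (algebraMap R (S ⧸ P) c)) * q := by
      rw [hfP, hq]
      simp only [Polynomial.map_mul, Polynomial.map_sub, map_X, map_C]
      ring
    have hfs : (f.map (algebraMap R (S ⧸ P))).Splits := by
      rw [IsScalarTower.algebraMap_eq R S (S ⧸ P), ← Polynomial.map_map]
      exact hs.map _
    have hqs : q.Splits := hfs.of_dvd hfP0 ⟨_, hfq.trans (mul_comm _ _)⟩
    have h1 : (f.rootSet (S ⧸ P)).ncard = q.natDegree := by
      rw [hroots, rootSet_def, Set.ncard_coe_finset, aroots_def,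
        Multiset.toFinset_card_of_nodup (nodup_roots hsepP), hqs.natDegree_eq_card_roots]
    have h2 : q.natDegree + 1 = f.natDegree := by
      rw [← hm.natDegree_map (algebraMap R (S ⧸ P)), hfq,
        natDegree_mul (X_sub_C_ne_zero _) hsepP.ne_zero, natDegree_X_sub_C, add_comm]
    rw [h1, h2, rootSet_def, Set.ncard_coe_finset]
    exact (Multiset.toFinset_card_le _).trans ((card_roots' _).trans natDegree_map_le)
  refine ⟨g, (hs.toPermHom_apply_eq_one_or_isSwap_of_ncard_le_of_mem_inertia P hle g
    hg).resolve_left fun H => hg1 (hfaith g fun x hx => ?_)⟩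
  exact congrArg Subtype.val (DFunLike.congr_fun H ⟨x, hx⟩)

/-- A subgroup of a symmetric group containing a transposition `(x y)`, and whose stabilizer of `x`
is transitive on the other points, is everything. -/
theorem Equiv.Perm.eq_top_of_swap_mem_of_forall_ne {α : Type*} [Finite α] [DecidableEq α]
    (H : Subgroup (Equiv.Perm α)) {x y : α} (hxy : x ≠ y) (hswap : Equiv.swap x y ∈ H)
    (htrans : ∀ z, z ≠ x → ∃ σ ∈ H, σ x = x ∧ σ y = z) : H = ⊤ := by
  have h1 (z : α) : Equiv.swap x z ∈ H := by
    rcases eq_or_ne z x with rfl | hz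
    · rw [Equiv.swap_self]; exact H.one_mem
    obtain ⟨σ, hσ, hx, hy⟩ := htrans z hz
    have := H.mul_mem (H.mul_mem hσ hswap) (H.inv_mem hσ)
    rwa [← Equiv.swap_apply_apply, hx, hy] at this
  rw [eq_top_iff, ← Equiv.Perm.closure_isSwap, Subgroup.closure_le]
  rintro _ ⟨a, b, hab, rfl⟩
  rcases eq_or_ne a x with rfl | ha
  · exact h1 b
  rcases eq_or_ne b x with rfl | hb
  · rw [Equiv.swap_comm]; exact h1 a
  have := H.mul_mem (H.mul_mem (h1 a) (h1 b)) (H.inv_mem (h1 a))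
  rwa [← Equiv.swap_apply_apply, Equiv.swap_apply_left, Equiv.swap_apply_of_ne_of_ne hb hab.symm]
    at this

section Trinomial

variable (κ : Type*) [Field κ] (D : ℕ)

theorem trinomial_critical [CharZero κ] (hD : 2 ≤ D) : ∃ (c : κ) (h : κ[X]),
    (X ^ D - X ^ (D - 1) : κ[X]) - C (c ^ D - c ^ (D - 1)) = (X - C c) ^ 2 * h ∧
    ((X - C c) * h).Separable := by
  obtain ⟨k, rfl⟩ : ∃ k, D = k + 2 := ⟨D - 2, by omega⟩
  have hk : ((k + 2 : ℕ) : κ) ≠ 0 := by exact_mod_cast (by omega : k + 2 ≠ 0)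
  have hk1 : ((k + 1 : ℕ) : κ) ≠ 0 := by exact_mod_cast (by omega : k + 1 ≠ 0)
  set c : κ := ((k + 1 : ℕ) : κ) / ((k + 2 : ℕ) : κ) with hc
  have hc0 : c ≠ 0 := div_ne_zero hk1 hk
  have hc1 : c ^ (k + 2) - c ^ (k + 1) ≠ 0 := by
    have : c - 1 ≠ 0 := by
      rw [hc, div_sub_one hk]
      refine div_ne_zero ?_ hk
      push_cast
      ring_nf
      norm_num
    rw [pow_succ, show c ^ (k + 1) * c - c ^ (k + 1) = c ^ (k + 1) * (c - 1) by ring]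
    exact mul_ne_zero (pow_ne_zero _ hc0) this
  set B : κ[X] := (X ^ (k + 2) - X ^ (k + 1) : κ[X]) - C (c ^ (k + 2) - c ^ (k + 1)) with hB
  have hB' : derivative B = C ((k + 2 : ℕ) : κ) * X ^ k * (X - C c) := by
    have : C ((k + 2 : ℕ) : κ) * C c = C ((k + 1 : ℕ) : κ) := by
      rw [← C_mul, hc, mul_div_cancel₀ _ hk]
    simp only [hB, derivative_sub, derivative_X_pow, derivative_C, sub_zero]
    rw [mul_sub, mul_assoc _ (X ^ k) (C c), mul_comm (X ^ k) (C c), ← mul_assoc, this]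
    simp only [Nat.add_sub_cancel, Nat.add_succ_sub_one]
    ring
  obtain ⟨q, hq⟩ : X - C c ∣ B := by rw [dvd_iff_isRoot]; simp [hB]
  have hq' : q + (X - C c) * derivative q = C ((k + 2 : ℕ) : κ) * X ^ k * (X - C c) := by
    rw [← hB', hq]; simp [derivative_mul]
  obtain ⟨h, rfl⟩ : X - C c ∣ q := by
    rw [← dvd_add_left (dvd_mul_right (X - C c) (derivative q)), hq']
    exact dvd_mul_left _ _
  refine ⟨c, h, by rw [pow_two, mul_assoc]; exact hq, ?_⟩
  have hh : h + derivative ((X - C c) * h) = C ((k + 2 : ℕ) : κ) * X ^ k := by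
    apply mul_left_cancel₀ (X_sub_C_ne_zero c)
    rw [mul_add, hq', mul_comm]
  rw [Polynomial.separable_def,
    isCoprime_iff_aeval_ne_zero_of_isAlgClosed κ (AlgebraicClosure κ)]
  intro a
  by_contra! H
  obtain ⟨H1, H2⟩ := H
  have e := congrArg (aeval a) hh
  have hBa : aeval a B = 0 := by rw [hq, map_mul, H1, mul_zero]
  have ha : aeval a h = 0 := by
    rcases mul_eq_zero.1 ((map_mul (aeval a) _ _).symm.trans H1) with h0 | h0
    · simp only [derivative_mul, derivative_sub, derivative_X, derivative_C, sub_zero, one_mul,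
        map_add, map_mul, h0, zero_mul, add_zero] at H2
      exact H2
    · exact h0
  rw [map_add, ha, H2, add_zero, map_mul, aeval_C, map_pow, aeval_X, eq_comm, mul_eq_zero,
    map_eq_zero, or_iff_right hk] at e
  have ha0 : a = 0 := eq_zero_of_pow_eq_zero e
  apply hc1
  apply (algebraMap κ (AlgebraicClosure κ)).injective
  rw [map_zero, ← neg_eq_zero, ← map_neg]
  simpa [hB, ha0] using hBa

theorem exists_irreducible_mul_eq_trinomial_sub (hD : 2 ≤ D) : ∃ Φ : κ[X][X], Φ.Monic ∧
    Irreducible Φ ∧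
    (X - C X) * Φ = (X ^ D - X ^ (D - 1) : κ[X][X]) - C (X ^ D - X ^ (D - 1)) := by
  obtain ⟨k, rfl⟩ : ∃ k, D = k + 2 := ⟨D - 2, by omega⟩
  simp only [Nat.add_succ_sub_one]
  set B : κ[X][X] := (X ^ (k + 2) - X ^ (k + 1)) - C (X ^ (k + 2) - X ^ (k + 1)) with hB
  have hdeg : (X ^ (k + 1) + C (X ^ (k + 2) - X ^ (k + 1)) : κ[X][X]).degree <
      ((k + 2 : ℕ) : WithBot ℕ) := by
    refine (degree_add_le _ _).trans_lt (max_lt ?_ ?_)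
    · rw [degree_X_pow]; exact_mod_cast Nat.lt_succ_self _
    · exact degree_C_le.trans_lt (by exact_mod_cast Nat.succ_pos _)
  have hBe : B = X ^ (k + 2) - (X ^ (k + 1) + C (X ^ (k + 2) - X ^ (k + 1))) := by rw [hB]; ring
  have hBm : B.Monic := hBe ▸ monic_X_pow_sub hdeg
  have hBd : B.natDegree = k + 2 := by
    rw [hBe]
    refine natDegree_eq_of_degree_eq_some ?_
    rw [degree_sub_eq_left_of_degree_lt (by rwa [degree_X_pow]), degree_X_pow]
  obtain ⟨Φ, hΦ⟩ : X - C X ∣ B := by rw [dvd_iff_isRoot]; simp [hB]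
  have hΦm : Φ.Monic := (monic_X_sub_C X).of_mul_monic_left (hΦ ▸ hBm)
  have hΦd : Φ.natDegree = k + 1 := by
    have := (monic_X_sub_C (X : κ[X])).natDegree_mul hΦm
    rw [← hΦ, hBd, natDegree_X_sub_C] at this
    omega
  have h1 : Φ.map (evalRingHom 1) = X ^ (k + 1) := by
    apply mul_left_cancel₀ (X_sub_C_ne_zero (1 : κ))
    have := congrArg (Polynomial.map (evalRingHom 1)) hΦ
    simp [hB] at this
    rw [C_1, ← this]
    ring
  have h0 : Φ.coeff 0 = X ^ (k + 1) - X ^ k := by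
    apply mul_left_cancel₀ (X_ne_zero (R := κ))
    have := congrArg (fun p => coeff p 0) hΦ
    simp [hB, mul_coeff_zero, coeff_X_pow] at this
    rw [← C_pow, ← C_pow, coeff_C_zero, coeff_C_zero] at this
    rw [← neg_inj, ← mul_neg, mul_neg, ← this]
    ring
  refine ⟨Φ, hΦm, ?_, hΦ.symm⟩
  refine IsEisensteinAt.irreducible (𝓟 := Ideal.span {(X - C 1 : κ[X])}) ⟨?_, ?_, ?_⟩
    ?_ hΦm.isPrimitive (by omega)
  · rw [hΦm.leadingCoeff, Ideal.mem_span_singleton, dvd_iff_isRoot]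
    simp
  · intro n hn
    rw [Ideal.mem_span_singleton, dvd_iff_isRoot, IsRoot.def, ← coe_evalRingHom, ← coeff_map, h1,
      coeff_X_pow, if_neg (by omega)]
  · rw [Ideal.span_singleton_pow, Ideal.mem_span_singleton, h0]
    rintro ⟨q, hq⟩
    have := congrArg (fun p => eval 1 (derivative p)) hq
    simp [derivative_mul, derivative_X_pow, pow_two] at this
  · rw [Ideal.span_singleton_prime (X_sub_C_ne_zero 1)]
    exact prime_X_sub_C 1

end Trinomial

section TrinomialGalois

/-- The trinomial `T^D - T^(D-1) - s` over `κ[s]`. -/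
noncomputable def Polynomial.trinomialFamily (κ : Type*) [CommRing κ] (D : ℕ) : κ[X][X] :=
  X ^ D - X ^ (D - 1) - C X

variable (κ : Type*) [Field κ] {D : ℕ} (K L : Type*) [Field K] [Field L]
  [Algebra κ[X] K] [IsFractionRing κ[X] K] [Algebra K L] [Algebra κ[X] L] [IsScalarTower κ[X] K L]

theorem monic_trinomialFamily (hD : 2 ≤ D) : (trinomialFamily κ D).Monic := by
  rw [trinomialFamily, sub_sub]
  refine monic_X_pow_sub ((degree_add_le _ _).trans_lt (max_lt ?_ ?_))
  · rw [degree_X_pow]; exact_mod_cast (by omega : D - 1 < D)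
  · exact degree_C_le.trans_lt (by exact_mod_cast (by omega : 0 < D))

theorem natDegree_trinomialFamily (hD : 2 ≤ D) : (trinomialFamily κ D).natDegree = D := by
  rw [trinomialFamily, sub_sub]
  refine natDegree_eq_of_degree_eq_some ?_
  rw [degree_sub_eq_left_of_degree_lt, degree_X_pow]
  rw [degree_X_pow]
  refine (degree_add_le _ _).trans_lt (max_lt ?_ ?_)
  · rw [degree_X_pow]; exact_mod_cast (by omega : D - 1 < D)
  · exact degree_C_le.trans_lt (by exact_mod_cast (by omega : 0 < D))

theorem exists_aut_swap_trinomialFamily [CharZero κ] (hD : 2 ≤ D)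
    [IsSplittingField K L ((trinomialFamily κ D).map (algebraMap κ[X] K))] :
    ∃ σ : Gal(L/K), ∃ x ∈ (trinomialFamily κ D).rootSet L, ∃ y ∈ (trinomialFamily κ D).rootSet L,
      x ≠ y ∧ σ x = y ∧ σ y = x ∧
        ∀ z ∈ (trinomialFamily κ D).rootSet L, z ≠ x → z ≠ y → σ z = z := by
  obtain ⟨c, h, hc, hsep⟩ := trinomial_critical κ D hD
  set f := trinomialFamily κ D with hf
  have hmon : f.Monic := monic_trinomialFamily κ hD
  have : CharZero K := charZero_of_injective_ringHom (f := (algebraMap κ[X] K).comp C)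
    ((IsFractionRing.injective κ[X] K).comp C_injective)
  have : FiniteDimensional K L := IsSplittingField.finiteDimensional L (f.map (algebraMap κ[X] K))
  have : Normal K L := Normal.of_isSplittingField (f.map (algebraMap κ[X] K))
  have : IsGalois K L := ⟨⟩
  set S := integralClosure κ[X] L with hS
  have : IsFractionRing S L := integralClosure.isFractionRing_of_finite_extension K L
  have : IsDedekindDomain S := integralClosure.isDedekindDomain κ[X] K L
  have : Module.Finite κ[X] S := IsIntegralClosure.finite κ[X] K L S
  let _ : MulSemiringAction Gal(L/K) S := IsIntegralClosure.MulSemiringAction κ[X] K L S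
  have : IsGaloisGroup Gal(L/K) κ[X] S := IsGaloisGroup.of_isFractionRing _ κ[X] S K L
  have : FaithfulSMul κ[X] L := by
    rw [faithfulSMul_iff_algebraMap_injective, IsScalarTower.algebraMap_eq κ[X] K L]
    exact (algebraMap K L).injective.comp (IsFractionRing.injective κ[X] K)
  have hsmul (σ : Gal(L/K)) (s : S) : ((σ • s : S) : L) = σ s :=
    algebraMap_galRestrict_apply κ[X] σ s
  have hfac : (X - C (C c)) ^ 2 * h.map C - C (X - C (c ^ D - c ^ (D - 1))) = f := by
    have := congrArg (Polynomial.map (C : κ →+* κ[X])) hc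
    simp only [Polynomial.map_sub, Polynomial.map_mul, Polynomial.map_pow, map_X, map_C] at this
    rw [← this, hf, trinomialFamily, C_sub (a := X), sub_sub_sub_cancel_right]
  have hϖ : (X - C (c ^ D - c ^ (D - 1)) : κ[X]) ≠ 0 := X_sub_C_ne_zero _
  have : (Ideal.span {(X - C (c ^ D - c ^ (D - 1)) : κ[X])}).IsMaximal :=
    PrincipalIdealRing.isMaximal_of_irreducible (irreducible_X_sub_C _)
  have : CharZero (κ[X] ⧸ Ideal.span {(X - C (c ^ D - c ^ (D - 1)) : κ[X])}) :=
    charZero_of_injective_ringHom (f := (Ideal.Quotient.mk _).comp C) (RingHom.injective _)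
  have hLs : (f.map (algebraMap κ[X] L)).Splits := by
    rw [IsScalarTower.algebraMap_eq κ[X] K L, ← Polynomial.map_map]
    exact IsSplittingField.splits L _
  have hroot (x : L) (hx : x ∈ f.rootSet L) : ∃ s : S, (s : L) = x ∧ s ∈ f.rootSet S := by
    have hx0 := (mem_rootSet'.1 hx).2
    refine ⟨⟨x, f, hmon, by rwa [← aeval_def]⟩, rfl, mem_rootSet'.2 ⟨(hmon.map _).ne_zero, ?_⟩⟩
    refine Subtype.val_injective (?_ : algebraMap S L _ = _)
    rw [← aeval_algebraMap_apply]
    exact hx0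
  have hroot' (s : S) (hs : s ∈ f.rootSet S) : (s : L) ∈ f.rootSet L := by
    refine mem_rootSet'.2 ⟨(hmon.map _).ne_zero, ?_⟩
    have := congrArg (algebraMap S L) (mem_rootSet'.1 hs).2
    rwa [← aeval_algebraMap_apply, map_zero] at this
  have hSs : (f.map (algebraMap κ[X] S)).Splits := by
    refine Splits.of_splits_map_of_injective (i := algebraMap S L) Subtype.val_injective ?_ ?_
    · rwa [Polynomial.map_map, ← IsScalarTower.algebraMap_eq]
    · intro x hx
      rw [Polynomial.map_map, ← IsScalarTower.algebraMap_eq] at hx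
      obtain ⟨s, rfl, -⟩ := hroot x (by
        rw [mem_rootSet']
        exact ⟨(hmon.map _).ne_zero, by simpa [aeval_def, eval_map] using (mem_roots'.1 hx).2⟩)
      exact ⟨s, rfl⟩
  have hfaith (g : Gal(L/K)) (hg : ∀ s ∈ f.rootSet S, g • s = s) : g = 1 := by
    have htop := IsSplittingField.adjoin_rootSet L (f.map (algebraMap κ[X] K))
    have : (g : L →ₐ[K] L) = AlgHom.id K L := by
      refine AlgHom.ext_of_adjoin_eq_top htop fun x hx => ?_
      obtain ⟨s, rfl, hs⟩ := hroot x (by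
        rw [mem_rootSet'] at hx ⊢
        refine ⟨(hmon.map _).ne_zero, ?_⟩
        simpa [aeval_map_algebraMap] using hx.2)
      have := congrArg (Subtype.val) (hg s hs)
      rw [hsmul] at this
      exact this
    exact AlgEquiv.ext fun x => DFunLike.congr_fun this x
  obtain ⟨g, hg⟩ := exists_isSwap_of_eq_sq_mul_sub (R := κ[X]) (S := S) (G := Gal(L/K))
    (X - C (c ^ D - c ^ (D - 1))) (C c) (h.map C) hϖ (hfac ▸ hmon) (hfac ▸ hSs) (by
      have := hsep.map (f := (Ideal.Quotient.mk
        (Ideal.span {(X - C (c ^ D - c ^ (D - 1)) : κ[X])})).comp C)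
      rw [← Polynomial.map_map] at this
      simpa using this) (by rwa [hfac])
  rw [hfac] at hg
  obtain ⟨x, y, hxy, hg⟩ := hg
  have hcoe (z : f.rootSet S) : ((MulAction.toPermHom Gal(L/K) (f.rootSet S) g z : S) : L) =
      g (z : S) := hsmul g z
  have hne {z w : f.rootSet S} (h : z ≠ w) : ((z : S) : L) ≠ (w : S) :=
    fun h' => h (Subtype.ext (Subtype.ext h'))
  refine ⟨g, _, hroot' _ x.2, _, hroot' _ y.2, hne hxy, ?_, ?_, ?_⟩
  · rw [← hcoe, hg, @Equiv.swap_apply_left _ (_) x y]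
  · rw [← hcoe, hg, @Equiv.swap_apply_right _ (_) x y]
  · intro z hz hzx hzy
    obtain ⟨s, rfl, hs⟩ := hroot z hz
    rw [← hcoe ⟨s, hs⟩, hg, @Equiv.swap_apply_of_ne_of_ne _ (_) x y]
    · rintro rfl; exact hzx rfl
    · rintro rfl; exact hzy rfl

end TrinomialGalois

section TrinomialGaloisPerm

variable (κ : Type*) [Field κ] {D : ℕ} (K L : Type*) [Field K] [Field L]
  [Algebra κ[X] K] [IsFractionRing κ[X] K] [Algebra K L] [Algebra κ[X] L] [IsScalarTower κ[X] K L]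

theorem eval₂_trinomialFamily_injective {L : Type*} [Field L] [Algebra κ[X] L]
    [FaithfulSMul κ[X] L] {x : L}
    (hx : x ^ D - x ^ (D - 1) = algebraMap κ[X] L X) :
    Function.Injective (eval₂RingHom ((algebraMap κ[X] L).comp C) x) := by
  let _ : Algebra κ L := ((algebraMap κ[X] L).comp C).toAlgebra
  have : IsScalarTower κ κ[X] L := .of_algebraMap_eq' rfl
  have hX : Transcendental κ (algebraMap κ[X] L X) := by
    rw [transcendental_algebraMap_iff (FaithfulSMul.algebraMap_injective κ[X] L)]
    exact transcendental_X κ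
  have : Transcendental κ x := by
    intro h
    refine hX ?_
    rw [← hx]
    exact (h.pow _).sub (h.pow _)
  exact transcendental_iff_injective.1 this

theorem exists_aut_fix_trinomialFamily (hD : 2 ≤ D) [Normal K L] {x y z : L}
    (hx : x ^ D - x ^ (D - 1) = algebraMap κ[X] L X)
    (hy : y ^ D - y ^ (D - 1) = algebraMap κ[X] L X)
    (hz : z ^ D - z ^ (D - 1) = algebraMap κ[X] L X) (hyx : y ≠ x) (hzx : z ≠ x) :
    ∃ σ : Gal(L/K), σ x = x ∧ σ y = z := by
  have : FaithfulSMul κ[X] L := by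
    rw [faithfulSMul_iff_algebraMap_injective, IsScalarTower.algebraMap_eq κ[X] K L]
    exact (algebraMap K L).injective.comp (IsFractionRing.injective κ[X] K)
  have hinj := eval₂_trinomialFamily_injective κ hx
  set j := eval₂RingHom ((algebraMap κ[X] L).comp C) x with hj
  set a : κ[X] →+* κ[X] := eval₂RingHom C (X ^ D - X ^ (D - 1)) with ha
  have hja : j.comp a = algebraMap κ[X] L := by
    ext <;> simp [hj, ha, hx]
  have hainj : Function.Injective a := by
    refine Function.Injective.of_comp (f := j) ?_
    rw [← RingHom.coe_comp, hja]
    exact FaithfulSMul.algebraMap_injective κ[X] L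
  set N := FractionRing κ[X]
  let _ : Algebra N L := (IsFractionRing.lift hinj).toAlgebra
  have hNL (p : κ[X]) : algebraMap N L (algebraMap κ[X] N p) = j p :=
    IsFractionRing.lift_algebraMap hinj p
  let _ : Algebra K N := (IsFractionRing.lift (A := κ[X]) (K := K)
    (g := (algebraMap κ[X] N).comp a) ((IsFractionRing.injective κ[X] N).comp hainj)).toAlgebra
  have hKN (p : κ[X]) : algebraMap K N (algebraMap κ[X] K p) = algebraMap κ[X] N (a p) :=
    IsFractionRing.lift_algebraMap _ p
  have : IsScalarTower K N L := by
    refine .of_algebraMap_eq' (IsFractionRing.ringHom_ext (A := κ[X]) fun p => ?_)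
    rw [RingHom.comp_apply, hKN, hNL]
    exact (IsScalarTower.algebraMap_apply κ[X] K L p).symm.trans (RingHom.congr_fun hja p).symm
  have : Normal N L := Normal.tower_top_of_normal K N L
  obtain ⟨Φ, hΦ, hirr, hmul⟩ := exists_irreducible_mul_eq_trinomial_sub κ D hD
  have hirr' := (hΦ.irreducible_iff_irreducible_map_fraction_map (K := N)).1 hirr
  have hmin (w : L) (hw : w ^ D - w ^ (D - 1) = algebraMap κ[X] L X) (hwx : w ≠ x) :
      Φ.map (algebraMap κ[X] N) = minpoly N w := by
    refine minpoly.eq_of_irreducible_of_monic hirr' ?_ (hΦ.map _)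
    have h := congrArg (eval₂ j w) hmul
    simp only [eval₂_mul, eval₂_sub, eval₂_X, eval₂_C, eval₂_pow, map_sub, map_pow] at h
    have hjX : j X = x := by simp [hj]
    rw [hjX, hw, hx, sub_self, mul_eq_zero, sub_eq_zero, or_iff_right hwx] at h
    rw [aeval_def, eval₂_map, ← h]
    congr 1
    exact RingHom.ext hNL
  obtain ⟨σ, hσ⟩ := isConjRoot_iff_exists_algEquiv.1
    ((hmin z hz hzx).symm.trans (hmin y hy hyx) : IsConjRoot N z y)
  refine ⟨σ.restrictScalars K, ?_, hσ⟩
  have : x = algebraMap N L (algebraMap κ[X] N X) := by rw [hNL]; simp [hj]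
  rw [this]
  exact σ.commutes _

theorem separable_trinomialFamily [CharZero κ] (hD : 2 ≤ D) :
    ((trinomialFamily κ D).map (algebraMap κ[X] K)).Separable := by
  classical
  set f := (trinomialFamily κ D).map (algebraMap κ[X] K) with hf
  have hmon : f.Monic := (monic_trinomialFamily κ hD).map _
  set E := AlgebraicClosure K
  have : FaithfulSMul κ[X] E := by
    rw [faithfulSMul_iff_algebraMap_injective, IsScalarTower.algebraMap_eq κ[X] K E]
    exact (algebraMap K E).injective.comp (IsFractionRing.injective κ[X] K)
  rw [← nodup_aroots_iff_of_splits hmon.ne_zero (IsAlgClosed.splits (f.map (algebraMap K E))),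
    Multiset.nodup_iff_count_le_one]
  intro x
  rw [count_roots]
  by_contra! h
  rw [one_lt_rootMultiplicity_iff_isRoot (hmon.map _).ne_zero] at h
  obtain ⟨h1, h2⟩ := h
  have hfE : f.map (algebraMap K E) = (X ^ D - X ^ (D - 1) : κ[X]).map ((algebraMap κ[X] E).comp C)
      - C (algebraMap κ[X] E X) := by
    rw [hf, Polynomial.map_map, ← IsScalarTower.algebraMap_eq]
    simp [trinomialFamily]
  have hx : x ^ D - x ^ (D - 1) = algebraMap κ[X] E X := by
    rw [hfE] at h1
    simpa [sub_eq_zero] using h1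
  have h3 := eval₂_trinomialFamily_injective κ hx
  rw [hfE, derivative_sub, derivative_C, sub_zero, derivative_map, IsRoot, eval_map] at h2
  have h4 := (injective_iff_map_eq_zero _).1 h3 _ h2
  have := congrArg (coeff · (D - 1)) h4
  simp only [coeff_derivative, coeff_sub, coeff_X_pow, coeff_zero] at this
  rw [Nat.sub_add_cancel (by omega)] at this
  have hne : (D : κ) ≠ 0 := by exact_mod_cast (by omega : D ≠ 0)
  rw [if_pos rfl, if_neg (by omega), sub_zero, one_mul] at this
  have h5 : ((D - 1 : ℕ) : κ) + 1 = D := by exact_mod_cast Nat.sub_add_cancel (by omega)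
  exact hne (h5 ▸ this)

end TrinomialGaloisPerm

theorem Polynomial.exists_separable_resolvent {K : Type*} [Field K] [CharZero K] {D : ℕ} {p : K[X]}
    (hp : p.Monic) (hd : p.natDegree = D) (hs : p.Separable) :
    ∃ u : Fin D → ℤ, (resolvent u p).Separable := by
  set L := AlgebraicClosure K
  obtain ⟨τ, hτ⟩ := exists_eq_prod_fin_of_splits (hp.map (algebraMap K L)) (IsAlgClosed.splits _)
    ((hp.natDegree_map _).trans hd)
  have hinj : Function.Injective τ := by
    have := hs.map (f := algebraMap K L)
    rwa [hτ, separable_prod_X_sub_C_iff] at this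
  let q (σ π : Equiv.Perm (Fin D)) : L[X] := ∑ i, C (τ (σ i) - τ (π i)) * X ^ (i : ℕ)
  have hq {σ π : Equiv.Perm (Fin D)} (h : σ ≠ π) : q σ π ≠ 0 := by
    intro h0
    refine h (Equiv.ext fun i => hinj ?_)
    have := congrArg (coeff · (i : ℕ)) h0
    simp only [q, finsetSum_coeff, coeff_C_mul, coeff_X_pow, coeff_zero] at this
    rw [Finset.sum_eq_single i] at this
    · simpa [sub_eq_zero] using this
    · intro j _ hj
      rw [if_neg (fun h => hj (Fin.ext h.symm)), mul_zero]
    · simp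
  let T := (Finset.univ : Finset (Equiv.Perm (Fin D) × Equiv.Perm (Fin D))).filter
    fun x => x.1 ≠ x.2
  have hT : ∏ x ∈ T, q x.1 x.2 ≠ 0 :=
    Finset.prod_ne_zero_iff.2 fun x hx => hq (Finset.mem_filter.1 hx).2
  obtain ⟨N, hN⟩ : ∃ N : ℕ, (∏ x ∈ T, q x.1 x.2).eval (N : L) ≠ 0 := by
    by_contra! h
    refine hT (eq_zero_of_infinite_isRoot _ ?_)
    exact (Set.infinite_range_of_injective (Nat.cast_injective (R := L))).mono
      (by rintro _ ⟨N, rfl⟩; exact h N)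
  refine ⟨fun i => (N : ℤ) ^ (i : ℕ), ?_⟩
  rw [← separable_map (algebraMap K L), ← resolvent_map, hτ, resolvent_prod_X_sub_C,
    separable_prod_X_sub_C_iff]
  intro σ π h
  by_contra hne
  rw [eval_prod, Finset.prod_ne_zero_iff] at hN
  refine hN (σ, π) (Finset.mem_filter.2 ⟨Finset.mem_univ _, hne⟩) ?_
  simp only [Int.cast_pow, Int.cast_natCast] at h
  simp only [q, eval_finsetSum, eval_mul, eval_C, eval_pow, eval_X]
  rw [← sub_eq_zero, ← Finset.sum_sub_distrib] at h
  rw [← h]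
  exact Finset.sum_congr rfl fun i _ => by ring

section

variable (κ : Type*) [Field κ] {D : ℕ} (K L : Type*) [Field K] [Field L]
  [Algebra κ[X] K] [IsFractionRing κ[X] K] [Algebra K L] [Algebra κ[X] L] [IsScalarTower κ[X] K L]

theorem exists_aut_perm_trinomialFamily [CharZero κ] (hD : 2 ≤ D)
    [IsSplittingField K L ((trinomialFamily κ D).map (algebraMap κ[X] K))] {τ : Fin D → L}
    (hτ : (trinomialFamily κ D).map (algebraMap κ[X] L) = ∏ i, (X - C (τ i)))
    (hinj : Function.Injective τ) (π : Equiv.Perm (Fin D)) :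
    ∃ g : Gal(L/K), ∀ i, g (τ i) = τ (π i) := by
  have : Normal K L := Normal.of_isSplittingField ((trinomialFamily κ D).map (algebraMap κ[X] K))
  have hmem (x : L) : x ∈ (trinomialFamily κ D).rootSet L ↔ ∃ i, τ i = x := by
    rw [mem_rootSet', ← eval_map_algebraMap, hτ, eval_prod, Finset.prod_eq_zero_iff, ← hτ,
      and_iff_right ((monic_trinomialFamily κ hD).map _).ne_zero]
    simp [sub_eq_zero, eq_comm]
  have heq (i : Fin D) : τ i ^ D - τ i ^ (D - 1) = algebraMap κ[X] L X := by
    have := (mem_rootSet'.1 ((hmem (τ i)).2 ⟨i, rfl⟩)).2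
    simpa [trinomialFamily, sub_eq_zero] using this
  have hperm (g : Gal(L/K)) : ∃ ρ : Equiv.Perm (Fin D), ∀ i, g (τ i) = τ (ρ i) := by
    have h (i) : ∃ j, τ j = g (τ i) := by
      rw [← hmem, mem_rootSet', and_iff_right ((monic_trinomialFamily κ hD).map _).ne_zero,
        trinomialFamily]
      have h1 := congrArg g (heq i)
      rw [IsScalarTower.algebraMap_apply κ[X] K L, AlgEquiv.commutes] at h1
      simpa [sub_eq_zero, IsScalarTower.algebraMap_apply κ[X] K L] using h1
    choose ρ hρ using h
    have hρi : Function.Injective ρ := fun i j hij => hinj (g.injective (by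
      rw [← hρ, ← hρ, hij]))
    exact ⟨Equiv.ofBijective ρ (Finite.injective_iff_bijective.1 hρi), fun i => (hρ i).symm⟩
  let H : Subgroup (Equiv.Perm (Fin D)) :=
    { carrier := {π | ∃ g : Gal(L/K), ∀ i, g (τ i) = τ (π i)}
      mul_mem' := by
        rintro π ρ ⟨g, hg⟩ ⟨h, hh⟩
        exact ⟨g * h, fun i => by simp [hg, hh]⟩
      one_mem' := ⟨1, fun i => rfl⟩
      inv_mem' := by
        rintro π ⟨g, hg⟩
        exact ⟨g⁻¹, fun i => g.injective (by
          simp [hg])⟩ }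
  suffices h : H = ⊤ by
    have : π ∈ H := h ▸ Subgroup.mem_top π
    exact this
  obtain ⟨g, x, hx, y, hy, hxy, hgx, hgy, hg⟩ := exists_aut_swap_trinomialFamily κ K L hD
  obtain ⟨i, rfl⟩ := (hmem x).1 hx
  obtain ⟨j, rfl⟩ := (hmem y).1 hy
  refine Equiv.Perm.eq_top_of_swap_mem_of_forall_ne H (x := i) (y := j) (fun h => hxy (h ▸ rfl))
    ⟨g, fun k => ?_⟩ fun k hk => ?_
  · by_cases hki : k = i
    · rw [hki, Equiv.swap_apply_left, hgx]
    by_cases hkj : k = j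
    · rw [hkj, Equiv.swap_apply_right, hgy]
    rw [Equiv.swap_apply_of_ne_of_ne hki hkj]
    exact hg _ ((hmem _).2 ⟨k, rfl⟩) (hinj.ne hki) (hinj.ne hkj)
  · obtain ⟨σ, hσi, hσj⟩ := exists_aut_fix_trinomialFamily κ K L hD (heq i) (heq j) (heq k)
      hxy.symm (hinj.ne hk)
    obtain ⟨ρ, hρ⟩ := hperm σ
    exact ⟨ρ, ⟨σ, hρ⟩, hinj ((hρ i).symm.trans hσi), hinj ((hρ j).symm.trans hσj)⟩

end

theorem exists_resolvent_trinomialFamily {D : ℕ} (hD : 2 ≤ D) : ∃ u : Fin D → ℤ,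
    ∀ (κ K : Type) [Field κ] [CharZero κ] [Field K] [Algebra κ[X] K] [IsFractionRing κ[X] K]
      (p : K[X]), p ∣ (resolvent u (trinomialFamily κ D)).map (algebraMap κ[X] K) →
        p.natDegree ≠ 0 → p.natDegree = D.factorial := by
  have : CharZero (FractionRing ℚ[X]) := charZero_of_injective_ringHom
    (f := (algebraMap ℚ[X] (FractionRing ℚ[X])).comp C)
    ((IsFractionRing.injective ℚ[X] _).comp C_injective)
  obtain ⟨u, hu⟩ := exists_separable_resolvent
    ((monic_trinomialFamily ℚ hD).map (algebraMap ℚ[X] (FractionRing ℚ[X])))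
    (((monic_trinomialFamily ℚ hD).natDegree_map _).trans (natDegree_trinomialFamily ℚ hD))
    (separable_trinomialFamily ℚ (FractionRing ℚ[X]) hD)
  refine ⟨u, fun κ K _ _ _ _ _ p hp hp0 => ?_⟩
  let φ : ℚ[X] →+* κ[X] := mapRingHom (algebraMap ℚ κ)
  have hφ : Function.Injective φ := map_injective _ (algebraMap ℚ κ).injective
  have hinjK : Function.Injective ((algebraMap κ[X] K).comp φ) :=
    (IsFractionRing.injective κ[X] K).comp hφ
  let ψ : FractionRing ℚ[X] →+* K := IsFractionRing.lift hinjK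
  have hψ : ψ.comp (algebraMap ℚ[X] (FractionRing ℚ[X])) = (algebraMap κ[X] K).comp φ :=
    RingHom.ext fun x => IsFractionRing.lift_algebraMap hinjK x
  have hsep := hu.map (f := ψ)
  have htri : (trinomialFamily ℚ D).map φ = trinomialFamily κ D := by
    simp [trinomialFamily, φ]
  rw [← resolvent_map, Polynomial.map_map, hψ, ← Polynomial.map_map, htri] at hsep
  set f := (trinomialFamily κ D).map (algebraMap κ[X] K) with hf
  have hmon : f.Monic := (monic_trinomialFamily κ hD).map _
  have hdeg : f.natDegree = D :=
    ((monic_trinomialFamily κ hD).natDegree_map _).trans (natDegree_trinomialFamily κ hD)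
  set L := f.SplittingField
  obtain ⟨τ, hτ⟩ := exists_eq_prod_fin_of_splits (hmon.map (algebraMap K L))
    (SplittingField.splits f) ((hmon.natDegree_map _).trans hdeg)
  have hinj : Function.Injective τ := by
    have := (separable_trinomialFamily κ K hD).map (f := algebraMap K L)
    rwa [← hf, hτ, separable_prod_X_sub_C_iff] at this
  rw [← resolvent_map, ← hf] at hp
  have hres := resolvent_map u (algebraMap K L) f
  rw [hτ, resolvent_prod_X_sub_C] at hres
  have hθ : Function.Injective fun σ : Equiv.Perm (Fin D) => ∑ i, (u i : L) * τ (σ i) := by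
    have := hsep.map (f := algebraMap K L)
    rwa [← hres, separable_prod_X_sub_C_iff] at this
  set θ := fun σ : Equiv.Perm (Fin D) => ∑ i, (u i : L) * τ (σ i)
  have hR0 : (resolvent u f).map (algebraMap K L) ≠ 0 := ((monic_resolvent u f).map _).ne_zero
  have hdvd : p.map (algebraMap K L) ∣ (resolvent u f).map (algebraMap K L) :=
    Polynomial.map_dvd _ hp
  have hp00 : p.map (algebraMap K L) ≠ 0 := ne_zero_of_dvd_ne_zero hR0 hdvd
  have hsplit : (p.map (algebraMap K L)).Splits := by
    refine Splits.of_dvd ?_ hR0 hdvd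
    rw [← hres]
    exact Splits.prod fun σ _ => Splits.X_sub_C _
  obtain ⟨x, hx⟩ := hsplit.exists_eval_eq_zero (by
    rw [degree_map]; exact fun h => hp0 (natDegree_eq_of_degree_eq_some h))
  obtain ⟨σ, rfl⟩ : ∃ σ, θ σ = x := by
    have := eval_dvd (x := x) hdvd
    rw [hx, zero_dvd_iff, ← hres, eval_prod, Finset.prod_eq_zero_iff] at this
    obtain ⟨σ, -, hσ⟩ := this
    exact ⟨σ, by rw [eval_sub, eval_X, eval_C, sub_eq_zero] at hσ; exact hσ.symm⟩
  have hall (ρ : Equiv.Perm (Fin D)) : θ ρ ∈ p.rootSet L := by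
    obtain ⟨g, hg⟩ := exists_aut_perm_trinomialFamily κ K L hD
      (by rw [← hτ, IsScalarTower.algebraMap_eq κ[X] K L, ← Polynomial.map_map]) hinj (ρ * σ⁻¹)
    have h1 : g (θ σ) = θ ρ := by
      have hu (m : ℤ) : g (m : L) = m := map_intCast g m
      simp only [θ, map_sum, map_mul, hu, hg, Equiv.Perm.mul_apply]
      simp
    rw [mem_rootSet', and_iff_right hp00, ← h1]
    rw [eval_map_algebraMap] at hx
    rw [aeval_algHom_apply, hx, map_zero]
  refine le_antisymm ?_ ?_
  · rw [← natDegree_resolvent u f]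
    exact natDegree_le_of_dvd hp (monic_resolvent u f).ne_zero
  · calc D.factorial = Nat.card (Equiv.Perm (Fin D)) := by
          rw [Nat.card_perm, Nat.card_fin]
      _ ≤ Nat.card (p.rootSet L) :=
          Nat.card_le_card_of_injective (fun ρ => (⟨θ ρ, hall ρ⟩ : p.rootSet L))
            fun a b h => hθ (congrArg Subtype.val h)
      _ ≤ p.natDegree := by
        rw [Nat.card_coe_set_eq]
        exact ncard_rootSet_le p L

end SymmetricGroup

/-- If more than `|Y|` algebraically independent elements are polynomials in elements `z_k`, `y_j`
of a field, then some valuation ring contains the `y_j` but not all of the `z_k`. -/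
theorem ValuationSubring.exists_notMem_of_algebraicIndependent {k E Z Y ι : Type*} [Field k]
    [Field E] [Algebra k E] [Finite Z] [Finite Y] [Finite ι] (hcard : Nat.card Y < Nat.card ι)
    (z : Z → E) (y : Y → E) (x : ι → E) (hx : AlgebraicIndependent k x)
    (hxmem : ∀ α, x α ∈ Algebra.adjoin k (Set.range (Sum.elim z y))) :
    ∃ (V : ValuationSubring E) (k₀ : Z), (∀ c : k, algebraMap k E c ∈ V) ∧ (∀ j, y j ∈ V) ∧
      z k₀ ∉ V ∧ ∀ i, z i / z k₀ ∈ V := by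
  set s : Set E := Set.range (algebraMap k E) ∪ Set.range y with hs
  by_cases hV : ∃ (V : ValuationSubring E), s ⊆ V.toSubring ∧ ∃ i, z i ∉ V
  · obtain ⟨V, hsV, i, hi⟩ := hV
    have : Nonempty Z := ⟨i⟩
    obtain ⟨k₀, hk₀⟩ := Finite.exists_max fun i => V.valuation (z i)
    have h0 : z k₀ ∉ V := fun h => hi (by
      rw [← V.valuation_le_one_iff] at h ⊢
      exact (hk₀ i).trans h)
    refine ⟨V, k₀, fun c => hsV (Or.inl ⟨c, rfl⟩), fun j => hsV (Or.inr ⟨j, rfl⟩), h0, fun i => ?_⟩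
    rw [← V.valuation_le_one_iff, map_div₀]
    refine div_le_one_of_le₀ (hk₀ i) zero_le
  · exfalso
    push Not at hV
    set S := (Subalgebra.algebraicClosure (Algebra.adjoin k (Set.range y)) E).restrictScalars k with hS
    have hyS (j : Y) : y j ∈ S := isAlgebraic_algebraMap
      (⟨y j, Algebra.subset_adjoin ⟨j, rfl⟩⟩ : Algebra.adjoin k (Set.range y))
    have hle : Subring.closure s ≤ (Algebra.adjoin k (Set.range y)).toSubring := by
      rw [Subring.closure_le, hs]
      rintro _ (⟨c, rfl⟩ | ⟨j, rfl⟩)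
      · exact Subalgebra.algebraMap_mem _ c
      · exact Algebra.subset_adjoin ⟨j, rfl⟩
    have hzS (i : Z) : z i ∈ S := by
      have h1 : z i ∈ (integralClosure (Subring.closure s) E).toSubring := by
        rw [← iInf_valuationSubring_superset, Subring.mem_iInf]
        exact fun V => hV V.1 V.2 i
      obtain ⟨p, hp, hp0⟩ := h1
      refine IsIntegral.isAlgebraic (R := Algebra.adjoin k (Set.range y))
        ⟨p.map (Subring.inclusion hle), hp.map _, ?_⟩
      rw [Polynomial.eval₂_map]
      exact hp0
    have hxS (α : ι) : x α ∈ S := by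
      refine Algebra.adjoin_le ?_ (hxmem α)
      rintro _ ⟨i | j, rfl⟩
      exacts [hzS i, hyS j]
    let M := AlgebraicIndependent.matroid k E
    have h1 : M.Indep (Set.range x) :=
      AlgebraicIndependent.matroid_indep_iff.2 hx.coe_range
    have h2 : Set.range x ⊆ M.closure (Set.range y) := by
      rw [AlgebraicIndependent.matroid_closure_eq]
      rintro _ ⟨α, rfl⟩
      exact hxS α
    have h3 : (Set.range x).encard ≤ (Set.range y).encard := by
      rw [← h1.eRk_eq_encard]
      refine (M.eRk_mono h2).trans ?_
      rw [M.eRk_closure_eq]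
      exact M.eRk_le_encard _
    rw [← Set.image_univ, ← Set.image_univ, hx.injective.encard_image] at h3
    have h4 := h3.trans (Set.encard_image_le _ _)
    rw [Set.encard_univ, Set.encard_univ, ENat.card_eq_coe_natCard, ENat.card_eq_coe_natCard] at h4
    exact absurd h4 (by exact_mod_cast not_le.2 hcard)

open MvPolynomial in
/-- If no nonzero polynomial relation holds along a subset `B` of an affine space between the values
of more than `|Y|` polynomials, then `B` approaches infinity along the `Z`-coordinates. -/
theorem exists_valuationSubring_of_forall_eq_zero {k Z Y ι : Type} [Field k] [Finite Z] [Finite Y]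
    [Finite ι] (hcard : Nat.card Y < Nat.card ι) (B : Set (Z ⊕ Y → k))
    (Ψ : ι → MvPolynomial (Z ⊕ Y) k)
    (h : ∀ Φ : MvPolynomial ι k, (∀ v ∈ B, eval (fun α => eval v (Ψ α)) Φ = 0) → Φ = 0) :
    ∃ (E : Type) (_ : Field E) (π : (B → k) →+* E) (V : ValuationSubring E) (k₀ : Z),
      (∀ c : k, π (fun _ => c) ∈ V) ∧ (∀ j, π (fun v => v.1 (Sum.inr j)) ∈ V) ∧
      π (fun v => v.1 (Sum.inl k₀)) ∉ V ∧
      ∀ i, π (fun v => v.1 (Sum.inl i)) / π (fun v => v.1 (Sum.inl k₀)) ∈ V := by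
  let c (i : Z ⊕ Y) : B → k := fun v => v.1 i
  have hc (p : MvPolynomial (Z ⊕ Y) k) (v : B) : aeval c p v = eval v.1 p := by
    have : (Pi.evalAlgHom k (fun _ : B => k) v).comp (aeval c) = aeval v.1 := by
      ext i; simp [c]
    exact DFunLike.congr_fun this p
  let ψ : MvPolynomial ι k →ₐ[k] (B → k) := aeval fun α => aeval c (Ψ α)
  have hψ (Φ : MvPolynomial ι k) (v : B) : ψ Φ v = eval (fun α => eval v.1 (Ψ α)) Φ := by
    have : (Pi.evalAlgHom k (fun _ : B => k) v).comp ψ = aeval fun α => eval v.1 (Ψ α) := by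
      ext i; simp [ψ, hc]
    exact DFunLike.congr_fun this Φ
  have hψ0 (Φ : MvPolynomial ι k) (hΦ : ψ Φ = 0) : Φ = 0 :=
    h Φ fun v hv => by rw [← hψ Φ ⟨v, hv⟩, hΦ, Pi.zero_apply]
  obtain ⟨p, hp, -, hdis⟩ := Ideal.exists_le_prime_disjoint (⊥ : Ideal (B → k))
    ((nonZeroDivisors (MvPolynomial ι k)).map ψ) (by
      rw [Set.disjoint_left]
      rintro _ h0 ⟨Φ, hΦ, rfl⟩
      exact nonZeroDivisors.ne_zero hΦ (hψ0 Φ h0))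
  let E := FractionRing ((B → k) ⧸ p)
  let π : (B → k) →ₐ[k] E := (IsScalarTower.toAlgHom k ((B → k) ⧸ p) E).comp (Ideal.Quotient.mkₐ k p)
  have hπ (a : B → k) : π a = 0 ↔ a ∈ p := by
    rw [← Ideal.Quotient.eq_zero_iff_mem]
    exact IsFractionRing.to_map_eq_zero_iff (R := (B → k) ⧸ p) (K := E)
  have hx : AlgebraicIndependent k fun α => π (aeval c (Ψ α)) := by
    rw [algebraicIndependent_iff]
    intro Φ hΦ
    have h1 : π (ψ Φ) = 0 := by
      rw [← hΦ]
      have : π.comp ψ = aeval fun α => π (aeval c (Ψ α)) := by ext; simp [ψ]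
      exact DFunLike.congr_fun this Φ
    by_contra hne
    exact Set.disjoint_left.1 hdis ((hπ _).1 h1) ⟨Φ, mem_nonZeroDivisors_of_ne_zero hne, rfl⟩
  obtain ⟨V, k₀, h1, h2, h3, h4⟩ := ValuationSubring.exists_notMem_of_algebraicIndependent hcard
    (fun i => π (c (Sum.inl i))) (fun j => π (c (Sum.inr j))) _ hx (fun α => by
      rw [Algebra.adjoin_range_eq_range_aeval]
      refine ⟨Ψ α, ?_⟩
      have : aeval (Sum.elim (fun i => π (c (Sum.inl i))) fun j => π (c (Sum.inr j))) =
          π.comp (aeval c) := by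
        ext (i | j) <;> simp
      exact DFunLike.congr_fun this _)
  exact ⟨E, inferInstance, π, V, k₀, fun a => (π.commutes a).symm ▸ h1 a, h2, h3, h4⟩

namespace Polynomial

theorem coeff_coeff_swap {R : Type*} [CommRing R] (p : R[X][X]) (i j : ℕ) :
    ((Bivariate.swap p).coeff i).coeff j = (p.coeff j).coeff i := by
  induction p using Polynomial.induction_on' with
  | add p q hp hq => simp [hp, hq]
  | monomial n f =>
    induction f using Polynomial.induction_on' with
    | add p q hp hq => simp [hp, hq]
    | monomial m r =>
      rw [Bivariate.swap_monomial_monomial]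
      simp only [coeff_monomial]
      split_ifs <;> simp_all [coeff_monomial]

theorem natDegree_coeff_le_natDegree_swap {R : Type*} [CommRing R] (p : R[X][X]) (i : ℕ) :
    (p.coeff i).natDegree ≤ (Bivariate.swap p).natDegree := by
  rw [natDegree_le_iff_coeff_eq_zero]
  intro j hj
  rw [← coeff_coeff_swap, coeff_eq_zero_of_natDegree_lt hj, coeff_zero]

theorem exists_forall_map_eq {B R S : Type*} [CommRing R] [CommRing S] (φ : B → R →+* S)
    (M : ℕ) (p : B → S[X]) (hM : ∀ b, (p b).natDegree ≤ M)
    (h : ∀ i, ∃ r, ∀ b, φ b r = (p b).coeff i) :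
    ∃ P : R[X], P.natDegree ≤ M ∧ ∀ b, P.map (φ b) = p b := by
  choose r hr using h
  refine ⟨∑ i ∈ Finset.range (M + 1), C (r i) * X ^ i, ?_, fun b => ?_⟩
  · exact natDegree_sum_le_of_forall_le _ _ fun i hi =>
      (natDegree_C_mul_X_pow_le _ _).trans (by simpa [Nat.lt_succ_iff] using hi)
  · conv_rhs => rw [(p b).as_sum_range_C_mul_X_pow' (Nat.lt_succ_of_le (hM b))]
    simp [Polynomial.map_sum, hr]

/-- Monic divisors of the members of a family of bivariate polynomials assemble to a divisor of the
family itself. -/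
theorem exists_monic_dvd_of_forall_monic_dvd {B k : Type*} [Field k] [Nonempty B]
    (G : (B → k)[X][X]) (hG : G.Monic) (e : ℕ)
    (h : ∀ b, ∃ A : k[X][X], A.Monic ∧ A.natDegree = e ∧
      A ∣ G.map (mapRingHom (Pi.evalRingHom (fun _ => k) b))) :
    ∃ A : (B → k)[X][X], A.Monic ∧ A.natDegree = e ∧ A ∣ G := by
  let φ (b : B) := mapRingHom (Pi.evalRingHom (fun _ => k) b)
  have hinj (P Q : (B → k)[X][X]) (hPQ : ∀ b, P.map (φ b) = Q.map (φ b)) : P = Q := by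
    ext i j b
    have := congrArg (fun p => (p.coeff i).coeff j) (hPQ b)
    simpa [φ] using this
  have hlift (M N : ℕ) (p : B → k[X][X]) (hp : ∀ b, (p b).natDegree ≤ M)
      (hp' : ∀ b i, ((p b).coeff i).natDegree ≤ N) :
      ∃ P : (B → k)[X][X], P.natDegree ≤ M ∧ ∀ b, P.map (φ b) = p b := by
    refine exists_forall_map_eq φ M p hp fun i => ?_
    obtain ⟨P, -, hP⟩ := exists_forall_map_eq (fun b => Pi.evalRingHom (fun _ => k) b) N
      (fun b => (p b).coeff i) (fun b => hp' b i) fun j => ⟨fun b => ((p b).coeff i).coeff j,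
        fun b => rfl⟩
    exact ⟨P, hP⟩
  have hbound (b : B) (A : k[X][X]) (hA : A ∣ G.map (φ b)) (i : ℕ) :
      (A.coeff i).natDegree ≤ (Bivariate.swap G).natDegree := by
    refine (natDegree_coeff_le_natDegree_swap A i).trans ?_
    have h0 : Bivariate.swap (G.map (φ b)) ≠ 0 := by
      rw [EmbeddingLike.map_ne_zero_iff]
      exact (hG.map _).ne_zero
    refine (natDegree_le_of_dvd (_root_.map_dvd Bivariate.swap hA) h0).trans ?_
    have : Bivariate.swap (G.map (φ b)) = (Bivariate.swap G).map (φ b) := by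
      ext i j
      simp only [coeff_coeff_swap, coeff_map, φ, coe_mapRingHom]
    rw [this]
    exact natDegree_map_le
  choose A hA hAe A' hAA' using h
  have hA' (b : B) : (A' b).Monic := by
    refine (hA b).of_mul_monic_left ?_
    rw [← hAA']
    exact hG.map _
  obtain ⟨P, hPe, hP⟩ := hlift e _ A (fun b => (hAe b).le)
    (fun b i => hbound b _ ⟨_, hAA' b⟩ i)
  obtain ⟨Q, -, hQ⟩ := hlift G.natDegree _ A' (fun b => by
      have := congrArg natDegree (hAA' b)
      rw [(hA b).natDegree_mul (hA' b), hG.natDegree_map] at this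
      lia)
    (fun b i => hbound b _ ⟨A b, by rw [mul_comm]; exact hAA' b⟩ i)
  have hcoeff : P.coeff e = 1 := by
    ext j b
    have : ((P.map (φ b)).coeff e).coeff j = (1 : k[X]).coeff j := by
      rw [hP, ← hAe b, (hA b).coeff_natDegree]
    simp only [φ, coeff_map, coe_mapRingHom, Pi.evalRingHom_apply] at this
    rw [this, coeff_one, coeff_one]
    split_ifs <;> rfl
  have hPm : P.Monic := monic_of_natDegree_le_of_coeff_eq_one e hPe hcoeff
  refine ⟨P, hPm, ?_, Q, hinj _ _ fun b => ?_⟩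
  · refine hPe.antisymm (le_natDegree_of_ne_zero ?_)
    rw [hcoeff]
    exact one_ne_zero
  · rw [Polynomial.map_mul, hP, hQ]
    exact hAA' b

attribute [local instance] Polynomial.algebra in
/-- A monic divisor of a polynomial over `V[X]`, where `V` is integrally closed in `E`, has
coefficients in `V[X]`. -/
theorem exists_monic_dvd_of_map_dvd {E : Type*} [Field E] (V : ValuationSubring E)
    (H : V[X][X]) (hH : H.Monic) (A : E[X][X]) (hA : A.Monic)
    (h : A ∣ H.map (mapRingHom (algebraMap V E))) :
    ∃ A' : V[X][X], A'.Monic ∧ A'.natDegree = A.natDegree ∧ A' ∣ H := by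
  have hint (p : E[X]) (hp : IsIntegral V[X] p) : p ∈ (mapRingHom (algebraMap V E)).range := by
    rw [Polynomial.isIntegral_iff_isIntegral_coeff] at hp
    rw [RingHom.mem_range]
    have : p ∈ lifts (algebraMap V E) := by
      rw [lifts_iff_coeff_lifts]
      intro i
      exact IsIntegrallyClosed.isIntegral_iff.1 (hp i)
    exact this
  have hl : A ∈ lifts (mapRingHom (algebraMap V E)) := by
    rw [lifts_iff_coeff_lifts]
    intro i
    exact hint _ (isIntegral_coeff_of_dvd H A hH hA h i)
  obtain ⟨A', hA', hdeg, hm⟩ := lifts_and_natDegree_eq_and_monic hl hA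
  refine ⟨A', hm, hdeg, ?_⟩
  have hinj : Function.Injective (mapRingHom (algebraMap V E)) :=
    map_injective _ (FaithfulSMul.algebraMap_injective V E)
  rw [← hA', map_dvd_map _ hinj hm] at h
  exact h

end Polynomial

namespace Polynomial

section Family

variable {R S J : Type*} [CommRing R] [CommRing S] [Fintype J] {n : ℕ} (D : ℕ) (w t : J → ℕ)

/-- The family `(Σ z_k s^k) (T^D - T^(D-1) - s) + Σ y_j s^(w j) T^(t j)` of polynomials
in `T` over `R[s]`. -/
noncomputable def perturbedTrinomial (z : Fin (n + 1) → R) (y : J → R) : R[X][X] :=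
  C (∑ k, C (z k) * X ^ (k : ℕ)) * trinomialFamily R D + ∑ j, C (C (y j) * X ^ w j) * X ^ t j

variable (z : Fin (n + 1) → R) (y : J → R)

theorem trinomialFamily_map (φ : R →+* S) :
    (trinomialFamily R D).map (mapRingHom φ) = trinomialFamily S D := by
  simp [trinomialFamily]

theorem perturbedTrinomial_map (φ : R →+* S) :
    (perturbedTrinomial D w t z y).map (mapRingHom φ) =
      perturbedTrinomial D w t (fun k => φ (z k)) (fun j => φ (y j)) := by
  simp [perturbedTrinomial, trinomialFamily_map, Polynomial.map_sum]

theorem C_C_mul_perturbedTrinomial (c : R) :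
    C (C c) * perturbedTrinomial D w t z y =
      perturbedTrinomial D w t (fun k => c * z k) (fun j => c * y j) := by
  simp only [perturbedTrinomial, mul_add, Finset.mul_sum, map_mul, map_sum, ← mul_assoc]

theorem perturbedTrinomial_zero :
    perturbedTrinomial D w t z (fun _ => 0) =
      C (∑ k, C (z k) * X ^ (k : ℕ)) * trinomialFamily R D := by
  simp [perturbedTrinomial]

theorem resolvent_monicize_map (u : Fin D → ℤ) (φ : R →+* S) (f : R[X]) :
    (resolvent u (monicize D f)).map φ = resolvent u (monicize D (f.map φ)) := by
  rw [monicize_map, resolvent_map]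

theorem resolvent_monicize_C_mul [IsDomain R] (u : Fin D → ℤ) (a : R) (f : R[X]) :
    resolvent u (monicize D (C a * f)) = (resolvent u (monicize D f)).scaleRoots a := by
  rw [monicize_C_mul, resolvent_scaleRoots u (monic_monicize D f) (natDegree_monicize D f)]

end Family

theorem scaleRoots_dvd_of_dvd_scaleRoots {R : Type*} [CommRing R] [IsDomain R] {p q : R[X]}
    {a b : R} (hab : a * b = 1) (h : p ∣ q.scaleRoots a) : p.scaleRoots b ∣ q := by
  have := scaleRoots_dvd p (q.scaleRoots a) (r := b) h
  rwa [← scaleRoots_mul, hab, scaleRoots_one] at this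

/-- The polynomials in the family `perturbedTrinomial` whose resolvent has a factor of given degree
are not dense after composition with polynomial functions in sufficiently many parameters. -/
theorem exists_ne_zero_forall_eval_eq_zero {k : Type} [Field k] [CharZero k] {n D : ℕ}
    (hD : 2 ≤ D) {u : Fin D → ℤ}
    (hu : ∀ (κ K : Type) [Field κ] [CharZero κ] [Field K] [Algebra κ[X] K]
      [IsFractionRing κ[X] K] (p : K[X]),
      p ∣ (resolvent u (trinomialFamily κ D)).map (algebraMap κ[X] K) → p.natDegree ≠ 0 →
        p.natDegree = D.factorial)
    {J Y ι : Type} [Fintype J] [Finite Y] [Finite ι] (hcard : Nat.card Y < Nat.card ι)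
    (ρ : J → Y) (w t : J → ℕ) (Ψ : ι → MvPolynomial (Fin (n + 1) ⊕ Y) k) {e : ℕ} (he : e ≠ 0)
    (he' : e ≠ D.factorial) :
    ∃ Φ : MvPolynomial ι k, Φ ≠ 0 ∧ ∀ v : Fin (n + 1) ⊕ Y → k,
      (∃ A : k[X][X], A.Monic ∧ A.natDegree = e ∧ A ∣ resolvent u (monicize D
        (perturbedTrinomial D w t (fun i => v (Sum.inl i)) (fun j => v (Sum.inr (ρ j)))))) →
      MvPolynomial.eval (fun α => MvPolynomial.eval v (Ψ α)) Φ = 0 := by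
  by_contra! hne
  let B : Set (Fin (n + 1) ⊕ Y → k) := {v | ∃ A : k[X][X], A.Monic ∧ A.natDegree = e ∧
    A ∣ resolvent u (monicize D
      (perturbedTrinomial D w t (fun i => v (Sum.inl i)) (fun j => v (Sum.inr (ρ j)))))}
  obtain ⟨E, _, π, V, k₀, hconst, hyV, hk₀, hzV⟩ :=
    exists_valuationSubring_of_forall_eq_zero hcard B Ψ fun Φ hΦ => by
      by_contra hΦ0
      obtain ⟨v, hv, hv0⟩ := hne Φ hΦ0
      exact hv0 (hΦ v hv)
  have : Nonempty B := by
    by_contra hB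
    rw [not_nonempty_iff] at hB
    have : π 1 = π 0 := congrArg π (Subsingleton.elim _ _)
    simp at this
  let cz (i : Fin (n + 1)) : B → k := fun v => v.1 (Sum.inl i)
  let cy (j : J) : B → k := fun v => v.1 (Sum.inr (ρ j))
  obtain ⟨A, hA, hAe, hAdvd⟩ := exists_monic_dvd_of_forall_monic_dvd
    (resolvent u (monicize D (perturbedTrinomial D w t cz cy))) (monic_resolvent u _) e
    fun b => by
      obtain ⟨A, hA, hAe, hAdvd⟩ := b.2
      refine ⟨A, hA, hAe, ?_⟩
      rw [resolvent_monicize_map, perturbedTrinomial_map]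
      exact hAdvd
  set z₀ := π (cz k₀) with hz₀
  have hz₀0 : z₀ ≠ 0 := fun h => hk₀ (h ▸ V.zero_mem)
  have hinvV : z₀⁻¹ ∈ V := (V.mem_or_inv_mem z₀).resolve_left hk₀
  have hinvm : (⟨z₀⁻¹, hinvV⟩ : V) ∈ IsLocalRing.maximalIdeal V := by
    rw [IsLocalRing.mem_maximalIdeal, mem_nonunits_iff]
    rintro ⟨x, hx⟩
    have h1 : z₀⁻¹ * ((x⁻¹ : Vˣ) : V) = 1 := by
      have := congrArg Subtype.val x.mul_inv
      rw [hx] at this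
      exact this
    rw [inv_mul_eq_one₀ hz₀0] at h1
    exact hk₀ (h1 ▸ ((x⁻¹ : Vˣ) : V).2)
  let zV (i : Fin (n + 1)) : V := ⟨π (cz i) / z₀, hzV i⟩
  let yV (j : J) : V := ⟨z₀⁻¹, hinvV⟩ * ⟨π (cy j), hyV (ρ j)⟩
  have hzk₀ : zV k₀ = 1 := Subtype.ext (div_self hz₀0)
  have hfE : perturbedTrinomial D w t (fun i => π (cz i)) (fun j => π (cy j)) =
      C (C z₀) * (perturbedTrinomial D w t zV yV).map (mapRingHom (algebraMap V E)) := by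
    rw [perturbedTrinomial_map, C_C_mul_perturbedTrinomial]
    congr 1
    · ext i
      exact (mul_div_cancel₀ _ hz₀0).symm
    · ext j
      exact (mul_inv_cancel_left₀ hz₀0 _).symm
  have hdE := map_dvd (mapRingHom π) hAdvd
  rw [resolvent_monicize_map, perturbedTrinomial_map, hfE, resolvent_monicize_C_mul] at hdE
  have hdE' := scaleRoots_dvd_of_dvd_scaleRoots
    (by rw [← C_mul, mul_inv_cancel₀ hz₀0, C_1] : (C z₀ : E[X]) * C z₀⁻¹ = 1) hdE
  rw [← resolvent_monicize_map] at hdE'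
  obtain ⟨A₁, hA₁, hA₁e, hA₁dvd⟩ := exists_monic_dvd_of_map_dvd V _ (monic_resolvent u _) _
    ((monic_scaleRoots_iff _).2 (hA.map (mapRingHom π))) hdE'
  rw [natDegree_scaleRoots, hA.natDegree_map, hAe] at hA₁e
  let κ := IsLocalRing.ResidueField V
  have : CharZero κ := charZero_of_injective_ringHom (f := (IsLocalRing.residue V).comp
    ((π.comp (Pi.constRingHom B k)).codRestrict V.toSubring hconst)) (RingHom.injective _)
  let K := FractionRing κ[X]
  set a : κ[X] := ∑ i, C (IsLocalRing.residue V (zV i)) * X ^ (i : ℕ) with ha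
  have ha0 : a ≠ 0 := by
    intro h
    have := congrArg (fun p => coeff p (k₀ : ℕ)) h
    simp [ha, coeff_X_pow, Fin.val_inj, hzk₀] at this
  have hyκ (j : J) : IsLocalRing.residue V (yV j) = 0 := by
    rw [IsLocalRing.residue_eq_zero_iff]
    exact Ideal.mul_mem_right _ _ hinvm
  have hdκ := map_dvd (mapRingHom (IsLocalRing.residue V)) hA₁dvd
  rw [resolvent_monicize_map, perturbedTrinomial_map] at hdκ
  simp only [hyκ] at hdκ
  rw [perturbedTrinomial_zero, ← ha, resolvent_monicize_C_mul,
    monicize_eq_self D (monic_trinomialFamily κ hD) (natDegree_trinomialFamily κ hD)] at hdκ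
  have hdK := map_dvd (algebraMap κ[X] K) hdκ
  have haK : algebraMap κ[X] K a ≠ 0 := by
    rwa [Ne, IsFractionRing.to_map_eq_zero_iff (R := κ[X]) (K := K)]
  rw [map_scaleRoots _ _ _ (by rw [(monic_resolvent u _).leadingCoeff, map_one]; exact one_ne_zero)]
    at hdK
  have hfin := hu κ K _ (scaleRoots_dvd_of_dvd_scaleRoots (mul_inv_cancel₀ haK) hdK)
  rw [natDegree_scaleRoots, (hA₁.map _).natDegree_map, hA₁.natDegree_map, hA₁e] at hfin
  exact he' (hfin he)

end Polynomial

namespace Polynomial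

theorem Splits.monicize {K : Type*} [Field K] {D : ℕ} (hD : D ≠ 0) {f : K[X]}
    (hf : f.natDegree ≤ D) (hs : f.Splits) : (monicize D f).Splits := by
  by_cases ha : f.coeff D = 0
  · have : Polynomial.monicize D f = X ^ (D - 1) * (X + C (f.coeff (D - 1))) := by
      obtain ⟨m, rfl⟩ := Nat.exists_eq_succ_of_ne_zero hD
      rw [Polynomial.monicize, ha, Nat.succ_eq_add_one, Finset.sum_range_succ,
        Finset.sum_eq_zero fun i hi => ?_]
      · simp
        ring
      · have : m + 1 - 1 - i ≠ 0 := by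
          have := Finset.mem_range.1 hi
          lia
        rw [zero_pow this, mul_zero, C_0, zero_mul]
    rw [this]
    exact (Splits.X_pow _).mul (Splits.X_add_C _)
  · have h1 := monicize_comp_C_mul_X D hD hf
    have h2 : ((Polynomial.monicize D f).comp (C (f.coeff D) * X)).Splits := by
      rw [h1]
      exact (Splits.C _).mul hs
    have h3 := h2.comp_of_natDegree_le_one (g := C (f.coeff D)⁻¹ * X) ((natDegree_C_mul_le _ _).trans natDegree_X_le)
    rwa [comp_assoc, mul_comp, C_comp, X_comp, ← mul_assoc, ← C_mul, mul_inv_cancel₀ ha, C_1,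
      one_mul, comp_X] at h3

/-- If the splitting field of `f` contains the roots of a polynomial with irreducible
resolvent, then the Galois group of `f` is the full symmetric group. -/
theorem nonempty_gal_mulEquiv_perm {K : Type*} [Field K] [CharZero K] {D : ℕ} (hD : 2 ≤ D)
    (u : Fin D → ℤ) {f g : K[X]} (hf : f.natDegree ≤ D) (hg : g.natDegree ≤ D)
    (hs : (g.map (algebraMap K f.SplittingField)).Splits)
    (hirr : Irreducible (resolvent u (monicize D g))) :
    Nonempty (f.Gal ≃* Equiv.Perm (Fin D)) := by
  have : Fact ((f.map (algebraMap K f.SplittingField)).Splits) := ⟨SplittingField.splits f⟩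
  obtain ⟨τ, hτ⟩ := exists_eq_prod_fin_of_splits (monic_monicize D _)
    (hs.monicize (by lia) (natDegree_map_le.trans hg)) (natDegree_monicize D _)
  have hroot : aeval (∑ i, (u i : f.SplittingField) * τ i) (resolvent u (monicize D g)) = 0 := by
    rw [aeval_def, ← eval_map, ← resolvent_map, ← monicize_map, hτ, resolvent_prod_X_sub_C,
      eval_prod]
    exact Finset.prod_eq_zero (Finset.mem_univ 1) (by
      rw [eval_sub, eval_X, eval_C]
      simp)
  have hcard1 : D.factorial ≤ Nat.card f.Gal := by
    have : IsGalois K f.SplittingField := { }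
    have h1 : Module.finrank K f.SplittingField = Nat.card f.Gal :=
      (IsGalois.card_aut_eq_finrank K f.SplittingField).symm
    rw [← h1, ← natDegree_resolvent u (monicize D g)]
    have h2 := minpoly.natDegree_le (A := K) (∑ i, (u i : f.SplittingField) * τ i)
    rwa [← minpoly.eq_of_irreducible_of_monic hirr hroot (monic_resolvent u _)] at h2
  let φ := Gal.galActionHom f f.SplittingField
  have hφ : Function.Injective φ := Gal.galActionHom_injective f f.SplittingField
  have hr : Fintype.card (f.rootSet f.SplittingField) ≤ D := by
    classical
    rw [← Nat.card_eq_fintype_card, Nat.card_coe_set_eq, rootSet, Set.ncard_coe_finset]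
    exact (Multiset.toFinset_card_le _).trans
      ((card_roots' _).trans (natDegree_map_le.trans hf))
  have hcard2 := Nat.card_le_card_of_injective φ hφ
  have hcard3 : Nat.card (Equiv.Perm (f.rootSet f.SplittingField)) =
      (Fintype.card (f.rootSet f.SplittingField)).factorial := by
    classical
    rw [Nat.card_eq_fintype_card, Fintype.card_perm]
  have hle := Nat.factorial_le hr
  have hrD : Fintype.card (f.rootSet f.SplittingField) = D := by
    refine ((Nat.factorial_inj (by lia : 1 < D)).1 ?_).symm
    lia
  have hbij : Function.Bijective φ := (Nat.bijective_iff_injective_and_card φ).2 ⟨hφ, by lia⟩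
  exact ⟨(MulEquiv.ofBijective φ hbij).trans
    (Fintype.equivFinOfCardEq hrD).permCongrHom⟩

/-- Over an integrally closed domain, a reducible monic polynomial has a proper monic divisor. -/
theorem Monic.exists_dvd_of_not_irreducible_map {R K : Type*} [CommRing R] [IsDomain R]
    [IsIntegrallyClosed R] [Field K] [Algebra R K] [IsFractionRing R K] {p : R[X]} (hp : p.Monic)
    (hp0 : p.natDegree ≠ 0) (h : ¬ Irreducible (p.map (algebraMap R K))) :
    ∃ q : R[X], q.Monic ∧ q.natDegree ≠ 0 ∧ q.natDegree < p.natDegree ∧ q ∣ p := by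
  rw [← hp.irreducible_iff_irreducible_map_fraction_map, hp.irreducible_iff_lt_natDegree_lt
    (by rintro rfl; exact hp0 natDegree_one)] at h
  push Not at h
  obtain ⟨q, hq, hqd, hqp⟩ := h
  rw [Finset.mem_Ioc] at hqd
  exact ⟨q, hq, by lia, by lia, hqp⟩

end Polynomial

namespace MvPolynomial

section Family

variable {R S : Type*} [CommRing R] [CommRing S] {n : ℕ} (i : Fin (n + 2))

/-- The substitution `x_j ↦ x_j - p_j x_i` for `j ≠ i`. -/
noncomputable def shear (p : Fin (n + 1) → R) :
    MvPolynomial (Fin (n + 2)) R →ₐ[R] MvPolynomial (Fin (n + 2)) R :=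
  aeval (i.insertNth (α := fun _ => MvPolynomial (Fin (n + 2)) R) (X i)
    (fun k => X (i.succAbove k) - C (p k) * X i))

theorem shear_X_self (p : Fin (n + 1) → R) : shear i p (X i) = X i := by
  simp [shear]

theorem shear_X_succAbove (p : Fin (n + 1) → R) (k : Fin (n + 1)) :
    shear i p (X (i.succAbove k)) = X (i.succAbove k) - C (p k) * X i := by
  simp [shear]

theorem algHom_ext_succAbove {A : Type*} [CommRing A] [Algebra R A]
    {f g : MvPolynomial (Fin (n + 2)) R →ₐ[R] A} (h : f (X i) = g (X i))
    (h' : ∀ k, f (X (i.succAbove k)) = g (X (i.succAbove k))) : f = g := by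
  refine algHom_ext fun j => ?_
  obtain rfl | ⟨k, rfl⟩ := Fin.eq_self_or_eq_succAbove i j
  exacts [h, h' k]

theorem shear_shear_neg (p : Fin (n + 1) → R) (F : MvPolynomial (Fin (n + 2)) R) :
    shear i p (shear i (-p) F) = F := by
  have : (shear i p).comp (shear i (-p)) = AlgHom.id R _ := by
    refine algHom_ext_succAbove i ?_ fun k => ?_
    · simp [shear_X_self]
    · simp only [AlgHom.comp_apply, shear_X_self, shear_X_succAbove, map_sub, map_mul, Pi.neg_apply,
        AlgHom.id_apply, map_neg, ← algebraMap_eq, AlgHom.commutes]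
      ring
  exact DFunLike.congr_fun this F

theorem map_shear (φ : R →+* S) (p : Fin (n + 1) → R) (F : MvPolynomial (Fin (n + 2)) R) :
    map φ (shear i p F) = shear i (fun k => φ (p k)) (map φ F) := by
  have : (map φ).comp (shear i p).toRingHom =
      (shear i (fun k => φ (p k))).toRingHom.comp (map φ) := by
    refine ringHom_ext (fun r => ?_) fun j => ?_
    · simp [shear]
    · obtain rfl | ⟨k, rfl⟩ := Fin.eq_self_or_eq_succAbove i j
      · simp [shear_X_self]
      · simp [shear_X_succAbove]
  exact DFunLike.congr_fun this F

theorem isHomogeneous_shear {F : MvPolynomial (Fin (n + 2)) R} {d : ℕ} (hF : F.IsHomogeneous d)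
    (p : Fin (n + 1) → R) : (shear i p F).IsHomogeneous d := by
  have := hF.aeval (i.insertNth (α := fun _ => MvPolynomial (Fin (n + 2)) R) (X i)
    (fun k => X (i.succAbove k) - C (p k) * X i)) (n := 1) fun j => by
      obtain rfl | ⟨k, rfl⟩ := Fin.eq_self_or_eq_succAbove i j
      · simpa using isHomogeneous_X R _
      · simpa using (isHomogeneous_X R _).sub (isHomogeneous_C_mul_X (p k) i)
  rwa [one_mul] at this

/-- The exponents of total degree `D + 1` having degree less than `D` in the variable `x_i`. -/
abbrev LowExponent (i : Fin (n + 2)) (D : ℕ) : Type :=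
  {β : Fin (n + 2) →₀ ℕ // β.degree = D + 1 ∧ β i < D}

instance finite_degree_eq {σ : Type*} [Finite σ] (d : ℕ) :
    Finite {β : σ →₀ ℕ // β.degree = d} :=
  (Finsupp.finite_of_degree_eq d).to_subtype

instance (D : ℕ) : Finite (LowExponent i D) :=
  Finite.of_injective (β := {β : Fin (n + 2) →₀ ℕ // β.degree = D + 1})
    (fun β => ⟨β.1, β.2.1⟩) fun _ _ h => Subtype.ext (Subtype.mk.inj h)

noncomputable instance (D : ℕ) : Fintype (LowExponent i D) := Fintype.ofFinite _

/-- The homogeneous form `x_i^D - x_0 x_i^(D-1) - x_0^(D-1) x_1`, up to the numbering of the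
variables other than `x_i`. -/
noncomputable def trinomialForm (R : Type*) [CommRing R] (i : Fin (n + 2)) (D : ℕ) :
    MvPolynomial (Fin (n + 2)) R :=
  X i ^ D - X (i.succAbove 0) * X i ^ (D - 1) -
    X (i.succAbove 0) ^ (D - 1) * X (i.succAbove 1)

end Family
end MvPolynomial

namespace MvPolynomial

section Family

variable {R S : Type*} [CommRing R] [CommRing S] {n : ℕ} (i : Fin (n + 2)) (D : ℕ)

/-- The family of forms of degree `D + 1` consisting of a product of a linear form with
`trinomialForm` and an arbitrary form of degree less than `D` in `x_i`. -/
noncomputable def perturbedForm (z : Fin (n + 1) → R) (y : LowExponent i D → R) :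
    MvPolynomial (Fin (n + 2)) R :=
  (∑ k, C (z k) * X (i.succAbove k)) * trinomialForm R i D + ∑ β, monomial β.1 (y β)

theorem map_perturbedForm (φ : R →+* S) (z : Fin (n + 1) → R) (y : LowExponent i D → R) :
    map φ (perturbedForm i D z y) =
      perturbedForm i D (fun k => φ (z k)) (fun β => φ (y β)) := by
  simp [perturbedForm, trinomialForm, map_monomial]

theorem sum_mul_trinomialForm (z : Fin (n + 1) → R) :
    (∑ k, C (z k) * X (i.succAbove k)) * trinomialForm R i D =
      ∑ k, monomial (Finsupp.single (i.succAbove k) 1 + Finsupp.single i D) (z k) -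
        (∑ k, C (z k) * X (i.succAbove k)) * (X (i.succAbove 0) * X i ^ (D - 1) +
          X (i.succAbove 0) ^ (D - 1) * X (i.succAbove 1)) := by
  have : ∑ k, monomial (Finsupp.single (i.succAbove k) 1 + Finsupp.single i D) (z k) =
      (∑ k, C (z k) * X (i.succAbove k)) * X i ^ D := by
    rw [Finset.sum_mul]
    refine Finset.sum_congr rfl fun k _ => ?_
    rw [C_mul_X_eq_monomial, X_pow_eq_monomial, monomial_mul, mul_one]
  rw [this, trinomialForm]
  ring

theorem degreeOf_sum_mul_lt [Nontrivial R] {D : ℕ} (hD : D ≠ 0) (z : Fin (n + 1) → R) :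
    degreeOf i ((∑ k, C (z k) * X (i.succAbove k)) * (X (i.succAbove 0) * X i ^ (D - 1) +
          X (i.succAbove 0) ^ (D - 1) * X (i.succAbove 1))) < D := by
  have h0 (k : Fin (n + 1)) : degreeOf i (X (i.succAbove k) : MvPolynomial (Fin (n + 2)) R) = 0 :=
    degreeOf_X_of_ne (Fin.succAbove_ne i k).symm
  have h1 : degreeOf i (∑ k, C (z k) * X (i.succAbove k)) ≤ 0 := by
    refine (degreeOf_sum_le _ _ _).trans (Finset.sup_le fun k _ => ?_)
    refine (degreeOf_mul_le _ _ _).trans ?_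
    rw [degreeOf_C, h0]
  have h2 : degreeOf i (X (i.succAbove 0) * X i ^ (D - 1) : MvPolynomial (Fin (n + 2)) R)
      ≤ D - 1 := by
    refine (degreeOf_mul_le _ _ _).trans ?_
    rw [h0, degreeOf_X_self_pow, zero_add]
  have h3 : degreeOf i (X (i.succAbove 0) ^ (D - 1) * X (i.succAbove 1) :
      MvPolynomial (Fin (n + 2)) R) ≤ D - 1 := by
    refine (degreeOf_mul_le _ _ _).trans ?_
    rw [h0, degreeOf_X_pow_of_ne _ (Fin.succAbove_ne i 0).symm]
    exact Nat.zero_le _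
  have h4 := (degreeOf_mul_le i (∑ k, C (z k) * X (i.succAbove k)) _).trans
    (add_le_add h1 ((degreeOf_add_le i _ _).trans (max_le h2 h3)))
  lia

theorem eq_single_add_of_degree_eq {β : Fin (n + 2) →₀ ℕ} {D : ℕ} (hβ : β.degree = D + 1)
    (hi : D ≤ β i) : β = Finsupp.single i (D + 1) ∨
      ∃ k, β = Finsupp.single (i.succAbove k) 1 + Finsupp.single i D := by
  obtain ⟨γ, rfl⟩ : ∃ γ, β = γ + Finsupp.single i D :=
    ⟨β - Finsupp.single i D, (tsub_add_cancel_of_le (by simpa using hi)).symm⟩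
  rw [map_add, Finsupp.degree_single] at hβ
  have h1 : γ.degree = 1 := by lia
  obtain ⟨j, rfl⟩ := (Finsupp.sum_eq_one_iff γ).1 h1
  rcases Fin.eq_self_or_eq_succAbove i j with rfl | ⟨k, rfl⟩
  · left
    rw [← Finsupp.single_add, add_comm 1 D]
  · exact Or.inr ⟨k, rfl⟩

theorem isHomogeneous_trinomialForm {D : ℕ} (hD : D ≠ 0) :
    (trinomialForm R i D).IsHomogeneous D := by
  obtain ⟨m, rfl⟩ := Nat.exists_eq_succ_of_ne_zero hD
  refine ((isHomogeneous_X_pow _ _).sub ?_).sub ?_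
  · have := (isHomogeneous_X R (i.succAbove 0)).mul (isHomogeneous_X_pow (R := R) i m)
    rwa [add_comm 1 m] at this
  · exact (isHomogeneous_X_pow (R := R) (i.succAbove 0) m).mul (isHomogeneous_X R (i.succAbove 1))

theorem exists_eq_perturbedForm [Nontrivial R] {D : ℕ} (hD : D ≠ 0)
    {F : MvPolynomial (Fin (n + 2)) R} (hF : F.IsHomogeneous (D + 1))
    (h0 : coeff (Finsupp.single i (D + 1)) F = 0) : ∃ z y, F = perturbedForm i D z y := by
  classical
  let z (k : Fin (n + 1)) : R := coeff (Finsupp.single (i.succAbove k) 1 + Finsupp.single i D) F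
  set H := F - (∑ k, C (z k) * X (i.succAbove k)) * trinomialForm R i D with hHdef
  have hH : H.IsHomogeneous (D + 1) := by
    refine hF.sub ?_
    rw [add_comm D 1]
    exact (IsHomogeneous.sum _ _ _ fun k _ => isHomogeneous_C_mul_X _ _).mul
      (isHomogeneous_trinomialForm i hD)
  have hHD (β : Fin (n + 2) →₀ ℕ) (hβ : coeff β H ≠ 0) : β.degree = D + 1 ∧ β i < D := by
    have hdeg : β.degree = D + 1 := by
      by_contra h
      exact hβ (hH.coeff_eq_zero h)
    refine ⟨hdeg, not_le.1 fun hi => hβ ?_⟩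
    have h1 : coeff β ((∑ k, C (z k) * X (i.succAbove k)) * (X (i.succAbove 0) * X i ^ (D - 1) +
          X (i.succAbove 0) ^ (D - 1) * X (i.succAbove 1))) = 0 := by
      rw [← notMem_support_iff]
      intro h
      exact absurd ((degreeOf_lt_iff (Nat.pos_of_ne_zero hD)).1 (degreeOf_sum_mul_lt i hD z) β h)
        (not_lt.2 hi)
    rw [hHdef, sum_mul_trinomialForm, coeff_sub, coeff_sub, h1, sub_zero, coeff_sum]
    simp only [coeff_monomial]
    rcases eq_single_add_of_degree_eq i hdeg hi with rfl | ⟨k, rfl⟩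
    · rw [h0, Finset.sum_eq_zero fun k _ => if_neg fun h => ?_, sub_zero]
      have := DFunLike.congr_fun h i
      simp at this
    · rw [Finset.sum_eq_single k (fun k' _ hk' => if_neg fun h => hk' ?_) (by simp), if_pos rfl,
        sub_self]
      exact Fin.succAbove_right_injective
        ((Finsupp.single_left_inj one_ne_zero).1 (add_right_cancel h))
  refine ⟨z, fun β => coeff β.1 H, ?_⟩
  rw [perturbedForm, ← sub_eq_iff_eq_add', ← hHdef]
  ext γ
  rw [coeff_sum]
  simp only [coeff_monomial]
  by_cases hγ : coeff γ H = 0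
  · rw [hγ, Finset.sum_eq_zero]
    intro β _
    split_ifs with h
    · rw [h, hγ]
    · rfl
  · rw [Finset.sum_eq_single ⟨γ, hHD γ hγ⟩ (fun β _ hβ => if_neg fun h => hβ (Subtype.ext h))
      (by simp), if_pos rfl]

/-- The coefficient of `x_i^d` in a form of degree `d` is its value at a coordinate point. -/
theorem coeff_single_eq_eval {d : ℕ} {F : MvPolynomial (Fin (n + 2)) R}
    (hF : F.IsHomogeneous d) :
    coeff (Finsupp.single i d) F = eval (Pi.single i 1) F := by
  classical
  rw [eval_eq', Finset.sum_eq_single (Finsupp.single i d)]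
  · rw [Finset.prod_eq_one, mul_one]
    intro j _
    rcases eq_or_ne j i with rfl | hj
    · simp
    · simp [hj.symm]
  · intro β hβ hne
    obtain ⟨j, hj, hj0⟩ : ∃ j ≠ i, β j ≠ 0 := by
      by_contra! h
      refine hne ?_
      have h1 : β = Finsupp.single i (β i) := by
        ext j
        rcases eq_or_ne j i with rfl | hj
        · simp
        · simp [hj.symm, h j hj]
      have h2 : β.degree = d := by
        by_contra h2
        exact mem_support_iff.1 hβ (hF.coeff_eq_zero h2)
      rw [h1, Finsupp.degree_single] at h2
      rw [h1, h2]
    rw [Finset.prod_eq_zero (Finset.mem_univ j), mul_zero]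
    simp [hj, hj0]
  · intro h
    rw [notMem_support_iff.1 h, zero_mul]

theorem eval_single_shear (p : Fin (n + 2) → R) (hp : p i = 1) (F : MvPolynomial (Fin (n + 2)) R) :
    eval (Pi.single i 1) (shear i (fun k => -p (i.succAbove k)) F) = eval p F := by
  have : (aeval (Pi.single i 1)).comp (shear i fun k => -p (i.succAbove k)) = aeval p := by
    refine algHom_ext_succAbove i ?_ fun k => ?_
    · simp [shear_X_self, hp]
    · simp [shear_X_succAbove]
  exact DFunLike.congr_fun this F

theorem exists_eq_shear_perturbedForm [Nontrivial R] {D : ℕ} (hD : D ≠ 0)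
    {F : MvPolynomial (Fin (n + 2)) R} (hF : F.IsHomogeneous (D + 1)) {p : Fin (n + 2) → R}
    (hp : p i = 1) (h0 : eval p F = 0) :
    ∃ z y, F = shear i (fun k => p (i.succAbove k)) (perturbedForm i D z y) := by
  have hF' := isHomogeneous_shear i hF (-fun k => p (i.succAbove k))
  obtain ⟨z, y, h⟩ := exists_eq_perturbedForm i hD hF' (by
    rw [coeff_single_eq_eval i hF', ← h0, ← eval_single_shear i p hp]
    rfl)
  refine ⟨z, y, ?_⟩
  rw [← h, shear_shear_neg]

end Family
end MvPolynomial

namespace MvPolynomial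

/-- The polynomial `F(x + T P)` in `T`. -/
noncomputable def lineRestriction {σ R : Type*} [CommRing R] (F : MvPolynomial σ R) (P : σ → R) :
    Polynomial (MvPolynomial σ R) :=
  aeval (fun j => Polynomial.C (X j) + Polynomial.C (C (P j)) * Polynomial.X) F

theorem fFP_eq_map_lineRestriction {m : ℕ} (F : MvPolynomial (Fin m) ℂ) (P : Fin m → ℂ) :
    fFP F P = (lineRestriction F P).map
      (algebraMap (MvPolynomial (Fin m) ℂ) (RatFuncField m)) := by
  rw [fFP, lineRestriction, ← Polynomial.coe_mapRingHom, aeval_def, hom_eval₂]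
  congr 1
  · ext
    simp
  · ext j : 1
    simp

theorem lineRestriction_smul {σ R : Type*} [CommRing R] (F : MvPolynomial σ R) (P : σ → R)
    (c : R) : lineRestriction F (c • P) =
      (lineRestriction F P).comp (Polynomial.C (C c) * Polynomial.X) := by
  rw [lineRestriction, lineRestriction, ← Polynomial.coe_compRingHom_apply, aeval_def, aeval_def,
    hom_eval₂]
  congr 1
  · ext
    simp
  · ext j : 1
    simp only [map_add, map_mul, Polynomial.coe_compRingHom_apply, Polynomial.C_comp,
      Polynomial.X_comp, Pi.smul_apply, smul_eq_mul]
    ring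

section

variable {R : Type*} [CommRing R] {n : ℕ} (i : Fin (n + 2))

theorem natDegree_aeval_le {A : Type*} [CommRing A] [Algebra R A]
    {v : Fin (n + 2) → Polynomial A} (hi : (v i).natDegree ≤ 1)
    (hv : ∀ k, (v (i.succAbove k)).natDegree = 0) {F : MvPolynomial (Fin (n + 2)) R} {D : ℕ}
    (hF : ∀ β ∈ F.support, β i ≤ D) : (aeval v F).natDegree ≤ D := by
  rw [aeval_def, eval₂_eq']
  refine Polynomial.natDegree_sum_le_of_forall_le _ _ fun β hβ => ?_
  rw [Fin.prod_univ_succAbove _ i]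
  have h1 : (v i ^ β i).natDegree ≤ D := by
    refine Polynomial.natDegree_pow_le.trans ((Nat.mul_le_mul_left _ hi).trans ?_)
    simpa using hF β hβ
  have h2 : (∏ k, v (i.succAbove k) ^ β (i.succAbove k)).natDegree ≤ 0 := by
    refine (Polynomial.natDegree_prod_le _ _).trans ?_
    refine (Finset.sum_eq_zero fun k _ => ?_).le
    have := Polynomial.natDegree_pow_le (p := v (i.succAbove k)) (n := β (i.succAbove k))
    rw [hv, mul_zero] at this
    exact Nat.le_zero.1 this
  have h3 : (algebraMap R (Polynomial A) (coeff β F)).natDegree = 0 := by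
    rw [Polynomial.algebraMap_apply, Polynomial.natDegree_C]
  refine Polynomial.natDegree_mul_le.trans ?_
  have h4 := Polynomial.natDegree_mul_le (p := v i ^ β i)
    (q := ∏ k, v (i.succAbove k) ^ β (i.succAbove k))
  lia

theorem lineRestriction_shear {P : Fin (n + 2) → R} (hP : P i = 1)
    (F : MvPolynomial (Fin (n + 2)) R) :
    lineRestriction (shear i (fun k => P (i.succAbove k)) F) P =
      aeval (i.insertNth (α := fun _ => Polynomial (MvPolynomial (Fin (n + 2)) R))
        (Polynomial.C (X i) + Polynomial.X)
        (fun k => Polynomial.C (X (i.succAbove k) - C (P (i.succAbove k)) * X i))) F := by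
  have : (aeval (fun j => Polynomial.C (X j) + Polynomial.C (C (P j)) * Polynomial.X)).comp
      (shear i (fun k => P (i.succAbove k))) =
      aeval (i.insertNth (α := fun _ => Polynomial (MvPolynomial (Fin (n + 2)) R))
        (Polynomial.C (X i) + Polynomial.X)
        (fun k => Polynomial.C (X (i.succAbove k) - C (P (i.succAbove k)) * X i))) := by
    refine algHom_ext_succAbove i ?_ fun k => ?_
    · simp [shear_X_self, hP]
    · simp only [AlgHom.comp_apply, shear_X_succAbove, map_sub, map_mul, aeval_X, ← algebraMap_eq,
        AlgHom.commutes, hP, Fin.insertNth_apply_succAbove, map_one, one_mul]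
      rw [Polynomial.algebraMap_apply]
      ring
  exact DFunLike.congr_fun this F

theorem natDegree_lineRestriction_le {D : ℕ} {F : MvPolynomial (Fin (n + 2)) R}
    (hF : F.IsHomogeneous (D + 1)) {P : Fin (n + 2) → R} (hP : P i = 1) (h0 : eval P F = 0) :
    (lineRestriction F P).natDegree ≤ D := by
  have hF' := isHomogeneous_shear i hF (-fun k => P (i.succAbove k))
  rw [← shear_shear_neg i (fun k => P (i.succAbove k)) F, lineRestriction_shear i hP]
  refine natDegree_aeval_le i ?_ (fun k => ?_) fun β hβ => ?_
  · rw [Fin.insertNth_apply_same, add_comm (Polynomial.C _)]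
    exact Polynomial.natDegree_add_C.trans_le Polynomial.natDegree_X_le
  · rw [Fin.insertNth_apply_succAbove, Polynomial.natDegree_C]
  · by_contra! hi
    have hdeg : β.degree = D + 1 := by
      by_contra h
      exact mem_support_iff.1 hβ (hF'.coeff_eq_zero h)
    rcases eq_single_add_of_degree_eq i hdeg hi.le with rfl | ⟨k, rfl⟩
    · refine mem_support_iff.1 hβ ?_
      rw [coeff_single_eq_eval i hF', ← h0, ← eval_single_shear i P hP]
      rfl
    · simp at hi

/-- The specialization `x_i ↦ 0` and `x_j ↦ s^k` if `x_j` is the `k`-th variable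
other than `x_i`. -/
noncomputable def toMomentCurve (R : Type*) [CommRing R] {n : ℕ} (i : Fin (n + 2)) :
    MvPolynomial (Fin (n + 2)) R →ₐ[R] Polynomial R :=
  aeval (i.insertNth (α := fun _ => Polynomial R) 0 (fun k => Polynomial.X ^ (k : ℕ)))

theorem map_toMomentCurve_lineRestriction {P : Fin (n + 2) → R} (hP : P i = 1)
    (F : MvPolynomial (Fin (n + 2)) R) :
    (lineRestriction (shear i (fun k => P (i.succAbove k)) F) P).map
        (toMomentCurve R i).toRingHom =
      aeval (i.insertNth (α := fun _ => Polynomial (Polynomial R)) Polynomial.X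
        (fun k => Polynomial.C (Polynomial.X ^ (k : ℕ)))) F := by
  rw [lineRestriction_shear i hP]
  have : (Polynomial.mapAlgHom (toMomentCurve R i)).comp
      (aeval (i.insertNth (α := fun _ => Polynomial (MvPolynomial (Fin (n + 2)) R))
        (Polynomial.C (X i) + Polynomial.X)
        (fun k => Polynomial.C (X (i.succAbove k) - C (P (i.succAbove k)) * X i)))) =
      aeval (i.insertNth (α := fun _ => Polynomial (Polynomial R)) Polynomial.X
        (fun k => Polynomial.C (Polynomial.X ^ (k : ℕ)))) := by
    refine algHom_ext_succAbove i ?_ fun k => ?_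
    · simp [toMomentCurve]
    · simp [toMomentCurve]
  exact DFunLike.congr_fun this F

theorem aeval_perturbedForm (hn : n ≠ 0) (D : ℕ) (z : Fin (n + 1) → R)
    (y : LowExponent i D → R) :
    aeval (i.insertNth (α := fun _ => Polynomial (Polynomial R)) Polynomial.X
        (fun k => Polynomial.C (Polynomial.X ^ (k : ℕ)))) (perturbedForm i D z y) =
      Polynomial.perturbedTrinomial D (fun β => ∑ k : Fin (n + 1), (k : ℕ) * β.1 (i.succAbove k))
        (fun β => β.1 i) z y := by
  have h1 : 1 < n + 1 := by lia
  rw [perturbedForm, Polynomial.perturbedTrinomial, map_add, map_mul, map_sum, map_sum]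
  congr 1
  · congr 1
    · simp [Polynomial.algebraMap_apply, ← algebraMap_eq]
    · simp [trinomialForm, Polynomial.trinomialFamily, Nat.mod_eq_of_lt h1]
  · refine Finset.sum_congr rfl fun β _ => ?_
    rw [aeval_monomial, Finsupp.prod_fintype _ _ fun _ => pow_zero _, Fin.prod_univ_succAbove _ i]
    simp only [Fin.insertNth_apply_same, Fin.insertNth_apply_succAbove, ← map_pow, ← map_prod,
      ← pow_mul, Finset.prod_pow_eq_pow_sum, map_mul, Polynomial.algebraMap_apply,
      Algebra.algebraMap_self_apply]
    ring

end

end MvPolynomial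

namespace MvPolynomial

theorem IsHomogeneous.eval_smul_eq_zero {σ R : Type*} [CommRing R] {F : MvPolynomial σ R} {d : ℕ}
    (hF : F.IsHomogeneous d) (c : R) {P : σ → R} (h : eval P F = 0) : eval (c • P) F = 0 := by
  have : eval (c • P) F = c ^ d * eval P F := by
    rw [eval_eq, eval_eq, Finset.mul_sum]
    refine Finset.sum_congr rfl fun β hβ => ?_
    have hdeg : β.degree = d := by
      by_contra h
      exact mem_support_iff.1 hβ (hF.coeff_eq_zero h)
    simp only [Pi.smul_apply, smul_eq_mul, mul_pow, Finset.prod_mul_distrib]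
    rw [Finset.prod_pow_eq_pow_sum, ← hdeg, Finsupp.degree_apply]
    ring
  rw [this, h, mul_zero]

theorem natDegree_fFP_le {n D : ℕ} {i : Fin (n + 2)} {F : MvPolynomial (Fin (n + 2)) ℂ}
    (hF : F.IsHomogeneous (D + 1)) {P : Fin (n + 2) → ℂ} (hP : P i ≠ 0) (h0 : eval P F = 0) :
    (fFP F P).natDegree ≤ D := by
  have h1 := natDegree_lineRestriction_le i hF (P := (P i)⁻¹ • P)
    (by simp [hP]) (hF.eval_smul_eq_zero _ h0)
  rw [fFP_eq_map_lineRestriction, ← smul_inv_smul₀ hP P, lineRestriction_smul]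
  refine Polynomial.natDegree_map_le.trans (Polynomial.natDegree_comp_le.trans ?_)
  refine (Nat.mul_le_mul h1 ((Polynomial.natDegree_C_mul_le _ _).trans
    Polynomial.natDegree_X_le)).trans ?_
  rw [mul_one]

theorem splits_map_of_splits_comp_C_mul_X {K L : Type*} [Field K] [Field L] [Algebra K L]
    {g : Polynomial K} {c : K} (hc : c ≠ 0)
    (h : ((g.comp (Polynomial.C c * Polynomial.X)).map (algebraMap K L)).Splits) :
    (g.map (algebraMap K L)).Splits := by
  have hc' : algebraMap K L c ≠ 0 := (map_ne_zero_iff _ (algebraMap K L).injective).2 hc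
  rw [Polynomial.map_comp] at h
  have h2 := h.comp_of_natDegree_le_one
    (g := Polynomial.C (algebraMap K L c)⁻¹ * Polynomial.X)
    ((Polynomial.natDegree_C_mul_le _ _).trans Polynomial.natDegree_X_le)
  rw [Polynomial.comp_assoc] at h2
  simp only [Polynomial.map_mul, Polynomial.map_C, Polynomial.map_X, Polynomial.mul_comp,
    Polynomial.C_comp, Polynomial.X_comp] at h2
  rwa [← mul_assoc, ← Polynomial.C_mul, mul_inv_cancel₀ hc', Polynomial.C_1, one_mul,
    Polynomial.comp_X] at h2

/-- If the Galois group of `f_{F,P}` is not the full symmetric group, then the resolvent of a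
specialization of `f_{F,P}` has a proper factor. -/
theorem exists_monic_dvd_resolvent {n D : ℕ} (hn : n ≠ 0) (hD : 2 ≤ D) (u : Fin D → ℤ)
    (i : Fin (n + 2)) {F : MvPolynomial (Fin (n + 2)) ℂ} (hF : F.IsHomogeneous (D + 1))
    {P : Fin (n + 2) → ℂ} (hP : P i ≠ 0) (h0 : eval P F = 0)
    (hGal : ¬ Nonempty ((fFP F P).Gal ≃* Equiv.Perm (Fin D))) :
    ∃ (p z : Fin (n + 1) → ℂ) (y : LowExponent i D → ℂ), F = shear i p (perturbedForm i D z y) ∧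
      ∃ A : Polynomial (Polynomial ℂ), A.Monic ∧ A.natDegree ≠ 0 ∧ A.natDegree < D.factorial ∧
        A ∣ Polynomial.resolvent u (Polynomial.monicize D (Polynomial.perturbedTrinomial D
          (fun β : LowExponent i D => ∑ k : Fin (n + 1), (k : ℕ) * β.1 (i.succAbove k))
          (fun β => β.1 i) z y)) := by
  set p := (P i)⁻¹ • P with hp
  have hpi : p i = 1 := by simp [hp, hP]
  have hp0 : eval p F = 0 := hF.eval_smul_eq_zero _ h0
  have hPp : P = P i • p := (smul_inv_smul₀ hP P).symm
  obtain ⟨z, y, hFzy⟩ := exists_eq_shear_perturbedForm i (by lia) hF hpi hp0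
  refine ⟨_, z, y, hFzy, ?_⟩
  let K := RatFuncField (n + 2)
  let ι := algebraMap (MvPolynomial (Fin (n + 2)) ℂ) K
  set f := lineRestriction F p with hf
  have hfdeg : f.natDegree ≤ D := natDegree_lineRestriction_le i hF hpi hp0
  let L := (fFP F P).SplittingField
  have hs : ((f.map ι).map (algebraMap K L)).Splits := by
    have hc : ι (C (P i)) ≠ 0 :=
      (map_ne_zero_iff (ι.comp C) (RingHom.injective _)).2 hP
    have hcomp : fFP F P = (f.map ι).comp (Polynomial.C (ι (C (P i))) * Polynomial.X) := by
      rw [fFP_eq_map_lineRestriction, hPp, lineRestriction_smul, ← hPp, ← hf, Polynomial.map_comp,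
        Polynomial.map_mul, Polynomial.map_C, Polynomial.map_X]
    have h1 : ((fFP F P).map (algebraMap K L)).Splits := Polynomial.SplittingField.splits _
    exact splits_map_of_splits_comp_C_mul_X hc
      ((congrArg (fun g => (Polynomial.map (algebraMap K L) g).Splits) hcomp).mp h1)
  have hirr : ¬ Irreducible ((Polynomial.resolvent u (Polynomial.monicize D f)).map ι) := by
    intro hirr
    rw [Polynomial.resolvent_monicize_map] at hirr
    exact hGal (Polynomial.nonempty_gal_mulEquiv_perm hD u (natDegree_fFP_le hF hP h0)
      (Polynomial.natDegree_map_le.trans hfdeg) hs hirr)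
  have hdeg := Polynomial.natDegree_resolvent u (Polynomial.monicize D f)
  obtain ⟨q, hq, hq0, hqd, hqdvd⟩ := (Polynomial.monic_resolvent u
    (Polynomial.monicize D f)).exists_dvd_of_not_irreducible_map (K := K)
    (by rw [hdeg]; exact D.factorial_ne_zero) hirr
  refine ⟨q.map (toMomentCurve ℂ i).toRingHom, hq.map _, ?_, ?_, ?_⟩
  · rwa [hq.natDegree_map]
  · rwa [hq.natDegree_map, ← hdeg]
  · have := Polynomial.map_dvd (toMomentCurve ℂ i).toRingHom hqdvd
    rwa [Polynomial.resolvent_monicize_map, hf, hFzy, map_toMomentCurve_lineRestriction i hpi,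
      aeval_perturbedForm i hn] at this

theorem card_lowExponent_sum_lt {n D : ℕ} (i : Fin (n + 2)) :
    Nat.card (LowExponent i D ⊕ Fin (n + 1)) <
      Nat.card {β : Fin (n + 2) →₀ ℕ // β.degree = D + 1} := by
  let φ : LowExponent i D ⊕ Fin (n + 1) → {β : Fin (n + 2) →₀ ℕ // β.degree = D + 1} :=
    Sum.elim (fun β => ⟨β.1, β.2.1⟩) fun k =>
      ⟨Finsupp.single (i.succAbove k) 1 + Finsupp.single i D, by
        rw [map_add, Finsupp.degree_single, Finsupp.degree_single, add_comm]⟩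
  have hφr (k : Fin (n + 1)) : (φ (Sum.inr k)).1 i = D := by simp [φ]
  have hφl (β : LowExponent i D) : (φ (Sum.inl β)).1 i < D := β.2.2
  have hinj : Function.Injective φ := by
    rintro (β | k) (β' | k') h
    · have h' : (φ (Sum.inl β)).1 = (φ (Sum.inl β')).1 := congrArg (fun x => x.1) h
      exact congrArg Sum.inl (Subtype.ext h')
    · exact absurd (h ▸ hφl β) (hφr k').not_lt
    · exact absurd (h ▸ hφl β') (hφr k).not_lt
    · have h' := add_right_cancel (congrArg (fun x => x.1) h)
      exact congrArg Sum.inr (Fin.succAbove_right_injective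
        ((Finsupp.single_left_inj one_ne_zero).1 h'))
  refine lt_of_le_of_ne (Nat.card_le_card_of_injective φ hinj) fun h => ?_
  have hsurj := ((Nat.bijective_iff_injective_and_card φ).2 ⟨hinj, h⟩).2
  obtain ⟨x, hx⟩ := hsurj ⟨Finsupp.single i (D + 1), Finsupp.degree_single _ _⟩
  have hxi : (φ x).1 i = D + 1 := by rw [hx]; simp
  rcases x with β | k
  · have := hφl β
    lia
  · have := hφr k
    lia

/-- The degree-`(D + 1)` forms `F` for which some zero `P` of `F` with `P_i ≠ 0` is not uniform lie
in a proper closed subset. -/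
theorem exists_ne_zero_forall_nonempty_gal_mulEquiv {n D : ℕ} (hn : n ≠ 0) (hD : 2 ≤ D)
    (i : Fin (n + 2)) :
    ∃ Φ : MvPolynomial {β : Fin (n + 2) →₀ ℕ // β.degree = D + 1} ℂ, Φ ≠ 0 ∧
      ∀ F : MvPolynomial (Fin (n + 2)) ℂ, F.IsHomogeneous (D + 1) →
        eval (fun α => coeff α.1 F) Φ ≠ 0 → ∀ P : Fin (n + 2) → ℂ, P i ≠ 0 → eval P F = 0 →
          Nonempty ((fFP F P).Gal ≃* Equiv.Perm (Fin D)) := by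
  obtain ⟨u, hu⟩ := exists_resolvent_trinomialFamily hD
  let Y := LowExponent i D ⊕ Fin (n + 1)
  let Ψ (α : {β : Fin (n + 2) →₀ ℕ // β.degree = D + 1}) : MvPolynomial (Fin (n + 1) ⊕ Y) ℂ :=
    coeff α.1 (shear i (fun k => X (Sum.inr (Sum.inr k)))
      (perturbedForm i D (fun k => X (Sum.inl k)) fun β => X (Sum.inr (Sum.inl β))))
  have hΨ (v : Fin (n + 1) ⊕ Y → ℂ) (α) : eval v (Ψ α) =
      coeff α.1 (shear i (fun k => v (Sum.inr (Sum.inr k)))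
        (perturbedForm i D (fun k => v (Sum.inl k)) fun β => v (Sum.inr (Sum.inl β)))) := by
    rw [← coeff_map, map_shear, map_perturbedForm]
    simp only [eval_X]
  have key (e : ℕ) (he : e ∈ Finset.Ioo 0 D.factorial) :=
    Polynomial.exists_ne_zero_forall_eval_eq_zero hD hu (card_lowExponent_sum_lt i)
      (Sum.inl : LowExponent i D → Y)
      (fun β => ∑ k : Fin (n + 1), (k : ℕ) * β.1 (i.succAbove k)) (fun β => β.1 i) Ψ
      (Finset.mem_Ioo.1 he).1.ne' (Finset.mem_Ioo.1 he).2.ne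
  choose! Φ hΦ0 hΦ using key
  refine ⟨∏ e ∈ Finset.Ioo 0 D.factorial, Φ e, Finset.prod_ne_zero_iff.2 hΦ0, ?_⟩
  intro F hF hne P hP h0
  by_contra hGal
  obtain ⟨p, z, y, hFzy, A, hA, hA0, hAlt, hAdvd⟩ :=
    exists_monic_dvd_resolvent hn hD u i hF hP h0 hGal
  have hmem : A.natDegree ∈ Finset.Ioo 0 D.factorial :=
    Finset.mem_Ioo.2 ⟨Nat.pos_of_ne_zero hA0, hAlt⟩
  rw [map_prod] at hne
  refine Finset.prod_ne_zero_iff.1 hne _ hmem ?_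
  have := hΦ _ hmem (Sum.elim z (Sum.elim y p)) ⟨A, hA, rfl, hAdvd⟩
  simpa only [hΨ, Sum.elim_inl, Sum.elim_inr, ← hFzy] using this

theorem exists_isHomogeneous_eval_coeff_ne_zero {σ R : Type*} [Finite σ] [CommRing R] [IsDomain R]
    [Infinite R] {d : ℕ} {Q : MvPolynomial {β : σ →₀ ℕ // β.degree = d} R} (hQ : Q ≠ 0) :
    ∃ F : MvPolynomial σ R, F.IsHomogeneous d ∧ eval (fun α => coeff α.1 F) Q ≠ 0 := by
  obtain ⟨x, hx⟩ : ∃ x, eval x Q ≠ 0 := by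
    by_contra! h
    exact hQ (funext fun x => by rw [h, map_zero])
  have := Fintype.ofFinite {β : σ →₀ ℕ // β.degree = d}
  refine ⟨∑ α, monomial α.1 (x α), IsHomogeneous.sum _ _ _ fun α _ =>
    isHomogeneous_monomial _ α.2, ?_⟩
  have hcoeff (α : {β : σ →₀ ℕ // β.degree = d}) :
      coeff α.1 (∑ β, monomial β.1 (x β)) = x α := by
    classical
    simp [coeff_sum, coeff_monomial, Subtype.val_inj]
  simpa only [hcoeff] using hx

theorem eval_coeff_rename_subtype_val {σ R : Type*} [CommRing R] {p : (σ →₀ ℕ) → Prop}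
    (Q : MvPolynomial {β : σ →₀ ℕ // p β} R) (F : MvPolynomial σ R) :
    eval (fun s => coeff s F) (rename Subtype.val Q) = eval (fun α => coeff α.1 F) Q := by
  rw [eval_rename]
  rfl

end MvPolynomial

theorem nonempty_gal_mulEquiv_perm_fin_one {K : Type*} [Field K] {f : Polynomial K}
    (hf : f.natDegree ≤ 1) : Nonempty (f.Gal ≃* Equiv.Perm (Fin 1)) := by
  have := Polynomial.Gal.uniqueGalOfSplits f (Polynomial.Splits.of_natDegree_le_one hf)
  exact ⟨MulEquiv.ofUnique⟩

/-- For all `n ≥ 1`, `d ≥ 2`, a general homogeneous `F` of degree `d` in `n+2` variables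
(i.e. all `F` in the nonvanishing locus of some polynomial function `Φ` on `V_d` that is not
identically zero on `V_d`) satisfies: for every nonzero point `P ∈ ℂ^{n+2}` with `F(P) = 0`,
the Galois group of the splitting field of `f_{F,P}` over `K` is isomorphic to `S_{d-1}`. -/
theorem general_hypersurface_inner_points_uniform (n d : ℕ) (hn : 1 ≤ n) (hd : 2 ≤ d) :
    ∃ Φ : MvPolynomial ((Fin (n + 2)) →₀ ℕ) ℂ,
      (∃ F₀ : MvPolynomial (Fin (n + 2)) ℂ, F₀.IsHomogeneous d ∧
        MvPolynomial.eval (fun s => MvPolynomial.coeff s F₀) Φ ≠ 0) ∧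
      ∀ F : MvPolynomial (Fin (n + 2)) ℂ, F.IsHomogeneous d →
        MvPolynomial.eval (fun s => MvPolynomial.coeff s F) Φ ≠ 0 →
        ∀ P : Fin (n + 2) → ℂ, P ≠ 0 → MvPolynomial.eval P F = 0 →
          Nonempty ((fFP F P).Gal ≃* Equiv.Perm (Fin (d - 1))) := by
  obtain ⟨D, rfl⟩ : ∃ D, d = D + 1 := ⟨d - 1, by lia⟩
  rw [Nat.add_sub_cancel]
  obtain rfl | hD : D = 1 ∨ 2 ≤ D := by lia
  · refine ⟨1, ⟨0, MvPolynomial.isHomogeneous_zero _ _ _, by simp⟩, fun F hF _ P hP h0 => ?_⟩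
    obtain ⟨i, hi⟩ := Function.ne_iff.1 hP
    exact nonempty_gal_mulEquiv_perm_fin_one (MvPolynomial.natDegree_fFP_le hF hi h0)
  · choose Φ hΦ0 hΦ using
      MvPolynomial.exists_ne_zero_forall_nonempty_gal_mulEquiv (n := n) (D := D) (by lia) hD
    refine ⟨MvPolynomial.rename Subtype.val (∏ i, Φ i), ?_, fun F hF hne P hP h0 => ?_⟩
    · obtain ⟨F, hF, hne⟩ := MvPolynomial.exists_isHomogeneous_eval_coeff_ne_zero
        (Finset.prod_ne_zero_iff.2 fun i _ => hΦ0 i)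
      exact ⟨F, hF, by rwa [MvPolynomial.eval_coeff_rename_subtype_val]⟩
    · obtain ⟨i, hi⟩ := Function.ne_iff.1 hP
      rw [MvPolynomial.eval_coeff_rename_subtype_val, map_prod] at hne
      exact hΦ i F hF (Finset.prod_ne_zero_iff.1 hne i (Finset.mem_univ i)) P hi h0
end

section
/- For every integer n ≥ 1, a general homogeneous polynomial F of degree 3 in n+2 complex variables has the following property: for every point P ∈ ℂ^{n+2} with F(P) ≠ 0, the Galois group of the splitting field of the cubic polynomial f_{F,P}(t) over K is isomorphic to the full symmetric group S_3 (in particular it is not the alternating group A_3). Equivalently: every point of ℙ^{n+1} is uniform for a general cubic hypersurface X ⊂ ℙ^{n+1}. -/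
set_option synthInstance.maxHeartbeats 1000000
set_option maxHeartbeats 1000000

section Shift

open MvPolynomial

variable {m : ℕ}

/-- The directional derivative `∑ Pᵢ ∂/∂xᵢ`. -/
noncomputable def dirDeriv (P : Fin m → ℂ) :
    Derivation ℂ (MvPolynomial (Fin m) ℂ) (MvPolynomial (Fin m) ℂ) :=
  mkDerivation ℂ fun i => C (P i)

@[simp]
lemma dirDeriv_X (P : Fin m → ℂ) (i : Fin m) : dirDeriv P (X i) = C (P i) := by
  simp [dirDeriv]

@[simp]
lemma dirDeriv_C (P : Fin m → ℂ) (a : ℂ) : dirDeriv P (C a) = 0 := by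
  simp [dirDeriv]

lemma dirDeriv_eq_sum (P : Fin m → ℂ) (G : MvPolynomial (Fin m) ℂ) :
    dirDeriv P G = ∑ i, C (P i) * pderiv i G := by
  induction G using MvPolynomial.induction_on with
  | C a => simp
  | add p q hp hq => simp [hp, hq, mul_add, Finset.sum_add_distrib]
  | mul_X p i hp =>
    simp [hp, mul_add, Finset.sum_add_distrib, pderiv_X, Pi.single_apply, Finset.mul_sum]
    ring_nf

lemma MvPolynomial.IsHomogeneous.dirDeriv {G : MvPolynomial (Fin m) ℂ} {k : ℕ}
    (hG : G.IsHomogeneous k) (P : Fin m → ℂ) : (dirDeriv P G).IsHomogeneous (k - 1) := by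
  rw [dirDeriv_eq_sum]
  exact IsHomogeneous.sum _ _ _ fun i _ => hG.pderiv.C_mul _

lemma pderiv_dirDeriv (P : Fin m → ℂ) (i : Fin m) (G : MvPolynomial (Fin m) ℂ) :
    pderiv i (dirDeriv P G) = dirDeriv P (pderiv i G) := by
  have : ⁅(pderiv i : Derivation ℂ (MvPolynomial (Fin m) ℂ) _), dirDeriv P⁆ = 0 := by
    refine MvPolynomial.derivation_ext fun j => ?_
    rw [Derivation.commutator_apply]
    by_cases h : i = j
    · subst h; simp
    · simp [pderiv_X_of_ne (Ne.symm h)]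
  have h := congrArg (fun D => D G) this
  rw [Derivation.commutator_apply] at h
  exact sub_eq_zero.mp h

variable {S : Type*} [CommRing S] [Algebra ℂ S]

/-- The substitution `xᵢ ↦ Qᵢ + t Pᵢ`. -/
noncomputable def shift (P : Fin m → ℂ) (Q : Fin m → S) :
    MvPolynomial (Fin m) ℂ →ₐ[ℂ] Polynomial S :=
  aeval fun i => Polynomial.C (Q i) + Polynomial.C (algebraMap ℂ S (P i)) * Polynomial.X

lemma derivative_shift (P : Fin m → ℂ) (Q : Fin m → S) (G : MvPolynomial (Fin m) ℂ) :
    Polynomial.derivative (shift P Q G) = shift P Q (dirDeriv P G) := by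
  induction G using MvPolynomial.induction_on with
  | C a => simp [shift, algHom_C, Polynomial.algebraMap_apply]
  | add p q hp hq => simp [hp, hq]
  | mul_X p i hp =>
    rw [map_mul, Polynomial.derivative_mul, hp, Derivation.leibniz]
    simp [shift, algHom_C, Polynomial.algebraMap_apply]
    ring

lemma coeff_zero_shift (P : Fin m → ℂ) (Q : Fin m → S) (G : MvPolynomial (Fin m) ℂ) :
    (shift P Q G).coeff 0 = aeval Q G := by
  induction G using MvPolynomial.induction_on with
  | C a => simp [shift, algHom_C, Polynomial.algebraMap_apply]
  | add p q hp hq => simp [hp, hq]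
  | mul_X p i hp =>
    rw [map_mul, Polynomial.mul_coeff_zero, hp]
    simp [shift]

lemma coeff_shift (P : Fin m → ℂ) (Q : Fin m → S) (k : ℕ) (G : MvPolynomial (Fin m) ℂ) :
    (k.factorial : S) * (shift P Q G).coeff k = aeval Q ((dirDeriv P)^[k] G) := by
  induction k generalizing G with
  | zero => simp [coeff_zero_shift]
  | succ k ih =>
    rw [Function.iterate_succ_apply, ← ih, ← derivative_shift, Polynomial.coeff_derivative,
      Nat.factorial_succ]
    push_cast
    ring

lemma natDegree_shift_le (P : Fin m → ℂ) (Q : Fin m → S) {G : MvPolynomial (Fin m) ℂ} {k : ℕ}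
    (hG : G.IsHomogeneous k) : (shift P Q G).natDegree ≤ k := by
  rw [shift, aeval_def, eval₂_eq]
  refine Polynomial.natDegree_sum_le_of_forall_le _ _ fun s hs => ?_
  have hs' : ∑ i ∈ s.support, s i = k := by
    by_contra h
    exact mem_support_iff.mp hs (hG.coeff_eq_zero h)
  refine (Polynomial.natDegree_C_mul_le _ _).trans ?_
  refine (Polynomial.natDegree_prod_le _ _).trans (hs' ▸ Finset.sum_le_sum fun i _ => ?_)
  refine Polynomial.natDegree_pow_le_of_le (m := 1) _ ?_ |>.trans (by simp)
  compute_degree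

lemma eval_shift (P Q : Fin m → ℂ) (τ : ℂ) (G : MvPolynomial (Fin m) ℂ) :
    (shift P Q G).eval τ = eval (Q + τ • P) G := by
  rw [← Polynomial.coe_aeval_eq_eval, shift]
  change (Polynomial.aeval τ) _ = _
  rw [← MvPolynomial.coe_aeval_eq_eval]
  have := MvPolynomial.comp_aeval_apply (R := ℂ)
    (fun i => Polynomial.C (Q i) + Polynomial.C (algebraMap ℂ ℂ (P i)) * Polynomial.X)
    (Polynomial.aeval τ) G
  rw [this]
  have hQ : (fun i => (Polynomial.aeval τ) (Polynomial.C (Q i) +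
      Polynomial.C (algebraMap ℂ ℂ (P i)) * Polynomial.X)) = Q + τ • P := by
    funext i
    simp only [map_add, map_mul, Polynomial.aeval_C, Polynomial.aeval_X, Algebra.algebraMap_self,
      RingHom.id_apply, Pi.add_apply, Pi.smul_apply, smul_eq_mul, mul_comm]
  rw [hQ]
  rfl

lemma eval_add_smul_of_isHomogeneous_three {F : MvPolynomial (Fin m) ℂ} (hF : F.IsHomogeneous 3)
    (P Q : Fin m → ℂ) (τ : ℂ) :
    eval (Q + τ • P) F = eval Q F + τ * eval Q (dirDeriv P F) +
      τ ^ 2 / 2 * eval Q (dirDeriv P (dirDeriv P F)) +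
      τ ^ 3 / 6 * eval Q (dirDeriv P (dirDeriv P (dirDeriv P F))) := by
  rw [← eval_shift, Polynomial.eval_eq_sum_range' (n := 4)
    (Nat.lt_succ_of_le (natDegree_shift_le P Q hF))]
  have h := fun k => coeff_shift P Q k F
  have h0 := h 0
  have h1 := h 1
  have h2 := h 2
  have h3 := h 3
  simp [Nat.factorial, MvPolynomial.aeval_eq_eval] at h0 h1 h2 h3
  simp only [Finset.sum_range_succ, Finset.sum_range_zero]
  rw [← h0, ← h1, ← h2, ← h3]
  ring

lemma eval_add_smul_of_isHomogeneous_two {F : MvPolynomial (Fin m) ℂ} (hF : F.IsHomogeneous 2)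
    (P Q : Fin m → ℂ) (τ : ℂ) :
    eval (Q + τ • P) F = eval Q F + τ * eval Q (dirDeriv P F) +
      τ ^ 2 / 2 * eval Q (dirDeriv P (dirDeriv P F)) := by
  rw [← eval_shift, Polynomial.eval_eq_sum_range' (n := 3)
    (Nat.lt_succ_of_le (natDegree_shift_le P Q hF))]
  have h := fun k => coeff_shift P Q k F
  have h0 := h 0
  have h1 := h 1
  have h2 := h 2
  simp [Nat.factorial, MvPolynomial.aeval_eq_eval] at h0 h1 h2
  simp only [Finset.sum_range_succ, Finset.sum_range_zero]
  rw [← h0, ← h1, ← h2]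
  ring

lemma eval_add_smul_of_isHomogeneous_one {F : MvPolynomial (Fin m) ℂ} (hF : F.IsHomogeneous 1)
    (P Q : Fin m → ℂ) (τ : ℂ) :
    eval (Q + τ • P) F = eval Q F + τ * eval Q (dirDeriv P F) := by
  rw [← eval_shift, Polynomial.eval_eq_sum_range' (n := 2)
    (Nat.lt_succ_of_le (natDegree_shift_le P Q hF))]
  have h := fun k => coeff_shift P Q k F
  have h0 := h 0
  have h1 := h 1
  simp [Nat.factorial, MvPolynomial.aeval_eq_eval] at h0 h1
  simp only [Finset.sum_range_succ, Finset.sum_range_zero]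
  rw [← h0, ← h1]
  ring

end Shift

section Polar

open MvPolynomial

variable {m : ℕ}

lemma MvPolynomial.IsHomogeneous.eval_zero_eq_zero {G : MvPolynomial (Fin m) ℂ} {k : ℕ}
    (hG : G.IsHomogeneous k) (hk : k ≠ 0) : eval 0 G = 0 := by
  rw [eval_zero, constantCoeff_eq]
  exact hG.coeff_eq_zero (by simpa using hk.symm)

/-- The coefficient of `t ^ 2` in `F (Q + t P)`. -/
noncomputable def halfSndDeriv (P : Fin m → ℂ) (F : MvPolynomial (Fin m) ℂ) :
    MvPolynomial (Fin m) ℂ :=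
  C (1 / 2) * dirDeriv P (dirDeriv P F)

lemma MvPolynomial.IsHomogeneous.halfSndDeriv {F : MvPolynomial (Fin m) ℂ}
    (hF : F.IsHomogeneous 3) (P : Fin m → ℂ) : (halfSndDeriv P F).IsHomogeneous 1 :=
  ((hF.dirDeriv P).dirDeriv P).C_mul _

lemma dirDeriv_dirDeriv (P : Fin m → ℂ) (F : MvPolynomial (Fin m) ℂ) :
    dirDeriv P (dirDeriv P F) = C 2 * halfSndDeriv P F := by
  rw [halfSndDeriv, ← mul_assoc, ← C_mul]
  norm_num

lemma dirDeriv_three {F : MvPolynomial (Fin m) ℂ} (hF : F.IsHomogeneous 3) (P : Fin m → ℂ) :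
    dirDeriv P (dirDeriv P (dirDeriv P F)) = C (6 * eval P F) := by
  have h1 := hF.dirDeriv P
  have h2 := h1.dirDeriv P
  have h3 := h2.dirDeriv P
  have h := eval_add_smul_of_isHomogeneous_three hF P 0 1
  rw [hF.eval_zero_eq_zero (by norm_num), h1.eval_zero_eq_zero (by norm_num),
    h2.eval_zero_eq_zero (by norm_num)] at h
  rw [totalDegree_eq_zero_iff_eq_C.mp (Nat.le_zero.mp h3.totalDegree_le)] at h ⊢
  simp only [eval_C, zero_add, one_smul] at h
  rw [h]
  congr 1
  ring

lemma dirDeriv_halfSndDeriv {F : MvPolynomial (Fin m) ℂ} (hF : F.IsHomogeneous 3)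
    (P : Fin m → ℂ) : dirDeriv P (halfSndDeriv P F) = C (3 * eval P F) := by
  rw [halfSndDeriv, Derivation.leibniz, dirDeriv_three hF, dirDeriv_C, smul_zero, add_zero,
    smul_eq_mul, ← C_mul]
  congr 1
  ring

section

variable {F : MvPolynomial (Fin m) ℂ} (hF : F.IsHomogeneous 3) (P Q : Fin m → ℂ) (τ : ℂ)
include hF

lemma eval_add_smul :
    eval (Q + τ • P) F = eval Q F + τ * eval Q (dirDeriv P F) +
      τ ^ 2 * eval Q (halfSndDeriv P F) + τ ^ 3 * eval P F := by
  rw [eval_add_smul_of_isHomogeneous_three hF, dirDeriv_three hF, dirDeriv_dirDeriv]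
  simp only [map_mul, eval_C]
  ring

lemma eval_add_smul_dirDeriv :
    eval (Q + τ • P) (dirDeriv P F) = eval Q (dirDeriv P F) +
      2 * τ * eval Q (halfSndDeriv P F) + 3 * τ ^ 2 * eval P F := by
  rw [eval_add_smul_of_isHomogeneous_two (hF.dirDeriv P), dirDeriv_three hF, dirDeriv_dirDeriv]
  simp only [map_mul, eval_C]
  ring

lemma eval_add_smul_halfSndDeriv :
    eval (Q + τ • P) (halfSndDeriv P F) = eval Q (halfSndDeriv P F) + 3 * τ * eval P F := by
  rw [eval_add_smul_of_isHomogeneous_one (hF.halfSndDeriv P), dirDeriv_halfSndDeriv hF]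
  simp only [map_mul, eval_C]
  ring

lemma eval_add_smul_pderiv (i : Fin m) :
    eval (Q + τ • P) (pderiv i F) = eval Q (pderiv i F) +
      τ * eval Q (pderiv i (dirDeriv P F)) + τ ^ 2 * eval Q (pderiv i (halfSndDeriv P F)) := by
  rw [eval_add_smul_of_isHomogeneous_two hF.pderiv, halfSndDeriv, pderiv_C_mul,
    pderiv_dirDeriv P i (dirDeriv P F), pderiv_dirDeriv P i F]
  simp only [map_mul, eval_C]
  ring

end

lemma exists_dvd_pow_of_zeros_subset {p g : MvPolynomial (Fin m) ℂ}
    (h : ∀ Q, eval Q p = 0 → eval Q g = 0) : ∃ k, p ∣ g ^ k := by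
  have hg : g ∈ vanishingIdeal ℂ (zeroLocus ℂ (Ideal.span {p})) := by
    rw [mem_vanishingIdeal_iff]
    intro Q hQ
    rw [zeroLocus_span] at hQ
    simpa [aeval_eq_eval] using h Q (by simpa [aeval_eq_eval] using hQ)
  rw [vanishingIdeal_zeroLocus_eq_radical] at hg
  obtain ⟨k, hk⟩ := hg
  exact ⟨k, Ideal.mem_span_singleton.mp hk⟩

lemma exists_two_ne (hm : 3 ≤ m) (j : Fin m) : ∃ k l : Fin m, k ≠ j ∧ l ≠ j ∧ k ≠ l := by
  have h : 1 < (Finset.univ.erase j).card := by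
    rw [Finset.card_erase_of_mem (Finset.mem_univ _), Finset.card_univ, Fintype.card_fin]
    omega
  obtain ⟨k, hk, l, hl, hkl⟩ := Finset.one_lt_card.mp h
  exact ⟨k, l, Finset.ne_of_mem_erase hk, Finset.ne_of_mem_erase hl, hkl⟩

/-- A nonconstant hypersurface in a space of dimension at least three is not contained in a
line through the origin. -/
lemma exists_zero_notMem_line (hm : 3 ≤ m) {P : Fin m → ℂ} (hP : P ≠ 0)
    {h : MvPolynomial (Fin m) ℂ} (hh : ¬ IsUnit h) :
    ∃ Q, (∀ τ : ℂ, Q + τ • P ≠ 0) ∧ eval Q h = 0 := by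
  by_contra! hcon
  obtain ⟨j, hj⟩ : ∃ j, P j ≠ 0 := Function.ne_iff.mp hP
  obtain ⟨k, l, hkj, hlj, hkl⟩ := exists_two_ne hm j
  set L : Fin m → MvPolynomial (Fin m) ℂ := fun i => C (P j) * X i - C (P i) * X j with hL
  have hzero : ∀ i Q, eval Q h = 0 → eval Q (L i) = 0 := by
    intro i Q hQ
    have : ∃ τ : ℂ, Q + τ • P = 0 := by
      by_contra! hne
      exact hcon Q hne hQ
    obtain ⟨τ, hτ⟩ := this
    have h1 := congrFun hτ i
    have h2 := congrFun hτ j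
    simp only [Pi.add_apply, Pi.smul_apply, smul_eq_mul, Pi.zero_apply] at h1 h2
    simp only [hL, map_sub, map_mul, eval_C, eval_X]
    linear_combination P j * h1 - P i * h2
  have hevk : ∀ i s, i ≠ j → s ≠ j → eval (Pi.single s 1) (L i) = if i = s then P j else 0 := by
    intro i s hi hs
    simp [hL, Pi.single_apply, hs.symm]
  obtain ⟨a, ha⟩ := exists_dvd_pow_of_zeros_subset (hzero k)
  obtain ⟨b, hb⟩ := exists_dvd_pow_of_zeros_subset (hzero l)
  have hLk : L k ≠ 0 := by
    intro h0
    have := hevk k k hkj hkj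
    rw [h0] at this
    simp at this
    exact hj this.symm
  have h0 : h ≠ 0 := by
    rintro rfl
    exact hLk (IsReduced.eq_zero _ ⟨a, zero_dvd_iff.mp ha⟩)
  obtain ⟨p, hp, hph⟩ := WfDvdMonoid.exists_irreducible_factor hh h0
  obtain ⟨g, hg⟩ := hp.prime.dvd_of_dvd_pow (hph.trans ha)
  have hpl := hp.prime.dvd_of_dvd_pow (hph.trans hb)
  have hg0 : g ≠ 0 := by rintro rfl; simp [hg] at hLk
  have hdeg : p.totalDegree + g.totalDegree ≤ 1 := by
    rw [← totalDegree_mul_of_isDomain hp.ne_zero hg0, ← hg]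
    have : (L k).IsHomogeneous 1 :=
      ((isHomogeneous_X _ _).C_mul _).sub ((isHomogeneous_X _ _).C_mul _)
    exact this.totalDegree_le
  have hpdeg : p.totalDegree ≠ 0 := by
    intro hd
    rw [totalDegree_eq_zero_iff_eq_C] at hd
    refine hp.not_isUnit ?_
    have : p.coeff 0 ≠ 0 := fun hc => hp.ne_zero (by rw [hd, hc, C_0])
    rw [hd]
    exact (isUnit_iff_ne_zero.mpr this).map C
  have hgC := totalDegree_eq_zero_iff_eq_C.mp (show g.totalDegree = 0 by omega)
  have hc : g.coeff 0 ≠ 0 := fun hc => hg0 (by rw [hgC, hc, C_0])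
  have hep : eval (Pi.single l 1) p = 0 := by
    have := hevk k l hkj hlj
    rw [hg, hgC, map_mul, eval_C, if_neg hkl] at this
    exact (mul_eq_zero.mp this).resolve_right hc
  obtain ⟨g', hg'⟩ := hpl
  have := hevk l l hlj hlj
  rw [hg', map_mul, hep, zero_mul, if_pos rfl] at this
  exact hj this.symm

end Polar

section Discriminant

open MvPolynomial

variable {m : ℕ} {F : MvPolynomial (Fin m) ℂ} {P : Fin m → ℂ}

/-- The cubic `F(Q + t P)` in `t`, with coefficients in `ℂ[Q]`. -/
noncomputable def lineCubic (F : MvPolynomial (Fin m) ℂ) (P : Fin m → ℂ) :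
    Cubic (MvPolynomial (Fin m) ℂ) :=
  ⟨C (eval P F), halfSndDeriv P F, dirDeriv P F, F⟩

/-- Nine times the opposite of the linear coefficient of the depressed monic cubic, up to the
square of the leading coefficient. -/
noncomputable def depressedQuadric (F : MvPolynomial (Fin m) ℂ) (P : Fin m → ℂ) :
    MvPolynomial (Fin m) ℂ :=
  halfSndDeriv P F ^ 2 - C (3 * eval P F) * dirDeriv P F

/-- The constant coefficient of the depressed cubic, up to a power of the leading coefficient. -/
noncomputable def depressedCubic (F : MvPolynomial (Fin m) ℂ) (P : Fin m → ℂ) :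
    MvPolynomial (Fin m) ℂ :=
  C 2 * halfSndDeriv P F ^ 3 - C (9 * eval P F) * (halfSndDeriv P F * dirDeriv P F) +
    C (27 * eval P F ^ 2) * F

lemma isHomogeneous_depressedQuadric (hF : F.IsHomogeneous 3) (P : Fin m → ℂ) :
    (depressedQuadric F P).IsHomogeneous 2 :=
  ((hF.halfSndDeriv P).pow 2).sub ((hF.dirDeriv P).C_mul _)

lemma isHomogeneous_depressedCubic (hF : F.IsHomogeneous 3) (P : Fin m → ℂ) :
    (depressedCubic F P).IsHomogeneous 3 :=
  ((((hF.halfSndDeriv P).pow 3).C_mul _).sub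
    (((hF.halfSndDeriv P).mul (hF.dirDeriv P)).C_mul _)).add (hF.C_mul _)

lemma C_mul_discr_lineCubic (F : MvPolynomial (Fin m) ℂ) (P : Fin m → ℂ) :
    C (27 * eval P F ^ 2) * (lineCubic F P).discr =
      4 * depressedQuadric F P ^ 3 - depressedCubic F P ^ 2 := by
  simp only [Cubic.discr, lineCubic, depressedQuadric, depressedCubic, C_mul, C_pow,
    map_ofNat]
  ring

/-- If `F` is nonsingular, then `F(Q + t P)` has no root which is polynomial in `Q`. -/
lemma lineCubic_no_root (hm : 3 ≤ m) (hF : F.IsHomogeneous 3) (hP : eval P F ≠ 0)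
    (hsm : ∀ Q : Fin m → ℂ, Q ≠ 0 → ∃ i, eval Q (pderiv i F) ≠ 0) (r : MvPolynomial (Fin m) ℂ) :
    C (eval P F) * r ^ 3 + halfSndDeriv P F * r ^ 2 + dirDeriv P F * r + F ≠ 0 := by
  intro hr
  have hP0 : P ≠ 0 := by
    rintro rfl
    exact hP (hF.eval_zero_eq_zero (by norm_num))
  have hr0 : eval 0 r = 0 := by
    have h := congrArg (eval 0) hr
    simp only [map_add, map_mul, map_pow, eval_C, hF.eval_zero_eq_zero (show 3 ≠ 0 by norm_num),
      (hF.dirDeriv P).eval_zero_eq_zero (show 3 - 1 ≠ 0 by norm_num),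
      (hF.halfSndDeriv P).eval_zero_eq_zero (show 1 ≠ 0 by norm_num), map_zero] at h
    simpa [hP] using h
  obtain ⟨Q, hQ, hQ0⟩ := exists_zero_notMem_line hm hP0
    (h := C (3 * eval P F) * r ^ 2 + C 2 * halfSndDeriv P F * r + dirDeriv P F) (by
      intro hu
      have h := hu.map (eval 0)
      simp only [map_add, map_mul, map_pow, hr0,
        (hF.dirDeriv P).eval_zero_eq_zero (show 3 - 1 ≠ 0 by norm_num)] at h
      simp at h)
  obtain ⟨i, hi⟩ := hsm _ (hQ (eval Q r))
  refine hi ?_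
  rw [eval_add_smul_pderiv hF]
  have h := congrArg (fun G => eval Q (pderiv i G)) hr
  simp only [map_add, pderiv_mul, pderiv_C, pderiv_pow, map_mul, map_pow, eval_C, map_zero,
    map_natCast] at h
  simp only [map_add, map_mul, map_pow, eval_C] at hQ0
  push_cast at h
  norm_num at h
  linear_combination h - eval Q (pderiv i r) * hQ0

/-- If `F` is nonsingular, every square root of the discriminant vanishes only where the
depressed cubic has a triple root. -/
lemma eval_depressedQuadric_eq_zero (hF : F.IsHomogeneous 3) (hP : eval P F ≠ 0)
    (hsm : ∀ Q : Fin m → ℂ, Q ≠ 0 → ∃ i, eval Q (pderiv i F) ≠ 0) {d : MvPolynomial (Fin m) ℂ}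
    (hd : (lineCubic F P).discr = d ^ 2) {Q : Fin m → ℂ} (hQ : eval Q d = 0) :
    eval Q (depressedQuadric F P) = 0 := by
  by_contra hq
  have hdisc : ∀ Q, eval Q d ^ 2 = eval Q (lineCubic F P).discr := fun Q => by
    rw [hd, map_pow]
  have hD := hdisc Q
  simp only [Cubic.discr, lineCubic, map_add, map_sub, map_mul, map_pow, eval_C, map_ofNat,
    hQ] at hD
  simp only [depressedQuadric, map_sub, map_mul, map_pow, eval_C] at hq
  set a := eval P F with ha
  set b := eval Q (halfSndDeriv P F) with hb
  set c := eval Q (dirDeriv P F) with hc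
  set e := eval Q F with he
  set τ := (9 * a * e - b * c) / (2 * (b ^ 2 - 3 * a * c)) with hτ
  have hτ' : τ * (2 * (b ^ 2 - 3 * a * c)) = 9 * a * e - b * c := by
    rw [hτ]; exact div_mul_cancel₀ _ (mul_ne_zero two_ne_zero hq)
  have hf' : c + 2 * τ * b + 3 * τ ^ 2 * a = 0 := by
    have : 4 * (b ^ 2 - 3 * a * c) ^ 2 * (c + 2 * τ * b + 3 * τ ^ 2 * a) = 0 := by
      linear_combination 9 * a * hD + (4 * b * (b ^ 2 - 3 * a * c) +
        3 * a * (τ * (2 * (b ^ 2 - 3 * a * c)) + 9 * a * e - b * c)) * hτ'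
    exact (mul_eq_zero.mp this).resolve_left
      (mul_ne_zero (by norm_num) (pow_ne_zero 2 hq))
  have hz : (b + 3 * τ * a) ^ 2 = b ^ 2 - 3 * a * c := by
    linear_combination 3 * a * hf'
  have hf : e + τ * c + τ ^ 2 * b + τ ^ 3 * a = 0 := by
    have : 9 * a * (e + τ * c + τ ^ 2 * b + τ ^ 3 * a) = 0 := by
      linear_combination (3 * a * τ + b) * hf' - hτ'
    exact (mul_eq_zero.mp this).resolve_left (by simpa using hP)
  have hE := eval_add_smul hF P Q τ
  have hC := eval_add_smul_dirDeriv hF P Q τ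
  have hB := eval_add_smul_halfSndDeriv hF P Q τ
  rw [← ha, ← hb, ← hc, ← he, hf] at hE
  rw [← ha, ← hb, ← hc, hf'] at hC
  set Q' := Q + τ • P
  have hB0 : eval Q' (halfSndDeriv P F) ≠ 0 := by
    intro h0
    rw [← hb, ← ha, h0] at hB
    rw [← hB] at hz
    exact hq (by rw [← hz]; ring)
  have hQ'0 : Q' ≠ 0 := by
    intro h0
    exact hB0 (by rw [h0]; exact (hF.halfSndDeriv P).eval_zero_eq_zero one_ne_zero)
  have hdQ' : eval Q' d = 0 := by
    have := hdisc Q'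
    simp only [Cubic.discr, lineCubic, map_add, map_sub, map_mul, map_pow, eval_C, map_ofNat, hE,
      hC] at this
    exact pow_eq_zero_iff (two_ne_zero) |>.mp (this.trans (by ring))
  obtain ⟨i, hi⟩ := hsm Q' hQ'0
  have h := congrArg (fun G => eval Q' (pderiv i G)) hd
  have h4 : pderiv i (4 : MvPolynomial (Fin m) ℂ) = 0 := pderiv_C (a := (4 : ℂ))
  have h27 : pderiv i (27 : MvPolynomial (Fin m) ℂ) = 0 := pderiv_C (a := (27 : ℂ))
  have h18 : pderiv i (18 : MvPolynomial (Fin m) ℂ) = 0 := pderiv_C (a := (18 : ℂ))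
  simp only [Cubic.discr, lineCubic, map_add, map_sub, pderiv_mul, pderiv_pow, pderiv_C,
    map_mul, map_pow, eval_C, map_ofNat, map_natCast, map_zero, hE, hC, hdQ', h4, h27, h18] at h
  have : eval Q' (halfSndDeriv P F) ^ 3 * eval Q' (pderiv i F) = 0 := by
    linear_combination (-1 / 4) * h
  exact (mul_ne_zero (pow_ne_zero 3 hB0) hi) this

lemma not_sq_dvd_depressedCubic (hm : 3 ≤ m) (hF : F.IsHomogeneous 3) (hP : eval P F ≠ 0)
    (hsm : ∀ Q : Fin m → ℂ, Q ≠ 0 → ∃ i, eval Q (pderiv i F) ≠ 0) {x : MvPolynomial (Fin m) ℂ}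
    (hx : ¬ IsUnit x) (hxq : x ∣ depressedQuadric F P) : ¬ x * x ∣ depressedCubic F P := by
  rintro ⟨w, hw⟩
  have hP0 : P ≠ 0 := by
    rintro rfl
    exact hP (hF.eval_zero_eq_zero (by norm_num))
  obtain ⟨Q, hQ, hxQ⟩ := exists_zero_notMem_line hm hP0 hx
  have hq : eval Q (depressedQuadric F P) = 0 := by
    obtain ⟨y, hy⟩ := hxq
    rw [hy, map_mul, hxQ, zero_mul]
  simp only [depressedQuadric, map_sub, map_mul, map_pow, eval_C] at hq
  set τ := -eval Q (halfSndDeriv P F) / (3 * eval P F) with hτ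
  obtain ⟨i, hi⟩ := hsm _ (hQ τ)
  have h := congrArg (fun G => eval Q (pderiv i G)) hw
  simp only [depressedCubic, map_add, map_sub, pderiv_mul, pderiv_pow, pderiv_C,
    map_mul, map_pow, eval_C, map_natCast, hxQ] at h
  refine hi ?_
  rw [eval_add_smul_pderiv hF]
  have hτ' : 3 * eval P F * τ = -eval Q (halfSndDeriv P F) := by
    rw [hτ]; field_simp
  have h27 : (27 * eval P F ^ 2 : ℂ) ≠ 0 := by simpa using hP
  refine (mul_eq_zero.mp ?_).resolve_left h27
  push_cast at h
  norm_num at h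
  linear_combination h - 3 * eval Q (pderiv i (halfSndDeriv P F)) * hq +
    (9 * eval P F * eval Q (pderiv i (dirDeriv P F)) + 3 * eval Q (pderiv i (halfSndDeriv P F)) *
      (3 * eval P F * τ - eval Q (halfSndDeriv P F))) * hτ'

/-- If `F` is nonsingular and its polar quadric at `P` is not the square of the corresponding
linear polar, then the discriminant of `F(Q + t P)` is not a square. -/
lemma discr_lineCubic_ne_sq (hm : 3 ≤ m) (hF : F.IsHomogeneous 3) (hP : eval P F ≠ 0)
    (hsm : ∀ Q : Fin m → ℂ, Q ≠ 0 → ∃ i, eval Q (pderiv i F) ≠ 0)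
    (hq : depressedQuadric F P ≠ 0) (d : MvPolynomial (Fin m) ℂ) :
    (lineCubic F P).discr ≠ d ^ 2 := by
  intro hd
  have hzero := fun Q => eval_depressedQuadric_eq_zero hF hP hsm hd (Q := Q)
  have hd0 : d ≠ 0 := by
    rintro rfl
    exact hq (funext fun Q => by rw [hzero Q (map_zero _), map_zero])
  have h27 : (C (27 * eval P F ^ 2) : MvPolynomial (Fin m) ℂ) ≠ 0 := by
    rw [Ne, C_eq_zero]; simpa using hP
  have hid : C (27 * eval P F ^ 2) * d ^ 2 =
      4 * depressedQuadric F P ^ 3 - depressedCubic F P ^ 2 := by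
    rw [← hd, C_mul_discr_lineCubic]
  obtain ⟨k, hk⟩ := exists_dvd_pow_of_zeros_subset hzero
  have hsq : Squarefree d := by
    rw [squarefree_iff_irreducible_sq_not_dvd_of_ne_zero hd0]
    rintro x hx ⟨y, hy⟩
    have hxq : x ∣ depressedQuadric F P :=
      hx.prime.dvd_of_dvd_pow (((Dvd.intro _ (by rw [hy, mul_assoc])).trans hk))
    refine not_sq_dvd_depressedCubic hm hF hP hsm hx.not_isUnit hxq ?_
    obtain ⟨z, hz⟩ := hxq
    have hc2 : depressedCubic F P ^ 2 =
        x ^ 3 * (4 * z ^ 3 - C (27 * eval P F ^ 2) * x * y ^ 2) := by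
      rw [hz, hy] at hid
      linear_combination hid
    obtain ⟨w, hw⟩ := hx.prime.dvd_of_dvd_pow (Dvd.intro_left
      (x ^ 2 * (4 * z ^ 3 - C (27 * eval P F ^ 2) * x * y ^ 2)) (by rw [hc2]; ring) :
      x ∣ depressedCubic F P ^ 2)
    have hw2 : x ∣ w ^ 2 := by
      refine ⟨4 * z ^ 3 - C (27 * eval P F ^ 2) * x * y ^ 2,
        mul_left_cancel₀ (pow_ne_zero 2 hx.ne_zero) ?_⟩
      rw [hw] at hc2
      linear_combination hc2
    obtain ⟨v, hv⟩ := hx.prime.dvd_of_dvd_pow hw2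
    exact ⟨v, by rw [hw, hv, mul_assoc]⟩
  have hdq : d ∣ depressedQuadric F P := by
    have h : d ∣ depressedQuadric F P ^ (k + 1) := hk.trans (pow_dvd_pow _ k.le_succ)
    exact (hsq.dvd_pow_iff_dvd k.succ_ne_zero).mp h
  have hhom : (C (27 * eval P F ^ 2) * d ^ 2).IsHomogeneous 6 := by
    rw [hid]
    have h1 := ((isHomogeneous_depressedQuadric hF P).pow 3).C_mul 4
    have h2 := (isHomogeneous_depressedCubic hF P).pow 2
    rw [map_ofNat] at h1
    exact h1.sub h2
  have hdeg := hhom.totalDegree (mul_ne_zero h27 (pow_ne_zero 2 hd0))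
  rw [totalDegree_mul_of_isDomain h27 (pow_ne_zero 2 hd0), totalDegree_C, pow_two,
    totalDegree_mul_of_isDomain hd0 hd0] at hdeg
  obtain ⟨y, hy⟩ := hdq
  have hy0 : y ≠ 0 := by rintro rfl; simp [hy] at hq
  have hle := (isHomogeneous_depressedQuadric hF P).totalDegree_le
  rw [hy, totalDegree_mul_of_isDomain hd0 hy0] at hle
  omega

end Discriminant

section Galois

lemma nonempty_gal_mulEquiv_perm_fin_three {K : Type*} [Field K] [CharZero K] (T : Cubic K)
    (ha : T.a ≠ 0) (hroot : ∀ x : K, ¬ T.toPoly.IsRoot x) (hsq : ∀ d : K, T.discr ≠ d ^ 2) :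
    Nonempty (T.toPoly.Gal ≃* Equiv.Perm (Fin 3)) := by
  classical
  have hdeg : T.toPoly.natDegree = 3 := Cubic.natDegree_of_a_ne_zero ha
  have h0 : T.toPoly ≠ 0 := Cubic.ne_zero_of_a_ne_zero ha
  have hirr : Irreducible T.toPoly := by
    rw [Polynomial.irreducible_iff_roots_eq_zero_of_degree_le_three (by omega) (by omega)]
    refine Multiset.eq_zero_of_forall_notMem fun x hx => hroot x ?_
    exact (Polynomial.mem_roots h0).mp hx
  have hsplit := Polynomial.SplittingField.splits T.toPoly
  have : Fact ((T.toPoly.map (algebraMap K T.toPoly.SplittingField)).Splits) := ⟨hsplit⟩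
  have : IsGalois K T.toPoly.SplittingField :=
    IsGalois.of_separable_splitting_field hirr.separable
  have hcard : Nat.card (T.toPoly.rootSet T.toPoly.SplittingField) = 3 := by
    rw [Nat.card_eq_fintype_card, Polynomial.card_rootSet_eq_natDegree hirr.separable hsplit, hdeg]
  have hinj := Polynomial.Gal.galActionHom_injective T.toPoly T.toPoly.SplittingField
  have hdvd := Subgroup.card_dvd_of_injective _ hinj
  have hperm : Nat.card (Equiv.Perm (T.toPoly.rootSet T.toPoly.SplittingField)) = 6 := by
    rw [Nat.card_perm, hcard]
    rfl
  rw [hperm] at hdvd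
  have h3 : 3 ∣ Nat.card T.toPoly.Gal := by
    have := Polynomial.Gal.prime_degree_dvd_card hirr (by rw [hdeg]; exact Nat.prime_three)
    rwa [hdeg] at this
  have hne3 : Nat.card T.toPoly.Gal ≠ 3 := by
    intro hc
    obtain ⟨x, y, z, hxyz⟩ := (Cubic.splits_iff_roots_eq_three ha).mp hsplit
    have hdisc := Cubic.discr_eq_prod_three_roots ha hxyz
    set δ := algebraMap K T.toPoly.SplittingField T.a * algebraMap K T.toPoly.SplittingField T.a *
      (x - y) * (x - z) * (y - z)
    have hδ0 : δ ≠ 0 := by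
      intro h
      rw [h, zero_pow two_ne_zero, map_eq_zero] at hdisc
      exact hsq 0 (by rw [hdisc, zero_pow two_ne_zero])
    have hfix : ∀ g : T.toPoly.SplittingField ≃ₐ[K] T.toPoly.SplittingField, g δ = δ := by
      intro g
      have hg : (g δ) ^ 2 = δ ^ 2 := by
        rw [← map_pow, ← hdisc, AlgEquiv.commutes]
      refine (sq_eq_sq_iff_eq_or_eq_neg.mp hg).resolve_right fun hneg => ?_
      have hg3 : g ^ 3 = 1 := by
        have : g ^ Nat.card T.toPoly.Gal = 1 := pow_card_eq_one' (G := T.toPoly.Gal)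
        rwa [hc] at this
      have h := congrArg (fun e => e δ) hg3
      simp only [pow_succ, pow_zero, one_mul, AlgEquiv.mul_apply, AlgEquiv.one_apply, hneg,
        map_neg, neg_neg] at h
      exact hδ0 (self_eq_neg.mp h.symm)
    obtain ⟨d, hd⟩ := (IsGalois.mem_range_algebraMap_iff_fixed δ).mpr hfix
    refine hsq d ((algebraMap K T.toPoly.SplittingField).injective ?_)
    rw [hdisc, ← hd, map_pow]
  have h6 : Nat.card T.toPoly.Gal = 6 := by
    obtain ⟨k, hk⟩ := h3
    have hle := Nat.le_of_dvd (by norm_num) hdvd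
    have hpos : 0 < Nat.card T.toPoly.Gal := Nat.card_pos
    have hk2 : k = 2 := by omega
    rw [hk, hk2]
  have hbij : Function.Bijective
      (Polynomial.Gal.galActionHom T.toPoly T.toPoly.SplittingField) := by
    rw [Nat.bijective_iff_injective_and_card]
    exact ⟨hinj, by rw [h6, hperm]⟩
  have e : T.toPoly.rootSet T.toPoly.SplittingField ≃ Fin 3 := Finite.equivFinOfCardEq hcard
  exact ⟨(MulEquiv.ofBijective _ hbij).trans e.permCongrHom⟩

open MvPolynomial

variable {m : ℕ} {F : MvPolynomial (Fin m) ℂ}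

lemma fFP_eq_shift (F : MvPolynomial (Fin m) ℂ) (P : Fin m → ℂ) :
    fFP F P = shift P (fun i => algebraMap (MvPolynomial (Fin m) ℂ) (RatFuncField m) (X i)) F :=
  rfl

lemma fFP_eq_toPoly (hF : F.IsHomogeneous 3) (P : Fin m → ℂ) :
    fFP F P = ((lineCubic F P).map
      (algebraMap (MvPolynomial (Fin m) ℂ) (RatFuncField m))).toPoly := by
  rw [fFP_eq_shift]
  set Q : Fin m → RatFuncField m :=
    fun i => algebraMap (MvPolynomial (Fin m) ℂ) (RatFuncField m) (X i) with hQ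
  have haeval : ∀ G, aeval Q G = algebraMap (MvPolynomial (Fin m) ℂ) (RatFuncField m) G := by
    intro G
    have : aeval Q = IsScalarTower.toAlgHom ℂ (MvPolynomial (Fin m) ℂ) (RatFuncField m) := by
      ext i
      simp [hQ]
    rw [this]
    rfl
  have h0 : (shift P Q F).coeff 0 = algebraMap _ (RatFuncField m) F := by
    simpa [haeval] using coeff_shift P Q 0 F
  have h1 : (shift P Q F).coeff 1 = algebraMap _ (RatFuncField m) (dirDeriv P F) := by
    simpa [haeval] using coeff_shift P Q 1 F
  have h2 : (shift P Q F).coeff 2 = algebraMap _ (RatFuncField m) (halfSndDeriv P F) := by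
    have h := coeff_shift P Q 2 F
    rw [Function.iterate_succ_apply', Function.iterate_one, dirDeriv_dirDeriv, haeval, map_mul,
      show (C 2 : MvPolynomial (Fin m) ℂ) = 2 from map_ofNat C 2, map_ofNat] at h
    norm_num [Nat.factorial] at h
    exact h
  have h3 : (shift P Q F).coeff 3 =
      algebraMap (MvPolynomial (Fin m) ℂ) (RatFuncField m) (C (eval P F)) := by
    have h := coeff_shift P Q 3 F
    rw [Function.iterate_succ_apply', Function.iterate_succ_apply', Function.iterate_one,
      dirDeriv_three hF, haeval, C_mul, map_mul,
      show (C 6 : MvPolynomial (Fin m) ℂ) = 6 from map_ofNat C 6, map_ofNat] at h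
    norm_num [Nat.factorial] at h
    exact h
  rw [Cubic.map, Cubic.toPoly, Polynomial.as_sum_range' _ 4
    (Nat.lt_succ_of_le (natDegree_shift_le P Q hF))]
  simp only [Finset.sum_range_succ, Finset.sum_range_zero, ← Polynomial.C_mul_X_pow_eq_monomial,
    h0, h1, h2, h3, lineCubic]
  ring

lemma nonempty_gal_fFP (hm : 3 ≤ m) (hF : F.IsHomogeneous 3)
    (hsm : ∀ Q : Fin m → ℂ, Q ≠ 0 → ∃ i, eval Q (pderiv i F) ≠ 0) {P : Fin m → ℂ}
    (hP : eval P F ≠ 0) (hq : depressedQuadric F P ≠ 0) :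
    Nonempty ((fFP F P).Gal ≃* Equiv.Perm (Fin 3)) := by
  have hinj := IsFractionRing.injective (MvPolynomial (Fin m) ℂ) (RatFuncField m)
  rw [fFP_eq_toPoly hF]
  refine nonempty_gal_mulEquiv_perm_fin_three _ ?_ ?_ ?_
  · simpa [Cubic.map, lineCubic] using hP
  · intro x hx
    set a : MvPolynomial (Fin m) ℂ := C (eval P F)⁻¹ with ha
    have haC : a * C (eval P F) = 1 := by
      rw [ha, ← C_mul, inv_mul_cancel₀ hP, C_1]
    have hxR : IsIntegral (MvPolynomial (Fin m) ℂ) x := by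
      refine ⟨Cubic.toPoly ⟨1, a * halfSndDeriv P F, a * dirDeriv P F, a * F⟩,
        Cubic.monic_of_a_eq_one rfl, ?_⟩
      have hx' := hx
      have h1 := congrArg (algebraMap _ (RatFuncField m)) haC
      simp only [map_mul, map_one] at h1
      simp [Cubic.map, Cubic.toPoly, lineCubic] at hx' ⊢
      linear_combination algebraMap _ (RatFuncField m) a * hx' - x ^ 3 * h1
    obtain ⟨r, rfl⟩ := IsIntegrallyClosed.isIntegral_iff.mp hxR
    refine lineCubic_no_root hm hF hP hsm r (hinj ?_)
    simpa [Cubic.map, Cubic.toPoly, lineCubic] using hx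
  · intro d hd
    have hdisc : ((lineCubic F P).map (algebraMap _ (RatFuncField m))).discr =
        algebraMap _ (RatFuncField m) (lineCubic F P).discr := by
      simp [Cubic.discr, Cubic.map, map_ofNat]
    rw [hdisc] at hd
    obtain ⟨d, rfl⟩ := IsIntegrallyClosed.exists_algebraMap_eq_of_isIntegral_pow
      (R := MvPolynomial (Fin m) ℂ) (two_pos) (hd ▸ isIntegral_algebraMap)
    rw [← map_pow] at hd
    exact discr_lineCubic_ne_sq hm hF hP hsm hq d (hinj hd)

end Galois

section Genericity

open MvPolynomial

/-- Monomials of degree `k` in which the variable `x_j` does not occur. -/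
abbrev MonomialsAvoiding {m : ℕ} (j : Fin m) (k : ℕ) : Type :=
  {s : Fin m →₀ ℕ // s.degree = k ∧ s j = 0}

instance {m : ℕ} (j : Fin m) (k : ℕ) : Finite (MonomialsAvoiding j k) :=
  ((Finsupp.finite_of_degree_le k).subset fun _ hs => hs.1.le).to_subtype

instance {m : ℕ} (k : ℕ) : Finite {s : Fin m →₀ ℕ // s.degree = k} :=
  ((Finsupp.finite_of_degree_le k).subset fun _ hs => le_of_eq hs).to_subtype

lemma MvPolynomial.IsHomogeneous.eval_eq_sum_monomialsAvoiding {m k : ℕ}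
    {G : MvPolynomial (Fin m) ℂ} (hG : G.IsHomogeneous k) {j : Fin m}
    [Fintype (MonomialsAvoiding j k)] {y : Fin m → ℂ} (hy : y j = 0) :
    eval y G = ∑ s : MonomialsAvoiding j k, coeff s.1 G * ∏ i, y i ^ s.1 i := by
  classical
  have hfin : {s : Fin m →₀ ℕ | s.degree = k ∧ s j = 0}.Finite :=
    (Finsupp.finite_of_degree_le k).subset fun _ hs => hs.1.le
  rw [← Finset.sum_subtype (p := fun s : Fin m →₀ ℕ => s.degree = k ∧ s j = 0) hfin.toFinset
    (fun s => by simp) (fun s => coeff s G * ∏ i, y i ^ s i), eval_eq']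
  refine Finset.sum_congr_of_eq_on_inter (fun s hs hs' => ?_) (fun s _ hs => ?_) fun _ _ _ => rfl
  · have hsj : s j ≠ 0 := by
      have hdeg : s.degree = k := by
        by_contra hne
        exact mem_support_iff.mp hs (hG.coeff_eq_zero hne)
      simpa [hdeg] using hs'
    rw [Finset.prod_eq_zero (Finset.mem_univ j) (by rw [hy, zero_pow hsj]), mul_zero]
  · rw [notMem_support_iff.mp hs, zero_mul]

lemma exists_ne_zero_vanishing_on_family {m k : ℕ} {ι : Type}
    (H : MvPolynomial (Fin m) (MvPolynomial ι ℂ))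
    (e : Option ι → {s : Fin m →₀ ℕ // s.degree = k}) (he : Function.Injective e) :
    ∃ Φ : MvPolynomial {s : Fin m →₀ ℕ // s.degree = k} ℂ, Φ ≠ 0 ∧
      ∀ v : ι → ℂ, eval (fun s => coeff s.1 (map (eval v) H)) Φ = 0 := by
  have hfin : Finite (Option ι) := Finite.of_injective e he
  have : Finite ι := Finite.of_injective (some : ι → Option ι) (Option.some_injective ι)
  have hdep : ¬ AlgebraicIndependent ℂ
      (fun s : {s : Fin m →₀ ℕ // s.degree = k} => coeff s.1 H) := by
    intro h
    have hle := h.cardinalMk_le_trdeg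
    rw [MvPolynomial.trdeg_of_isDomain, Cardinal.lift_id] at hle
    have hle' := (Cardinal.mk_le_of_injective he).trans hle
    rw [Cardinal.mk_option] at hle'
    rw [← Nat.cast_card (α := ι)] at hle'
    norm_cast at hle'
    omega
  rw [algebraicIndependent_iff] at hdep
  push Not at hdep
  obtain ⟨Φ, hΦ, hne⟩ := hdep
  refine ⟨Φ, hne, fun v => ?_⟩
  have h := congrArg (eval v) hΦ
  rw [map_zero, aeval_def, ← coe_eval₂Hom, map_eval₂Hom] at h
  rw [← h, eval, coe_eval₂Hom, coe_eval₂Hom]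
  congr 1
  ext
  simp

lemma exists_injective_monomials_of_singular {m : ℕ} (j : Fin m) :
    ∃ e : Option (MonomialsAvoiding j 3 ⊕ MonomialsAvoiding j 2 ⊕ {i // i ≠ j}) →
      {s : Fin m →₀ ℕ // s.degree = 3}, Function.Injective e := by
  refine ⟨fun o => match o with
    | none => ⟨Finsupp.single j 3, by simp⟩
    | some (.inl s) => ⟨s.1, s.2.1⟩
    | some (.inr (.inl s)) => ⟨Finsupp.single j 1 + s.1, by simp [s.2.1]⟩
    | some (.inr (.inr i)) => ⟨Finsupp.single j 2 + Finsupp.single i.1 1, by simp⟩, ?_⟩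
  rintro (_ | s | s | s) (_ | t | t | t) h <;>
    have hval := congrArg Subtype.val h <;> have hj := DFunLike.congr_fun hval j
  all_goals grind -ext [Finsupp.add_apply, add_right_inj, Finsupp.single_left_inj]

lemma exists_injective_monomials_of_depressed {m : ℕ} (hm : 3 ≤ m) (j : Fin m) :
    ∃ e : Option (MonomialsAvoiding j 3 ⊕ Fin m ⊕ {i // i ≠ j}) →
      {s : Fin m →₀ ℕ // s.degree = 3}, Function.Injective e := by
  obtain ⟨k, l, hk, hl, hkl⟩ := exists_two_ne hm j
  refine ⟨fun o => match o with
    | none => ⟨Finsupp.single j 1 + Finsupp.single k 1 + Finsupp.single l 1, by simp⟩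
    | some (.inl s) => ⟨s.1, s.2.1⟩
    | some (.inr (.inl i)) => ⟨Finsupp.single j 1 + Finsupp.single i 2, by simp⟩
    | some (.inr (.inr i)) => ⟨Finsupp.single j 2 + Finsupp.single i.1 1, by simp⟩, ?_⟩
  rintro (_ | s | s | s) (_ | t | t | t) h <;>
    have hval := congrArg Subtype.val h <;> have hvj := DFunLike.congr_fun hval j <;>
    have hvk := DFunLike.congr_fun hval k <;> have hvl := DFunLike.congr_fun hval l
  all_goals grind -ext [Finsupp.add_apply, add_right_inj, Finsupp.single_left_inj]

/-- Euler's identity for a linear form, whose partial derivatives are constants. -/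
lemma MvPolynomial.IsHomogeneous.eval_eq_sum_pderiv {m : ℕ} {G : MvPolynomial (Fin m) ℂ}
    (hG : G.IsHomogeneous 1) (x : Fin m → ℂ) : eval x G = ∑ i, eval 0 (pderiv i G) * x i := by
  have hx := eval_add_smul_of_isHomogeneous_one hG x 0 1
  rw [zero_add, one_smul, hG.eval_zero_eq_zero one_ne_zero, dirDeriv_eq_sum, map_sum, zero_add,
    one_mul] at hx
  simpa [mul_comm] using hx

lemma eval_halfSndDeriv_eq_zero_of_singular {m : ℕ} {F : MvPolynomial (Fin m) ℂ}
    (hF : F.IsHomogeneous 3) {Q : Fin m → ℂ} (hQ : ∀ i, eval Q (pderiv i F) = 0)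
    (y : Fin m → ℂ) : eval y (halfSndDeriv Q F) = 0 := by
  rw [(hF.halfSndDeriv Q).eval_eq_sum_pderiv]
  refine Finset.sum_eq_zero fun i _ => ?_
  have hi := eval_add_smul_pderiv hF Q 0 1 i
  rw [zero_add, one_smul, hQ, IsHomogeneous.eval_zero_eq_zero (hF.pderiv) two_ne_zero,
    IsHomogeneous.eval_zero_eq_zero ((hF.dirDeriv Q).pderiv) one_ne_zero] at hi
  rw [(by linear_combination -hi : eval 0 (pderiv i (halfSndDeriv Q F)) = 0), zero_mul]

lemma eval_eq_zero_of_singular {m : ℕ} {F : MvPolynomial (Fin m) ℂ}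
    (hF : F.IsHomogeneous 3) {Q : Fin m → ℂ} (hQ : ∀ i, eval Q (pderiv i F) = 0) :
    eval Q F = 0 := by
  have h := eval_add_smul_dirDeriv hF Q 0 1
  rw [zero_add, one_smul, dirDeriv_eq_sum, map_sum, Finset.sum_eq_zero (fun i _ => by
    rw [map_mul, hQ, mul_zero]), ← dirDeriv_eq_sum, eval_halfSndDeriv_eq_zero_of_singular hF hQ,
    (hF.dirDeriv Q).eval_zero_eq_zero two_ne_zero] at h
  linear_combination -h / 3

lemma exists_ne_zero_vanishing_on_singular {m : ℕ} (j : Fin m) :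
    ∃ Φ : MvPolynomial {s : Fin m →₀ ℕ // s.degree = 3} ℂ, Φ ≠ 0 ∧
      ∀ F : MvPolynomial (Fin m) ℂ, F.IsHomogeneous 3 →
        (∃ Q : Fin m → ℂ, Q j ≠ 0 ∧ ∀ i, eval Q (pderiv i F) = 0) →
        eval (fun s => coeff s.1 F) Φ = 0 := by
  classical
  have := Fintype.ofFinite (MonomialsAvoiding j 3)
  have := Fintype.ofFinite (MonomialsAvoiding j 2)
  let ι := MonomialsAvoiding j 3 ⊕ MonomialsAvoiding j 2 ⊕ {i // i ≠ j}
  let p : Fin m → MvPolynomial ι ℂ :=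
    fun i => if h : i = j then 1 else X (.inr (.inr ⟨i, h⟩))
  let H : MvPolynomial (Fin m) (MvPolynomial ι ℂ) :=
    ∑ s : MonomialsAvoiding j 3, C (X (.inl s)) * ∏ i, (X i - C (p i) * X j) ^ s.1 i +
    X j * ∑ s : MonomialsAvoiding j 2, C (X (.inr (.inl s))) *
      ∏ i, (X i - C (p i) * X j) ^ s.1 i
  obtain ⟨e, he⟩ := exists_injective_monomials_of_singular j
  obtain ⟨Φ, hΦ, hv⟩ := exists_ne_zero_vanishing_on_family H e he
  refine ⟨Φ, hΦ, ?_⟩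
  rintro F hF ⟨Q, hQj, hQ⟩
  let v : ι → ℂ := Sum.elim (fun s => coeff s.1 F)
    (Sum.elim (fun s => (Q j)⁻¹ * coeff s.1 (dirDeriv Q F)) fun i => Q i / Q j)
  have hp : ∀ i, eval v (p i) = Q i / Q j := by
    intro i
    by_cases h : i = j
    · simp [p, h, hQj]
    · simp [p, h, v]
  convert hv v using 3
  funext s
  congr 1
  refine MvPolynomial.funext fun x => ?_
  set y : Fin m → ℂ := fun i => x i - Q i / Q j * x j with hy
  have hyj : y j = 0 := by simp [hy, hQj]
  have hx : x = y + (x j / Q j) • Q := by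
    funext i
    simp [hy]
    ring
  have hxF : eval x F = eval y F + x j / Q j * eval y (dirDeriv Q F) := by
    conv_lhs => rw [hx]
    rw [eval_add_smul hF, eval_eq_zero_of_singular hF hQ,
      eval_halfSndDeriv_eq_zero_of_singular hF hQ]
    ring
  rw [hxF, hF.eval_eq_sum_monomialsAvoiding hyj,
    (hF.dirDeriv Q).eval_eq_sum_monomialsAvoiding hyj]
  simp only [H, map_add, map_sum, map_mul, map_prod, map_pow, map_sub, map_C, map_X, eval_C,
    eval_X, hp, v, Sum.elim_inl, Sum.elim_inr, Finset.mul_sum]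
  congr 1
  refine Finset.sum_congr rfl fun s _ => ?_
  ring

lemma exists_ne_zero_vanishing_on_depressed {m : ℕ} (hm : 3 ≤ m) (j : Fin m) :
    ∃ Φ : MvPolynomial {s : Fin m →₀ ℕ // s.degree = 3} ℂ, Φ ≠ 0 ∧
      ∀ F : MvPolynomial (Fin m) ℂ, F.IsHomogeneous 3 →
        (∃ P : Fin m → ℂ, P j ≠ 0 ∧ eval P F ≠ 0 ∧ depressedQuadric F P = 0) →
        eval (fun s => coeff s.1 F) Φ = 0 := by
  classical
  have := Fintype.ofFinite (MonomialsAvoiding j 3)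
  let ι := MonomialsAvoiding j 3 ⊕ Fin m ⊕ {i // i ≠ j}
  let p : Fin m → MvPolynomial ι ℂ :=
    fun i => if h : i = j then 1 else X (.inr (.inr ⟨i, h⟩))
  let H : MvPolynomial (Fin m) (MvPolynomial ι ℂ) :=
    ∑ s : MonomialsAvoiding j 3, C (X (.inl s)) * ∏ i, (X i - C (p i) * X j) ^ s.1 i +
    (∑ i, C (X (.inr (.inl i))) * X i) ^ 3
  obtain ⟨e, he⟩ := exists_injective_monomials_of_depressed hm j
  obtain ⟨Φ, hΦ, hv⟩ := exists_ne_zero_vanishing_on_family H e he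
  refine ⟨Φ, hΦ, ?_⟩
  rintro F hF ⟨P, hPj, hP, hq⟩
  obtain ⟨κ, hκ⟩ := IsAlgClosed.exists_pow_nat_eq (27 * eval P F ^ 2)⁻¹ (n := 3) (by norm_num)
  have hκ' : κ ^ 3 * (27 * eval P F ^ 2) = 1 := by
    rw [hκ, inv_mul_cancel₀ (mul_ne_zero (by norm_num) (pow_ne_zero 2 hP))]
  let G : MvPolynomial (Fin m) ℂ := F - C (κ ^ 3) * halfSndDeriv P F ^ 3
  have hG : G.IsHomogeneous 3 := hF.sub (((hF.halfSndDeriv P).pow 3).C_mul _)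
  let v : ι → ℂ := Sum.elim (fun s => coeff s.1 G)
    (Sum.elim (fun i => κ * eval 0 (pderiv i (halfSndDeriv P F))) fun i => P i / P j)
  have hp : ∀ i, eval v (p i) = P i / P j := by
    intro i
    by_cases h : i = j
    · simp [p, h, hPj]
    · simp [p, h, v]
  convert hv v using 3
  funext s
  congr 1
  refine MvPolynomial.funext fun x => ?_
  set y : Fin m → ℂ := fun i => x i - P i / P j * x j with hy
  have hyj : y j = 0 := by simp [hy, hPj]
  have hx : x = y + (x j / P j) • P := by
    funext i
    simp [hy]
    ring
  have hxF : eval x F = eval y G + (κ * eval x (halfSndDeriv P F)) ^ 3 := by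
    have hBx := eval_add_smul_halfSndDeriv hF P y (x j / P j)
    have hFx := eval_add_smul hF P y (x j / P j)
    rw [← hx] at hBx hFx
    have hqy := congrArg (eval y) hq
    simp only [depressedQuadric, map_sub, map_mul, map_pow, eval_C, map_zero] at hqy
    rw [hBx, hFx]
    simp only [G, map_sub, map_mul, map_pow, eval_C]
    linear_combination -(9 * (x j / P j) * eval P F * κ ^ 3) * hqy -
      (x j / P j * eval y (dirDeriv P F) + (x j / P j) ^ 2 * eval y (halfSndDeriv P F) +
        (x j / P j) ^ 3 * eval P F) * hκ'
  rw [hxF, hG.eval_eq_sum_monomialsAvoiding hyj, (hF.halfSndDeriv P).eval_eq_sum_pderiv]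
  simp only [H, map_add, map_sum, map_mul, map_prod, map_pow, map_sub, map_C, map_X, eval_C,
    eval_X, hp, v, Sum.elim_inl, Sum.elim_inr, Finset.mul_sum]
  congr 2
  refine Finset.sum_congr rfl fun s _ => ?_
  ring

/-- A general cubic is smooth and none of its depressed quadrics vanishes. -/
lemma exists_generic_condition {m : ℕ} (hm : 3 ≤ m) :
    ∃ Φ : MvPolynomial {s : Fin m →₀ ℕ // s.degree = 3} ℂ, Φ ≠ 0 ∧
      ∀ F : MvPolynomial (Fin m) ℂ, F.IsHomogeneous 3 → eval (fun s => coeff s.1 F) Φ ≠ 0 →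
        (∀ Q : Fin m → ℂ, Q ≠ 0 → ∃ i, eval Q (pderiv i F) ≠ 0) ∧
        ∀ P : Fin m → ℂ, eval P F ≠ 0 → depressedQuadric F P ≠ 0 := by
  choose Φ hΦ hΦF using fun j : Fin m => exists_ne_zero_vanishing_on_singular j
  choose Ψ hΨ hΨF using fun j : Fin m => exists_ne_zero_vanishing_on_depressed hm j
  refine ⟨∏ j, Φ j * Ψ j, Finset.prod_ne_zero_iff.mpr fun j _ => mul_ne_zero (hΦ j) (hΨ j),
    fun F hF hne => ?_⟩
  rw [map_prod, Finset.prod_ne_zero_iff] at hne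
  simp only [map_mul, mul_ne_zero_iff, Finset.mem_univ, forall_true_left] at hne
  refine ⟨fun Q hQ => ?_, fun P hP hq => ?_⟩
  · obtain ⟨j, hj⟩ : ∃ j, Q j ≠ 0 := Function.ne_iff.mp hQ
    by_contra! hcon
    exact (hne j).1 (hΦF j F hF ⟨Q, hj, hcon⟩)
  · have hP0 : P ≠ 0 := by
      rintro rfl
      exact hP (hF.eval_zero_eq_zero three_ne_zero)
    obtain ⟨j, hj⟩ : ∃ j, P j ≠ 0 := Function.ne_iff.mp hP0
    exact (hne j).2 (hΨF j F hF ⟨P, hj, hP, hq⟩)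

lemma exists_isHomogeneous_coeff_eq {m k : ℕ} (c : {s : Fin m →₀ ℕ // s.degree = k} → ℂ) :
    ∃ F : MvPolynomial (Fin m) ℂ, F.IsHomogeneous k ∧ ∀ s, coeff s.1 F = c s := by
  classical
  have := Fintype.ofFinite {s : Fin m →₀ ℕ // s.degree = k}
  refine ⟨∑ s : {s : Fin m →₀ ℕ // s.degree = k}, monomial s.1 (c s),
    IsHomogeneous.sum _ _ _ fun s _ => isHomogeneous_monomial _ s.2, fun s => ?_⟩
  simp [coeff_sum, coeff_monomial, Subtype.coe_inj]

end Genericity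
/-- For all `n ≥ 1`, a general homogeneous cubic `F` in `n+2` variables (i.e. all `F` in the
nonvanishing locus of some polynomial function `Φ` on `V_3` that is not identically zero on
`V_3`) satisfies: for every point `P ∈ ℂ^{n+2}` with `F(P) ≠ 0`, the Galois group of the
splitting field of the cubic `f_{F,P}` over `K` is isomorphic to the full symmetric group `S_3`
(in particular it is not `A_3`). -/
theorem general_cubic_all_points_uniform (n : ℕ) (hn : 1 ≤ n) :
    ∃ Φ : MvPolynomial ((Fin (n + 2)) →₀ ℕ) ℂ,
      (∃ F₀ : MvPolynomial (Fin (n + 2)) ℂ, F₀.IsHomogeneous 3 ∧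
        MvPolynomial.eval (fun s => MvPolynomial.coeff s F₀) Φ ≠ 0) ∧
      ∀ F : MvPolynomial (Fin (n + 2)) ℂ, F.IsHomogeneous 3 →
        MvPolynomial.eval (fun s => MvPolynomial.coeff s F) Φ ≠ 0 →
        ∀ P : Fin (n + 2) → ℂ, MvPolynomial.eval P F ≠ 0 →
          Nonempty ((fFP F P).Gal ≃* Equiv.Perm (Fin 3)) := by
  have hm : 3 ≤ n + 2 := by omega
  obtain ⟨Φ, hΦ, hΦF⟩ := exists_generic_condition hm
  have hcoe : ∀ F : MvPolynomial (Fin (n + 2)) ℂ,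
      MvPolynomial.eval (fun s => MvPolynomial.coeff s F) (MvPolynomial.rename Subtype.val Φ) =
        MvPolynomial.eval (fun s => MvPolynomial.coeff s.1 F) Φ :=
    fun F => MvPolynomial.eval_rename _ _ _
  refine ⟨MvPolynomial.rename Subtype.val Φ, ?_, fun F hF hne P hP => ?_⟩
  · obtain ⟨c, hc⟩ : ∃ c, MvPolynomial.eval c Φ ≠ 0 := by
      by_contra! h
      exact hΦ (MvPolynomial.funext fun c => by rw [h c, map_zero])
    obtain ⟨F₀, hF₀, hF₀c⟩ := exists_isHomogeneous_coeff_eq c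
    refine ⟨F₀, hF₀, ?_⟩
    rwa [hcoe, funext hF₀c]
  · rw [hcoe] at hne
    obtain ⟨hsm, hq⟩ := hΦF F hF hne
    exact nonempty_gal_fFP hm hF hsm hP (hq P hP)
end
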